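/- arXiv:1406.5482 — 3 statements merged into one kernel-verified Lean document; each statement's English description precedes it below -/
import Mathlib

section
/- Let f : U → U be a discrete dynamical system on an open set U ⊆ ℝ³ and let K be an attractor for f. Then K has a neighbourhood basis consisting of compact topological 3-manifolds with boundary, all homeomorphic to each other. More precisely, if N ⊆ 𝒜(K) is any compact neighbourhood of K that is a topological 3-manifold with boundary, then the sets N_k := f^k(N) (k ∈ ℕ) form a neighbourhood basis of K and each restriction f^k|_N : N → N_k is a homeomorphism onto N_k. -/
open Set

noncomputable section

/-- Euclidean 3-space. -/
abbrev R3 := EuclideanSpace ℝ (Fin 3)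

/-- The image in `ℝ³` of a set `P ⊆ ℝ³` under the `n`-th iterate of a map `f : U → U`
defined on (the subtype of) an open set `U ⊆ ℝ³`. -/
def imgIter {U : Set R3} (f : U → U) (n : ℕ) (P : Set R3) : Set R3 :=
  Subtype.val '' (f^[n] '' (Subtype.val ⁻¹' P))

/-- A compact set `P` is attracted by `K` under `f : U → U` if for every neighbourhood `V`
of `K` there is `n₀` such that `fⁿ(P) ⊆ V` for all `n ≥ n₀`. -/
def IsAttracted {U : Set R3} (f : U → U) (K P : Set R3) : Prop :=
  ∀ V : Set R3, K ⊆ interior V → ∃ n₀ : ℕ, ∀ n ≥ n₀, imgIter f n P ⊆ V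

/-- `K` is an attractor for the discrete dynamical system `f : U → U`: it is compact,
invariant (`f(K) = K`), and has a neighbourhood `A ⊆ U` all of whose compact subsets
are attracted by `K`. -/
def IsAttractor {U : Set R3} (f : U → U) (K : Set R3) : Prop :=
  IsCompact K ∧ K ⊆ U ∧ imgIter f 1 K = K ∧
    ∃ A : Set R3, A ⊆ U ∧ K ⊆ interior A ∧
      ∀ P : Set R3, IsCompact P → P ⊆ A → IsAttracted f K P

/-- The closed half-space `{x ∈ ℝ³ : x₃ ≥ 0}`. -/
def HalfSpace3 : Set R3 := {x | 0 ≤ x 2}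

/-- `M ⊆ ℝ³` is a topological 3-manifold with boundary if every point of `M` has an open
neighbourhood in `M` homeomorphic to an open subset of the closed half-space. -/
def IsManifold3WithBoundary (M : Set R3) : Prop :=
  ∀ p : M, ∃ V : Set M, IsOpen V ∧ p ∈ V ∧
    ∃ W : Set ↥HalfSpace3, IsOpen W ∧ Nonempty (↥V ≃ₜ ↥W)

/-- The basin of attraction `𝒜(K)` of `K`: the union of all neighbourhoods `A ⊆ U` of `K`
each of whose compact subsets is attracted by `K`. -/
def Basin {U : Set R3} (f : ↥U → ↥U) (K : Set R3) : Set R3 :=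
  ⋃₀ {A : Set R3 | A ⊆ U ∧ K ⊆ interior A ∧
      ∀ P : Set R3, IsCompact P → P ⊆ A → IsAttracted f K P}

open MeasureTheory Metric Filter Topology
open scoped NNReal

theorem exists_det_one_add_smul_eq_cubic (A : R3 →L[ℝ] R3) :
    ∃ a b c : ℝ, ∀ t : ℝ,
      (ContinuousLinearMap.id ℝ R3 + t • A).det = 1 + a * t + b * t ^ 2 + c * t ^ 3 := by
  let B := (EuclideanSpace.basisFun (Fin 3) ℝ).toBasis
  let M := LinearMap.toMatrix B B (A : R3 →ₗ[ℝ] R3)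
  have h (t : ℝ) : (ContinuousLinearMap.id ℝ R3 + t • A).det = (1 + t • M).det := by
    rw [ContinuousLinearMap.det, ← LinearMap.det_toMatrix B]
    rw [ContinuousLinearMap.toLinearMap_add, ContinuousLinearMap.toLinearMap_smul, map_add,
      map_smul, ContinuousLinearMap.coe_id, LinearMap.toMatrix_id]
  refine ⟨M 0 0 + M 1 1 + M 2 2,
    M 0 0 * M 1 1 - M 0 1 * M 1 0 + M 0 0 * M 2 2 - M 0 2 * M 2 0 + M 1 1 * M 2 2
      - M 1 2 * M 2 1, M.det, fun t => ?_⟩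
  rw [h, Matrix.det_fin_three, Matrix.det_fin_three]
  simp
  ring

theorem det_fderiv_eq_zero_of_norm_eq {g : R3 → R3} {G : R3 →L[ℝ] R3} {x : R3} {R : ℝ}
    (hR : 0 < R) (hg : HasFDerivAt g G x) (hn : ∀ᶠ y in 𝓝 x, ‖g y‖ = R) : G.det = 0 := by
  by_contra hdet
  obtain ⟨v, hv⟩ : ∃ v, G v = g x :=
    ⟨(G.toContinuousLinearEquivOfDetNeZero hdet).symm (g x), 
      (G.toContinuousLinearEquivOfDetNeZero hdet).apply_symm_apply (g x)⟩
  have h1 := hg.norm_sq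
  have h2 : HasFDerivAt (fun y => ‖g y‖ ^ 2) (0 : R3 →L[ℝ] ℝ) x :=
    (hasFDerivAt_const (R ^ 2) x).congr_of_eventuallyEq (hn.mono fun y hy => by simp [hy])
  have h3 := congrArg (fun T : R3 →L[ℝ] ℝ => T v) (h1.unique h2)
  have h4 : ‖g x‖ = R := hn.self_of_nhds
  simp [hv, h4] at h3
  exact hR.ne' h3

theorem exists_small_perturbation_volume_image :
    ∃ δ : ℝ≥0, 0 < δ ∧ ∀ F : R3 → R3,
      ApproximatesLinearOn F (ContinuousLinearMap.id ℝ R3) univ δ →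
        Function.Bijective F ∧ (∀ s : Set R3, volume s = 0 → volume (F '' s) = 0) ∧
        ∀ (x : R3) (G : R3 →L[ℝ] R3), HasFDerivAt F G x → 0 < G.det := by
  have h1 : ∀ᶠ δ : ℝ≥0 in 𝓝[>] 0, ∀ (s : Set R3) (F : R3 → R3),
      ApproximatesLinearOn F (ContinuousLinearMap.id ℝ R3) s δ →
        volume (F '' s) ≤ (2 : ℝ≥0) * volume s :=
    addHaar_image_le_mul_of_det_lt volume _ (by simp [ContinuousLinearMap.det])
  have h2 : ∀ᶠ G : R3 →L[ℝ] R3 in 𝓝 (ContinuousLinearMap.id ℝ R3), 0 < G.det :=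
    ContinuousLinearMap.continuous_det.continuousAt.eventually
      (lt_mem_nhds (by simp [ContinuousLinearMap.det]))
  obtain ⟨η, hη, h2⟩ := Metric.eventually_nhds_iff.1 h2
  have h3 : ∀ᶠ δ : ℝ≥0 in 𝓝[>] 0, δ < min 1 η.toNNReal :=
    nhdsWithin_le_nhds (gt_mem_nhds (by simpa using hη))
  obtain ⟨δ, ⟨h1, h3⟩, hδ⟩ := ((h1.and h3).and self_mem_nhdsWithin).exists
  refine ⟨δ, hδ, fun F hF => ⟨?_, ?_, ?_⟩⟩
  · have hF' : ApproximatesLinearOn F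
        ((ContinuousLinearEquiv.refl ℝ R3 : R3 ≃L[ℝ] R3) : R3 →L[ℝ] R3) univ δ := hF
    have hc : Subsingleton R3 ∨
        δ < ‖((ContinuousLinearEquiv.refl ℝ R3).symm : R3 →L[ℝ] R3)‖₊⁻¹ := by
      right
      have : ‖((ContinuousLinearEquiv.refl ℝ R3).symm : R3 →L[ℝ] R3)‖₊ = 1 := by
        ext; simp
      rw [this, inv_one]
      exact h3.trans_le (min_le_left _ _)
    exact ⟨injOn_univ.1 (hF'.injOn hc), hF'.surjective hc⟩
  · intro s hs
    simpa [hs] using h1 s F (hF.mono_set (subset_univ s))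
  · intro x G hG
    apply h2
    have h4 : LipschitzWith δ (F - ⇑(ContinuousLinearMap.id ℝ R3)) :=
      lipschitzOnWith_univ.1 (ApproximatesLinearOn.approximatesLinearOn_iff_lipschitzOnWith.1 hF)
    have h5 := (hG.sub (ContinuousLinearMap.id ℝ R3).hasFDerivAt).le_of_lipschitz h4
    rw [dist_eq_norm]
    refine h5.trans_lt ?_
    have := h3.trans_le (min_le_right _ _)
    exact (Real.lt_toNNReal_iff_coe_lt).1 this

theorem no_lipschitz_retraction {g : R3 → R3} {L : ℝ≥0} (hg : LipschitzWith L g) {R : ℝ}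
    (hR : 0 < R) (hin : ∀ x, ‖x‖ < R → ‖g x‖ = R) (hout : ∀ x, R ≤ ‖x‖ → g x = x) : False := by
  obtain ⟨δ, hδ, hpert⟩ := exists_small_perturbation_volume_image
  set h : R3 → R3 := fun x => g x - x with hh
  have hL : LipschitzWith (L + 1) h := hg.sub LipschitzWith.id
  set s : Set R3 := ball 0 R ∩ {x | DifferentiableAt ℝ h x}
  have hsm : MeasurableSet s := measurableSet_ball.inter (measurableSet_of_differentiableAt ℝ h)
  let F : ℝ → R3 → R3 := fun t x => x + t • h x
  have hFd (t : ℝ) (x : R3) (hx : x ∈ s) :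
      HasFDerivAt (F t) (ContinuousLinearMap.id ℝ R3 + t • fderiv ℝ h x) x :=
    (hasFDerivAt_id x).add (hx.2.hasFDerivAt.const_smul t)
  let D : ℝ → R3 → ℝ := fun t x => (ContinuousLinearMap.id ℝ R3 + t • fderiv ℝ h x).det
  set V : ℝ := volume.real (ball (0 : R3) R) with hV
  have key (t : ℝ) (ht : 0 ≤ t) (htδ : t * (L + 1) ≤ δ) :
      IntegrableOn (D t) s ∧
      ∫ x in s, D t x = V := by
    have hA : ApproximatesLinearOn (F t) (ContinuousLinearMap.id ℝ R3) univ δ := by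
      rw [ApproximatesLinearOn.approximatesLinearOn_iff_lipschitzOnWith, lipschitzOnWith_univ]
      apply LipschitzWith.of_dist_le_mul
      intro x y
      have : dist (t • h x) (t • h y) = t * dist (h x) (h y) := by
        rw [dist_smul₀, Real.norm_of_nonneg ht]
      have h2 := hL.dist_le_mul x y
      simp only [F, Pi.sub_apply, ContinuousLinearMap.id_apply, add_sub_cancel_left, this]
      push_cast at h2
      calc t * dist (h x) (h y) ≤ t * ((L + 1) * dist x y) := by gcongr
        _ = (t * (L + 1)) * dist x y := by ring
        _ ≤ δ * dist x y := by gcongr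
    obtain ⟨hbij, hnull, hpos⟩ := hpert _ hA
    have himg : F t '' ball 0 R = ball 0 R := by
      have hfix : ∀ x, x ∉ ball (0 : R3) R → F t x = x := by
        intro x hx
        have := hout x (by simpa using hx)
        simp [F, hh, this]
      apply Subset.antisymm
      · rintro _ ⟨x, hx, rfl⟩
        by_contra hc
        have := hbij.1 (hfix _ hc)
        rw [this] at hc
        exact hc hx
      · intro y hy
        obtain ⟨x, rfl⟩ := hbij.2 y
        refine ⟨x, ?_, rfl⟩
        by_contra hc
        rw [hfix x hc] at hy
        exact hc hy
    have hvol : volume (F t '' s) = volume (ball (0 : R3) R) := by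
      apply le_antisymm
      · exact measure_mono ((image_mono inter_subset_left).trans himg.subset)
      · have hz : volume (F t '' {x | ¬ DifferentiableAt ℝ h x}) = 0 :=
          hnull _ hL.ae_differentiableAt
        calc volume (ball (0 : R3) R) = volume (F t '' ball 0 R) := by rw [himg]
          _ ≤ volume (F t '' s ∪ F t '' {x | ¬ DifferentiableAt ℝ h x}) := by
              rw [← image_union]
              refine measure_mono (image_mono fun x hx => ?_)
              by_cases hd : DifferentiableAt ℝ h x
              · exact Or.inl ⟨hx, hd⟩
              · exact Or.inr hd
          _ ≤ volume (F t '' s) + 0 := (measure_union_le _ _).trans (by rw [hz])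
          _ = _ := add_zero _
    have hFw : ∀ x ∈ s, HasFDerivWithinAt (F t)
        (ContinuousLinearMap.id ℝ R3 + t • fderiv ℝ h x) s x :=
      fun x hx => (hFd t x hx).hasFDerivWithinAt
    have habs : ∀ x ∈ s, |(ContinuousLinearMap.id ℝ R3 + t • fderiv ℝ h x).det| • (1 : ℝ)
        = D t x := by
      intro x hx
      rw [abs_of_pos (hpos x _ (hFd t x hx)), smul_eq_mul, mul_one]
    constructor
    · have := (integrableOn_image_iff_integrableOn_abs_det_fderiv_smul volume hsm hFw
        hbij.1.injOn (fun _ => (1 : ℝ))).1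
        (integrableOn_const (by rw [hvol]; exact measure_ball_lt_top.ne))
      exact this.congr_fun habs hsm
    · have := integral_image_eq_integral_abs_det_fderiv_smul volume hsm hFw
        hbij.1.injOn (fun _ => (1 : ℝ))
      rw [setIntegral_congr_fun hsm habs] at this
      rw [← this, setIntegral_const, smul_eq_mul, mul_one, hV, measureReal_def, hvol,
        measureReal_def]
  obtain ⟨e, he, hesmall⟩ : ∃ e : ℝ, 0 < e ∧ 3 * e * (L + 1) ≤ δ := by
    have hδ' : (0 : ℝ) < δ := hδ
    have hL' : (0 : ℝ) < L + 1 := by positivity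
    exact ⟨δ / (3 * (L + 1)), by positivity, le_of_eq (by field_simp)⟩
  have hLe : 0 < e * (L + 1) := by positivity
  obtain ⟨i0, v0⟩ := key 0 le_rfl (by simp)
  obtain ⟨i1, v1⟩ := key e he.le (by linarith)
  obtain ⟨i2, v2⟩ := key (2 * e) (by positivity) (by linarith)
  obtain ⟨i3, v3⟩ := key (3 * e) (by positivity) hesmall
  -- Lagrange weights, expressing the value at `1` of a cubic by its values at `0, e, 2e, 3e`
  let w0 : ℝ := (1 - e) * (1 - 2 * e) * (1 - 3 * e) / (-6 * e ^ 3)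
  let w1 : ℝ := (1 - 2 * e) * (1 - 3 * e) / (2 * e ^ 3)
  let w2 : ℝ := (1 - e) * (1 - 3 * e) / (-2 * e ^ 3)
  let w3 : ℝ := (1 - e) * (1 - 2 * e) / (6 * e ^ 3)
  have hw : ∀ a b c : ℝ, 1 + a + b + c =
      w0 * (1 + a * 0 + b * 0 ^ 2 + c * 0 ^ 3) + w1 * (1 + a * e + b * e ^ 2 + c * e ^ 3)
      + w2 * (1 + a * (2 * e) + b * (2 * e) ^ 2 + c * (2 * e) ^ 3)
      + w3 * (1 + a * (3 * e) + b * (3 * e) ^ 2 + c * (3 * e) ^ 3) := by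
    intro a b c
    simp only [w0, w1, w2, w3]
    field_simp
    ring
  have hzero : ∀ x ∈ s, 0 =
      w0 * D 0 x
      + w1 * D e x
      + w2 * D (2 * e) x
      + w3 * D (3 * e) x := by
    intro x hx
    obtain ⟨a, b, c, habc⟩ := exists_det_one_add_smul_eq_cubic (fderiv ℝ h x)
    have hd : (ContinuousLinearMap.id ℝ R3 + (1 : ℝ) • fderiv ℝ h x).det = 0 := by
      refine det_fderiv_eq_zero_of_norm_eq hR (hFd 1 x hx) ?_
      filter_upwards [isOpen_ball.mem_nhds hx.1] with y hy
      simpa [F, hh] using hin y (by simpa using hy)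
    rw [habc] at hd
    simp only [D]
    rw [habc, habc, habc, habc, ← hw]
    linarith
  have hint := setIntegral_congr_fun (μ := volume) hsm hzero
  have j1 : IntegrableOn (fun x => w0 * D 0 x + w1 * D e x) s :=
    (i0.const_mul w0).add (i1.const_mul w1)
  have j2 : IntegrableOn (fun x => w0 * D 0 x + w1 * D e x + w2 * D (2 * e) x) s :=
    j1.add (i2.const_mul w2)
  rw [integral_add j2 (i3.const_mul w3), integral_add j1 (i2.const_mul w2),
    integral_add (i0.const_mul w0) (i1.const_mul w1)] at hint
  simp only [integral_const_mul, v0, v1, v2, v3, integral_zero] at hint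
  have h1 := hw 0 0 0
  have hVpos : 0 < V := ENNReal.toReal_pos (measure_ball_pos _ _ hR).ne' measure_ball_lt_top.ne
  have : (w0 + w1 + w2 + w3) = 1 := by linarith
  have : V = 0 := by linear_combination (-V) * this - hint
  exact hVpos.ne' this

/-- The map which is the identity outside the ball of radius `R` and sends the punctured ball
radially onto the sphere. -/
def radialPush (R : ℝ) (y : R3) : R3 := if R ≤ ‖y‖ then y else R • ‖y‖⁻¹ • y

theorem norm_radialPush_of_lt {R : ℝ} (hR : 0 < R) {y : R3} (hy : y ≠ 0) (h : ‖y‖ < R) :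
    ‖radialPush R y‖ = R := by
  rw [radialPush, if_neg h.not_ge, norm_smul, norm_smul, norm_inv, norm_norm,
    inv_mul_cancel₀ (norm_ne_zero_iff.2 hy), mul_one, Real.norm_of_nonneg hR.le]

theorem norm_normalize_sub_le {r : ℝ} (hr : 0 < r) {x y : R3} (hx : r ≤ ‖x‖) (hy : r ≤ ‖y‖) :
    ‖‖x‖⁻¹ • x - ‖y‖⁻¹ • y‖ ≤ 2 / r * ‖x - y‖ := by
  have hx0 : 0 < ‖x‖ := hr.trans_le hx
  have hy0 : 0 < ‖y‖ := hr.trans_le hy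
  have h1 : ‖x‖⁻¹ • x - ‖y‖⁻¹ • y = ‖x‖⁻¹ • (x - y) + (‖x‖⁻¹ - ‖y‖⁻¹) • y := by module
  have h2 : ‖(‖x‖⁻¹ - ‖y‖⁻¹) • y‖ ≤ ‖x‖⁻¹ * ‖x - y‖ := by
    have : ‖x‖⁻¹ - ‖y‖⁻¹ = (‖y‖ - ‖x‖) * (‖x‖⁻¹ * ‖y‖⁻¹) := by field_simp
    rw [norm_smul, this, norm_mul, norm_mul, norm_inv, norm_inv, norm_norm, norm_norm]
    have h3 : ‖‖y‖ - ‖x‖‖ ≤ ‖x - y‖ := by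
      rw [norm_sub_rev x y]; exact abs_norm_sub_norm_le y x
    calc ‖‖y‖ - ‖x‖‖ * (‖x‖⁻¹ * ‖y‖⁻¹) * ‖y‖ = ‖x‖⁻¹ * ‖‖y‖ - ‖x‖‖ := by field_simp
      _ ≤ _ := by gcongr
  have h4 : ‖x‖⁻¹ ≤ r⁻¹ := inv_anti₀ hr hx
  calc _ ≤ ‖‖x‖⁻¹ • (x - y)‖ + ‖(‖x‖⁻¹ - ‖y‖⁻¹) • y‖ := h1 ▸ norm_add_le _ _
    _ ≤ ‖x‖⁻¹ * ‖x - y‖ + ‖x‖⁻¹ * ‖x - y‖ := by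
        rw [norm_smul, norm_inv, norm_norm]; gcongr
    _ ≤ r⁻¹ * ‖x - y‖ + r⁻¹ * ‖x - y‖ := by gcongr
    _ = _ := by ring

theorem exists_lipschitzOnWith_radialPush {R r : ℝ} (hR : 0 < R) (hr : 0 < r) :
    ∃ C, LipschitzOnWith C (radialPush R) {y | r ≤ ‖y‖} := by
  refine ⟨(1 + R * (2 / r)).toNNReal, LipschitzOnWith.of_dist_le_mul ?_⟩
  have mixed : ∀ x y : R3, r ≤ ‖x‖ → r ≤ ‖y‖ → R ≤ ‖x‖ → ‖y‖ < R →
      ‖x - R • ‖y‖⁻¹ • y‖ ≤ (1 + R * (2 / r)) * ‖x - y‖ := by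
    intro x y hx hy hxR hyR
    have hx0 : 0 < ‖x‖ := hr.trans_le hx
    have h1 : x - R • ‖y‖⁻¹ • y =
        (‖x‖ - R) • ‖x‖⁻¹ • x + R • (‖x‖⁻¹ • x - ‖y‖⁻¹ • y) := by
      have : x = ‖x‖ • ‖x‖⁻¹ • x := (smul_inv_smul₀ hx0.ne' x).symm
      rw [smul_sub, sub_smul, ← this]
      abel
    have h2 : ‖(‖x‖ - R) • ‖x‖⁻¹ • x‖ ≤ ‖x - y‖ := by
      rw [norm_smul, norm_smul, norm_inv, norm_norm, inv_mul_cancel₀ hx0.ne', mul_one,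
        Real.norm_of_nonneg (by linarith)]
      have := norm_sub_norm_le x y
      linarith
    have h3 := norm_normalize_sub_le hr hx hy
    calc _ ≤ ‖(‖x‖ - R) • ‖x‖⁻¹ • x‖ + ‖R • (‖x‖⁻¹ • x - ‖y‖⁻¹ • y)‖ := h1 ▸ norm_add_le _ _
      _ ≤ ‖x - y‖ + R * (2 / r * ‖x - y‖) := by
        rw [norm_smul R, Real.norm_of_nonneg hR.le]; gcongr
      _ = _ := by ring
  intro x hx y hy
  have hC : 0 ≤ R * (2 / r) := by positivity
  rw [Real.coe_toNNReal _ (by positivity), dist_eq_norm, dist_eq_norm]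
  simp only [mem_ofPred_eq] at hx hy
  unfold radialPush
  split_ifs with h1 h2 h2
  · exact le_mul_of_one_le_left (norm_nonneg _) (by linarith)
  · exact mixed x y hx hy h1 (not_le.1 h2)
  · rw [norm_sub_rev, norm_sub_rev x y]
    exact mixed y x hy hx h2 (not_le.1 h1)
  · rw [← smul_sub, norm_smul, Real.norm_of_nonneg hR.le]
    have := norm_normalize_sub_le hr hx hy
    calc _ ≤ R * (2 / r * ‖x - y‖) := by gcongr
      _ ≤ _ := by nlinarith [norm_nonneg (x - y)]

/-- A form of Brouwer's fixed point theorem: a continuous map close to the identity on the unit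
ball vanishes somewhere in it. -/
theorem exists_zero_of_norm_sub_le {T : R3 → R3} (hT : ContinuousOn T (closedBall 0 1))
    (hclose : ∀ x ∈ closedBall (0 : R3) 1, ‖T x - x‖ ≤ 1 / 2) :
    ∃ x ∈ closedBall (0 : R3) 1, T x = 0 := by
  by_contra! hne
  obtain ⟨r₀, hr₀, hmin⟩ := (isCompact_closedBall (0 : R3) 1).exists_forall_le' hT.norm
    (a := 0) (fun x hx => norm_pos_iff.2 (hne x hx))
  obtain ⟨T₁, hT₁⟩ := ContinuousMap.exists_restrict_eq (isClosed_closedBall (x := (0 : R3)) (ε := 1))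
    ⟨_, hT.domRestrict⟩
  have hT₁' : ∀ x ∈ closedBall (0 : R3) 1, T₁ x = T x := fun x hx =>
    congrArg (fun q : C(closedBall (0 : R3) 1, R3) => q ⟨x, hx⟩) hT₁
  set r : ℝ := min (r₀ / 2) (1 / 8)
  have hrpos : 0 < r := by positivity
  obtain ⟨S, hS, hSd, -⟩ := T₁.continuous.exists_contDiff_approx 1
    (ε := fun _ => r) continuous_const (fun _ => hrpos)
  have hSd' : ∀ x ∈ closedBall (0 : R3) 1, ‖S x - T x‖ < r := fun x hx => by
    rw [← hT₁' x hx, ← dist_eq_norm]; exact hSd x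
  let χ : ContDiffBump (0 : R3) := ⟨7 / 8, 1, by norm_num, by norm_num⟩
  let h : R3 → R3 := fun x => χ x • (S x - x)
  have hsm : ContDiff ℝ 1 h := χ.contDiff.smul (hS.sub contDiff_id)
  obtain ⟨L, hL⟩ := hsm.lipschitzWith_of_hasCompactSupport
    (χ.hasCompactSupport.smul_right) one_ne_zero
  let H : R3 → R3 := fun x => x + h x
  have hH : LipschitzWith (1 + L) H := LipschitzWith.id.add hL
  have hhle : ∀ x ∈ closedBall (0 : R3) 1, ‖h x‖ ≤ 5 / 8 := by
    intro x hx
    have h1 : ‖S x - x‖ ≤ 5 / 8 := by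
      have h2 := norm_sub_le_norm_sub_add_norm_sub (S x) (T x) x
      have h3 := hclose x hx
      have h4 := hSd' x hx
      have h5 : r ≤ 1 / 8 := min_le_right _ _
      linarith
    rw [norm_smul, Real.norm_of_nonneg χ.nonneg]
    exact (mul_le_of_le_one_left (norm_nonneg _) χ.le_one).trans h1
  have hHout : ∀ x : R3, 1 ≤ ‖x‖ → H x = x := by
    intro x hx
    have : χ x = 0 := χ.zero_of_le_dist (by simpa using hx)
    simp [H, h, this]
  have hHlow : ∀ x : R3, r ≤ ‖H x‖ := by
    intro x
    rcases le_or_gt ‖x‖ 1 with hx | hx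
    · have hxm : x ∈ closedBall (0 : R3) 1 := by simpa using hx
      rcases le_or_gt ‖x‖ (7 / 8) with hx' | hx'
      · have : χ x = 1 := χ.one_of_mem_closedBall (by simpa [χ] using hx')
        have hHx : H x = S x := by simp [H, h, this]
        rw [hHx]
        have h1 := hmin x hxm
        have h2 := hSd' x hxm
        have h3 : r ≤ r₀ / 2 := min_le_left _ _
        have h4 := norm_sub_norm_le (T x) (S x)
        rw [norm_sub_rev] at h4
        linarith
      · have h1 := hhle x hxm
        have h2 := norm_sub_norm_le x (-h x)
        rw [sub_neg_eq_add, norm_neg] at h2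
        have h5 : r ≤ 1 / 8 := min_le_right _ _
        simp only [H]
        linarith
    · rw [hHout x hx.le]
      have h5 : r ≤ 1 / 8 := min_le_right _ _
      linarith
  have hHup : ∀ x : R3, ‖x‖ < 2 → ‖H x‖ < 2 := by
    intro x hx2
    rcases le_or_gt ‖x‖ 1 with hx | hx
    · have h1 := hhle x (by simpa using hx)
      have h2 := norm_add_le x (h x)
      simp only [H]
      linarith
    · rwa [hHout x hx.le]
  obtain ⟨C, hC⟩ := exists_lipschitzOnWith_radialPush (R := 2) two_pos hrpos
  have hg : LipschitzWith (C * (1 + L)) (radialPush 2 ∘ H) :=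
    lipschitzOnWith_univ.1 (hC.comp hH.lipschitzOnWith (fun x _ => hHlow x))
  refine no_lipschitz_retraction hg two_pos (fun x hx => ?_) (fun x hx => ?_)
  · exact norm_radialPush_of_lt two_pos (norm_pos_iff.1 (hrpos.trans_le (hHlow x))) (hHup x hx)
  · rw [Function.comp_apply, hHout x (by linarith), radialPush, if_pos hx]

theorem image_closedBall_mem_nhds {f : R3 → R3} (hf : ContinuousOn f (closedBall 0 1))
    (hinj : InjOn f (closedBall 0 1)) : f '' closedBall 0 1 ∈ 𝓝 (f 0) := by
  by_contra hnot
  set B : Set R3 := closedBall 0 1 with hB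
  have hBc : IsCompact B := isCompact_closedBall _ _
  have h0 : (0 : R3) ∈ B := by simp [hB]
  have : CompactSpace B := isCompact_iff_compactSpace.1 hBc
  have hemb : IsClosedEmbedding (B.domRestrict f) :=
    hf.domRestrict.isClosedEmbedding (injOn_iff_injective.1 hinj)
  obtain ⟨G, hG⟩ := ContinuousMap.exists_extension' hemb
    (⟨Subtype.val, continuous_subtype_val⟩ : C(B, R3))
  have hGf : ∀ x ∈ B, G (f x) = x := fun x hx => congrFun hG ⟨x, hx⟩
  obtain ⟨ε, hε, hGε⟩ : ∃ ε > 0, ∀ y, dist y (f 0) < 2 * ε → ‖G y‖ < 1 / 10 := by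
    have : ∀ᶠ y in 𝓝 (f 0), ‖G y‖ < 1 / 10 :=
      G.continuous.norm.continuousAt.eventually (gt_mem_nhds (by simp [hGf 0 h0]))
    obtain ⟨ε, hε, h⟩ := Metric.eventually_nhds_iff.1 this
    exact ⟨ε / 2, by positivity, fun y hy => h (by linarith)⟩
  obtain ⟨c, hcε, hc⟩ : ∃ c, dist c (f 0) < ε ∧ c ∉ f '' B := by
    by_contra! h
    exact hnot (Metric.mem_nhds_iff.2 ⟨ε, hε, fun c hc => h c hc⟩)
  have hGc : ∀ y, dist y c ≤ ε → ‖G y‖ < 1 / 10 := fun y hy =>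
    hGε y (by linarith [dist_triangle y c (f 0)])
  obtain ⟨δ, hδ, hδmin⟩ := ((hBc.image_of_continuousOn hf).inter_right
      (isClosed_le continuous_const (continuous_id.dist continuous_const) :
        IsClosed {y | ε ≤ dist y c})).exists_forall_le'
    (f := fun y => ‖G y‖) (a := 0) G.continuous.norm.continuousOn (by
      rintro _ ⟨⟨x, hx, rfl⟩, hy⟩
      rw [hGf x hx, norm_pos_iff]
      rintro rfl
      rw [dist_comm] at hcε
      exact hcε.not_ge hy)
  set η : ℝ := min (δ / 2) (1 / 10)
  have hηpos : 0 < η := by positivity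
  obtain ⟨P, hP, hPd, -⟩ := G.continuous.exists_contDiff_approx 1
    (ε := fun _ => η) continuous_const (fun _ => hηpos)
  have hPnull : volume (P '' sphere c ε) = 0 :=
    addHaar_image_eq_zero_of_differentiableOn_of_addHaar_eq_zero volume
      (hP.differentiable one_ne_zero).differentiableOn (Measure.addHaar_sphere _ _ _)
  obtain ⟨v, hv, hvP⟩ : ∃ v : R3, ‖v‖ < η ∧ v ∉ P '' sphere c ε := by
    by_contra! h
    have : ball (0 : R3) η ⊆ P '' sphere c ε := fun v hv => h v (by simpa using hv)
    exact (measure_ball_pos volume (0 : R3) hηpos).ne' (measure_mono_null this hPnull)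
  have hPG : ∀ y, ‖P y - v - G y‖ < 2 * η := by
    intro y
    have h1 : ‖P y - G y‖ < η := by rw [← dist_eq_norm]; exact hPd y
    have h2 : P y - v - G y = (P y - G y) - v := by abel
    rw [h2]
    linarith [norm_sub_le (P y - G y) v]
  have hη1 : η ≤ δ / 2 := min_le_left _ _
  have hη2 : η ≤ 1 / 10 := min_le_right _ _
  let Φ : R3 → R3 := fun y => c + max 1 (ε / ‖y - c‖) • (y - c)
  have hne : ∀ x ∈ B, 0 < ‖f x - c‖ := fun x hx => by
    rw [norm_pos_iff, sub_ne_zero]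
    rintro rfl
    exact hc ⟨x, hx, rfl⟩
  have hΦfar : ∀ x ∈ B, ε ≤ ‖f x - c‖ → Φ (f x) = f x := by
    intro x hx h
    have : ε / ‖f x - c‖ ≤ 1 := (div_le_one (hne x hx)).2 h
    simp [Φ, max_eq_left this]
  have hΦnear : ∀ x ∈ B, ‖f x - c‖ < ε → Φ (f x) ∈ sphere c ε := by
    intro x hx h
    have : 1 ≤ ε / ‖f x - c‖ := (one_le_div (hne x hx)).2 h.le
    simp only [Φ, max_eq_right this, mem_sphere, dist_eq_norm, add_sub_cancel_left]
    rw [norm_smul, Real.norm_of_nonneg (by positivity), div_mul_cancel₀ _ (hne x hx).ne']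
  have hcont : ContinuousOn (fun x => P (Φ (f x)) - v) B := by
    have h1 : ContinuousOn (fun x => f x - c) B := hf.sub continuousOn_const
    have h2 : ContinuousOn (fun x => ε / ‖f x - c‖) B :=
      continuousOn_const.div h1.norm (fun x hx => (hne x hx).ne')
    have h3 : ContinuousOn (fun x => Φ (f x)) B :=
      continuousOn_const.add ((continuousOn_const.sup h2).smul h1)
    exact (hP.continuous.comp_continuousOn h3).sub continuousOn_const
  obtain ⟨x, hx, hx0⟩ := exists_zero_of_norm_sub_le hcont (by
    intro x hx
    rcases le_or_gt ε ‖f x - c‖ with h | h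
    · rw [hΦfar x hx h]
      have := hPG (f x)
      rw [hGf x hx] at this
      linarith
    · have h1 := hGc (f x) (by rw [dist_eq_norm]; exact h.le)
      rw [hGf x hx] at h1
      have h2 := hGc _ (mem_sphere.1 (hΦnear x hx h)).le
      have h3 := hPG (Φ (f x))
      have h4 : P (Φ (f x)) - v - x = (P (Φ (f x)) - v - G (Φ (f x))) + G (Φ (f x)) - x := by
        abel
      rw [h4]
      have h5 := norm_sub_le ((P (Φ (f x)) - v - G (Φ (f x))) + G (Φ (f x))) x
      have h6 := norm_add_le (P (Φ (f x)) - v - G (Φ (f x))) (G (Φ (f x)))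
      linarith)
  rcases le_or_gt ε ‖f x - c‖ with h | h
  · rw [hΦfar x hx h] at hx0
    have h1 := hPG (f x)
    rw [hx0, zero_sub, norm_neg] at h1
    have h2 := hδmin (f x) ⟨⟨x, hx, rfl⟩, by rw [mem_ofPred_eq, dist_eq_norm]; exact h⟩
    linarith
  · exact hvP ⟨_, hΦnear x hx h, sub_eq_zero.1 hx0⟩

/-- **Invariance of domain** in `ℝ³`. -/
theorem isOpen_image_of_continuousOn_injOn {f : R3 → R3} {W : Set R3} (hW : IsOpen W)
    (hf : ContinuousOn f W) (hinj : InjOn f W) : IsOpen (f '' W) := by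
  rw [isOpen_iff_mem_nhds]
  rintro _ ⟨a, ha, rfl⟩
  obtain ⟨r, hr, hrW⟩ := Metric.nhds_basis_closedBall.mem_iff.1 (hW.mem_nhds ha)
  let φ : R3 → R3 := fun x => a + r • x
  have hφ : MapsTo φ (closedBall 0 1) W := fun x hx => hrW (by
    have hx' : ‖x‖ ≤ 1 := by simpa using hx
    simpa [φ, dist_eq_norm, norm_smul, abs_of_pos hr] using mul_le_of_le_one_right hr.le hx')
  have hφi : Function.Injective φ := fun x y hxy => by
    simpa [φ, hr.ne'] using hxy
  have key := image_closedBall_mem_nhds (f := f ∘ φ)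
    (hf.comp (by fun_prop) hφ) (hinj.comp hφi.injOn hφ)
  have h0 : φ 0 = a := by simp [φ]
  rw [Function.comp_apply, h0] at key
  refine mem_of_superset key ?_
  rw [image_comp]
  exact image_mono hφ.image_subset

theorem isOpen_imgIter {U : Set R3} {f : U → U} (hfc : Continuous f)
    (hfi : Function.Injective f) (k : ℕ) {W : Set R3} (hW : IsOpen W) (hWU : W ⊆ U) :
    IsOpen (imgIter f k W) := by
  let F : R3 → R3 := Function.extend Subtype.val (fun x : U => ((f^[k] x : U) : R3)) id
  have hF (x : U) : F x = (f^[k] x : U) := Subtype.val_injective.extend_apply _ _ x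
  have himg : F '' W = imgIter f k W := by
    ext y
    simp only [imgIter, mem_image, mem_preimage]
    constructor
    · rintro ⟨x, hx, rfl⟩
      exact ⟨_, ⟨⟨x, hWU hx⟩, hx, rfl⟩, (hF ⟨x, hWU hx⟩).symm⟩
    · rintro ⟨_, ⟨x, hx, rfl⟩, rfl⟩
      exact ⟨x, hx, hF x⟩
  rw [← himg]
  refine isOpen_image_of_continuousOn_injOn hW (ContinuousOn.mono ?_ hWU) ?_
  · rw [continuousOn_iff_continuous_domRestrict]
    have : U.domRestrict F = fun x => ((f^[k] x : U) : R3) := funext hF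
    rw [this]
    exact continuous_subtype_val.comp (hfc.iterate k)
  · intro x hx y hy hxy
    have h1 := hF ⟨x, hWU hx⟩
    have h2 := hF ⟨y, hWU hy⟩
    have : f^[k] ⟨x, hWU hx⟩ = f^[k] ⟨y, hWU hy⟩ := Subtype.ext (by rw [← h1, ← h2]; exact hxy)
    exact congrArg Subtype.val (hfi.iterate k this)

theorem imgIter_mono {U : Set R3} (f : U → U) (k : ℕ) {P Q : Set R3} (h : P ⊆ Q) :
    imgIter f k P ⊆ imgIter f k Q :=
  image_mono (image_mono (preimage_mono h))

theorem imgIter_add {U : Set R3} (f : U → U) (m n : ℕ) (P : Set R3) :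
    imgIter f (m + n) P = imgIter f m (imgIter f n P) := by
  rw [imgIter, imgIter, imgIter, preimage_image_eq _ Subtype.val_injective, Function.iterate_add,
    image_comp]

theorem imgIter_eq_self {U : Set R3} {f : U → U} {K : Set R3} (hKU : K ⊆ U)
    (hK : imgIter f 1 K = K) (k : ℕ) : imgIter f k K = K := by
  induction k with
  | zero => simpa [imgIter] using hKU
  | succ k ih => rw [imgIter_add, hK, ih]

theorem isCompact_imgIter {U : Set R3} {f : U → U} (hfc : Continuous f) (k : ℕ) {P : Set R3}
    (hP : IsCompact P) (hPU : P ⊆ U) : IsCompact (imgIter f k P) := by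
  have h : IsCompact ((↑) ⁻¹' P : Set U) := by
    rw [Subtype.isCompact_iff, Subtype.image_preimage_coe, inter_eq_right.2 hPU]
    exact hP
  exact (h.image (hfc.iterate k)).image continuous_subtype_val

theorem IsManifold3WithBoundary.of_homeomorph {M N : Set R3} (hM : IsManifold3WithBoundary M)
    (e : M ≃ₜ N) : IsManifold3WithBoundary N := by
  intro p
  obtain ⟨V, hV, hpV, W, hW, ⟨φ⟩⟩ := hM (e.symm p)
  exact ⟨e.symm ⁻¹' V, hV.preimage e.symm.continuous, hpV, W, hW,
    ⟨(e.symm.sets (s := e.symm ⁻¹' V) (t := V) rfl).trans φ⟩⟩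

theorem exists_homeomorph_imgIter {U : Set R3} {f : U → U} (hfc : Continuous f)
    (hfi : Function.Injective f) (k : ℕ) {N : Set R3} (hNU : N ⊆ U) (hN : IsCompact N) :
    ∃ e : N ≃ₜ imgIter f k N, ∀ x : N, (e x : R3) = ((f^[k] ⟨(x : R3), hNU x.2⟩ : U) : R3) := by
  have : CompactSpace N := isCompact_iff_compactSpace.1 hN
  let g : N → imgIter f k N := fun x =>
    ⟨(f^[k] ⟨(x : R3), hNU x.2⟩ : U), _, ⟨⟨x, hNU x.2⟩, x.2, rfl⟩, rfl⟩
  have hg : Continuous g := by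
    refine Continuous.subtype_mk (continuous_subtype_val.comp ((hfc.iterate k).comp ?_)) _
    exact Continuous.subtype_mk continuous_subtype_val _
  have hbij : Function.Bijective g := by
    constructor
    · intro x y hxy
      have h := hfi.iterate k (Subtype.ext (congrArg (fun z : imgIter f k N => (z : R3)) hxy))
      exact Subtype.ext (congrArg (fun z : U => (z : R3)) h)
    · rintro ⟨_, _, ⟨x, hx, rfl⟩, rfl⟩
      exact ⟨⟨x, hx⟩, rfl⟩
  exact ⟨hg.homeoOfEquivCompactToT2 (f := Equiv.ofBijective g hbij), fun x => rfl⟩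

/-- Every compact subset of the basin of an attractor is attracted by it. -/
theorem IsAttractor.isAttracted_of_subset_basin {U : Set R3} (hU : IsOpen U) {f : U → U}
    (hfc : Continuous f) {K : Set R3} (hK : IsAttractor f K) {N : Set R3} (hN : IsCompact N)
    (hNb : N ⊆ Basin f K) : IsAttracted f K N := by
  obtain ⟨-, -, -, A, hAU, hKA, hA⟩ := hK
  intro V hV
  have hloc : ∀ p ∈ N, ∃ t ∈ 𝓝[N] p, ∃ n₀, ∀ n ≥ n₀, imgIter f n t ⊆ V := by
    intro p hp
    obtain ⟨A', ⟨hA'U, -, hA'⟩, hpA'⟩ := hNb hp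
    have hpU : p ∈ U := hA'U hpA'
    obtain ⟨m, hm⟩ := hA' {p} isCompact_singleton (singleton_subset_iff.2 hpA') (interior A)
      (by rwa [interior_interior])
    have hpm : ((f^[m] ⟨p, hpU⟩ : U) : R3) ∈ interior A :=
      hm m le_rfl ⟨_, ⟨⟨p, hpU⟩, rfl, rfl⟩, rfl⟩
    let O : Set R3 := Subtype.val '' {x : U | ((f^[m] x : U) : R3) ∈ interior A}
    have hO : IsOpen O := hU.isOpenMap_subtype_val _
      (isOpen_interior.preimage (continuous_subtype_val.comp (hfc.iterate m)))
    obtain ⟨Q, hQ, hpQ, hQO⟩ := exists_compact_subset hO ⟨⟨p, hpU⟩, hpm, rfl⟩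
    have hQU : Q ⊆ U := hQO.trans (by rintro _ ⟨x, -, rfl⟩; exact x.2)
    have hQA : imgIter f m Q ⊆ A := by
      rintro _ ⟨_, ⟨x, hx, rfl⟩, rfl⟩
      obtain ⟨x', hx', hxx'⟩ := hQO hx
      rw [Subtype.ext hxx'] at hx'
      exact interior_subset hx'
    obtain ⟨n₀, hn₀⟩ := hA _ (isCompact_imgIter hfc m hQ hQU) hQA V hV
    refine ⟨Q, mem_nhdsWithin_of_mem_nhds (mem_interior_iff_mem_nhds.1 hpQ), n₀ + m,
      fun n hn => ?_⟩
    have := hn₀ (n - m) (by omega)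
    rwa [← imgIter_add, Nat.sub_add_cancel (by omega)] at this
  refine hN.induction_on (p := fun t => ∃ n₀, ∀ n ≥ n₀, imgIter f n t ⊆ V) ?_ ?_ ?_ hloc
  · exact ⟨0, fun n _ => by simp [imgIter]⟩
  · rintro s t hst ⟨n₀, h⟩
    exact ⟨n₀, fun n hn => (imgIter_mono f n hst).trans (h n hn)⟩
  · rintro s t ⟨n₀, h⟩ ⟨n₁, h'⟩
    refine ⟨max n₀ n₁, fun n hn => ?_⟩
    have : imgIter f n (s ∪ t) = imgIter f n s ∪ imgIter f n t := by
      simp only [imgIter, preimage_union, image_union]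
    rw [this]
    exact union_subset (h n (le_of_max_le_left hn)) (h' n (le_of_max_le_right hn))

/-- An attractor `K` of a discrete dynamical system `f : U → U` has a neighbourhood basis
of compact 3-manifolds with boundary, all homeomorphic to each other: if `N ⊆ 𝒜(K)` is any
compact neighbourhood of `K` that is a 3-manifold with boundary, then the sets
`N_k := f^k(N)` are again such neighbourhoods, form a neighbourhood basis of `K`, and each
restriction `f^k|_N` is a homeomorphism of `N` onto `N_k`. -/
theorem attractor_has_manifold_neighbourhood_basis {U : Set R3} (hU : IsOpen U)
    (f : ↥U → ↥U) (hfc : Continuous f) (hfi : Function.Injective f)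
    {K : Set R3} (hattr : IsAttractor f K)
    (N : Set R3) (hNU : N ⊆ U) (hNc : IsCompact N) (hNnbhd : K ⊆ interior N)
    (hNbasin : N ⊆ Basin f K) (hNm : IsManifold3WithBoundary N) :
    (∀ k : ℕ, K ⊆ interior (imgIter f k N) ∧ IsCompact (imgIter f k N) ∧
        IsManifold3WithBoundary (imgIter f k N)) ∧
    (∀ V : Set R3, IsOpen V → K ⊆ V → ∃ k : ℕ, imgIter f k N ⊆ V) ∧
    (∀ k : ℕ, ∃ e : ↥N ≃ₜ ↥(imgIter f k N),
        ∀ x : ↥N, (e x : R3) = ((f^[k] ⟨(x : R3), hNU x.2⟩ : ↥U) : R3)) := by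
  obtain ⟨-, hKU, hKinv, -⟩ := id hattr
  refine ⟨fun k => ⟨?_, isCompact_imgIter hfc k hNc hNU, ?_⟩, fun V hV hKV => ?_,
    fun k => exists_homeomorph_imgIter hfc hfi k hNU hNc⟩
  · calc K = imgIter f k K := (imgIter_eq_self hKU hKinv k).symm
      _ ⊆ imgIter f k (interior N) := imgIter_mono f k hNnbhd
      _ ⊆ interior (imgIter f k N) := interior_maximal (imgIter_mono f k interior_subset)
          (isOpen_imgIter hfc hfi k isOpen_interior (interior_subset.trans hNU))
  · obtain ⟨e, -⟩ := exists_homeomorph_imgIter hfc hfi k hNU hNc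
    exact hNm.of_homeomorph e
  · obtain ⟨n, hn⟩ := hattr.isAttracted_of_subset_basin hU hfc hNc hNbasin V
      (by rwa [hV.interior_eq])
    exact ⟨n, hn n le_rfl⟩
end
end

section
/- Every compact set K ⊆ ℝ³ has arbitrarily small neighbourhoods that are polyhedral 3-manifolds: for every open set V with K ⊆ V there exists a set N with K ⊆ interior(N) ⊆ N ⊆ V such that N is a polyhedron and a topological 3-manifold with boundary. -/
open Set

noncomputable section

/-- A simplex in `ℝ³`: the convex hull of a finite affinely independent set of points. -/
def IsSimplexSet (s : Set R3) : Prop :=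
  ∃ t : Finset R3, AffineIndependent ℝ (fun x : (t : Set R3) => (x : R3)) ∧
    s = convexHull ℝ (t : Set R3)

/-- A polyhedron in `ℝ³`: a finite union of simplices. -/
def IsPolyhedron (P : Set R3) : Prop :=
  ∃ F : Finset (Set R3), (∀ s ∈ F, IsSimplexSet s) ∧ P = ⋃ s ∈ F, s

/-- The closed cube with centre `c` and half-edge `r`. -/
def closedCube (c : R3) (r : ℝ) : Set R3 := {x | ∀ j, |x j - c j| ≤ r}

/-- By Carathéodory's theorem, a polytope is a polyhedron. -/
theorem isPolyhedron_convexHull {s : Set R3} (hs : s.Finite) :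
    IsPolyhedron (convexHull ℝ s) := by
  classical
  let F : Set (Set R3) := {u | ∃ t : Finset R3, (t : Set R3) ⊆ s ∧
    AffineIndependent ℝ ((↑) : t → R3) ∧ u = convexHull ℝ (t : Set R3)}
  have hF : F.Finite := by
    refine (hs.finite_subsets.image (fun u => convexHull ℝ u)).subset ?_
    rintro u ⟨t, ht, -, rfl⟩
    exact ⟨t, ht, rfl⟩
  refine ⟨hF.toFinset, ?_, ?_⟩
  · intro u hu
    obtain ⟨t, -, ht, rfl⟩ := hF.mem_toFinset.1 hu
    exact ⟨t, ht, rfl⟩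
  · rw [convexHull_eq_union]
    ext x
    simp only [mem_iUnion, Set.Finite.mem_toFinset, exists_prop]
    constructor
    · rintro ⟨t, h1, h2, hx⟩
      exact ⟨_, ⟨t, h1, h2, rfl⟩, hx⟩
    · rintro ⟨_, ⟨t, h1, h2, rfl⟩, hx⟩
      exact ⟨t, h1, h2, hx⟩

theorem isPolyhedron_biUnion {ι : Type*} (t : Finset ι) (P : ι → Set R3)
    (h : ∀ i ∈ t, IsPolyhedron (P i)) : IsPolyhedron (⋃ i ∈ t, P i) := by
  classical
  choose! F hF hP using h
  refine ⟨t.biUnion F, ?_, ?_⟩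
  · intro s hs
    obtain ⟨i, hi, hs⟩ := Finset.mem_biUnion.1 hs
    exact hF i hi s hs
  · rw [Finset.set_biUnion_biUnion]
    exact iUnion₂_congr hP

theorem closedCube_eq_convexHull (c : R3) {r : ℝ} (hr : 0 ≤ r) :
    closedCube c r = convexHull ℝ ((EuclideanSpace.equiv (Fin 3) ℝ).symm ''
      Set.pi univ fun j => {c j - r, c j + r}) := by
  have h := (EuclideanSpace.equiv (Fin 3) ℝ).symm.toLinearEquiv.toLinearMap.image_convexHull
    (Set.pi univ fun j => ({c j - r, c j + r} : Set ℝ))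
  refine Eq.trans ?_ h
  rw [convexHull_pi]
  ext x
  have hseg (j : Fin 3) : convexHull ℝ {c j - r, c j + r} = Icc (c j - r) (c j + r) := by
    rw [convexHull_pair, segment_eq_Icc (by linarith)]
  simp only [hseg]
  constructor
  · intro hx
    refine ⟨fun j => x j, fun j _ => ?_, rfl⟩
    have := abs_le.1 (hx j)
    exact ⟨by linarith, by linarith⟩
  · rintro ⟨y, hy, rfl⟩ j
    have hyj : y j ∈ Icc (c j - r) (c j + r) := hy j (mem_univ j)
    change |y j - c j| ≤ r
    exact abs_le.2 ⟨by linarith [hyj.1], by linarith [hyj.2]⟩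

theorem isPolyhedron_closedCube (c : R3) {r : ℝ} (hr : 0 ≤ r) :
    IsPolyhedron (closedCube c r) := by
  rw [closedCube_eq_convexHull c hr]
  exact isPolyhedron_convexHull ((Set.Finite.pi fun j => toFinite _).image _)

/-- A set is locally a half-space near a point if a homeomorphism of the ambient space takes it
to the half-space near that point. -/
theorem exists_halfSpace_chart (N : Set R3) (p : N) (U : Set R3) (hU : IsOpen U) (hp : (p : R3) ∈ U)
    (Φ : R3 ≃ₜ R3) (h : ∀ x ∈ U, x ∈ N ↔ Φ x ∈ HalfSpace3) :
    ∃ V : Set N, IsOpen V ∧ p ∈ V ∧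
      ∃ W : Set ↥HalfSpace3, IsOpen W ∧ Nonempty (↥V ≃ₜ ↥W) := by
  refine ⟨Subtype.val ⁻¹' U, hU.preimage continuous_subtype_val, hp,
    (fun z => Φ.symm (z : R3)) ⁻¹' U,
    hU.preimage (Φ.symm.continuous.comp continuous_subtype_val), ⟨?_⟩⟩
  exact
    { toFun := fun x => ⟨⟨Φ x.1.1, (h _ x.2).1 x.1.2⟩, by
        change Φ.symm (Φ x.1.1) ∈ U
        rw [Φ.symm_apply_apply]
        exact x.2⟩
      invFun := fun z => ⟨⟨Φ.symm z.1.1, (h _ z.2).2 (by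
        rw [Φ.apply_symm_apply]
        exact z.1.2)⟩, z.2⟩
      left_inv := fun x => Subtype.ext (Subtype.ext (Φ.symm_apply_apply _))
      right_inv := fun z => Subtype.ext (Subtype.ext (Φ.apply_symm_apply _))
      continuous_toFun := by fun_prop
      continuous_invFun := by fun_prop }

/-- A continuous function that increases at unit speed along a diagonal direction `s` is, up to
sign, the last coordinate of a global chart. -/
def diagonalChart (f : R3 → ℝ) (hf : Continuous f) (s : R3) (hs : ∀ j, s j * s j = 1)
    (hfs : ∀ x (τ : ℝ), f (x + τ • s) = f x + τ) : R3 ≃ₜ R3 where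
  toFun x := !₂[s 0 * x 0 - s 2 * x 2, s 1 * x 1 - s 2 * x 2, -f x]
  invFun z := (!₂[s 0 * z 0, s 1 * z 1, 0] : R3) +
    (-z 2 - f !₂[s 0 * z 0, s 1 * z 1, 0]) • s
  left_inv x := by
    have hq : (!₂[s 0 * (s 0 * x 0 - s 2 * x 2), s 1 * (s 1 * x 1 - s 2 * x 2), 0] : R3) =
        x + (-(s 2 * x 2)) • s := by
      ext j
      fin_cases j
      · simp
        linear_combination x 0 * hs 0
      · simp
        linear_combination x 1 * hs 1
      · simp
        linear_combination x 2 * hs 2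
    simp only [Matrix.cons_val_zero, Matrix.cons_val_one, Matrix.cons_val]
    rw [hq, hfs]
    module
  right_inv z := by
    ext j
    fin_cases j
    · simp
      linear_combination (z 0 + (-z 2 - f !₂[s 0 * z 0, s 1 * z 1, 0])) * hs 0 -
        (-z 2 - f !₂[s 0 * z 0, s 1 * z 1, 0]) * hs 2
    · simp
      linear_combination (z 1 + (-z 2 - f !₂[s 0 * z 0, s 1 * z 1, 0])) * hs 1 -
        (-z 2 - f !₂[s 0 * z 0, s 1 * z 1, 0]) * hs 2
    · simp [hfs]
  continuous_toFun := by fun_prop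
  continuous_invFun := by fun_prop

/-- Translating by `τ` commutes with taking the maximum of finitely many reals. -/
theorem sup'_add_const {ι : Type*} (t : Finset ι) (ht : t.Nonempty) (g : ι → ℝ) (τ : ℝ) :
    t.sup' ht (fun i => g i + τ) = t.sup' ht g + τ :=
  (Finset.apply_sup'_eq_sup'_comp ht (· + τ) fun a b => (max_add_add_right a b τ).symm).symm

/-- Translating by `τ` commutes with taking the minimum of finitely many reals. -/
theorem inf'_add_const {ι : Type*} (t : Finset ι) (ht : t.Nonempty) (g : ι → ℝ) (τ : ℝ) :
    t.inf' ht (fun i => g i + τ) = t.inf' ht g + τ :=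
  (Finset.apply_inf'_eq_inf'_comp ht (· + τ) fun a b => (min_add_add_right a b τ).symm).symm

/-- A finite union of cubes of the same size is a manifold with boundary, provided that no upper
face of a cube lies in the plane of a lower face. -/
theorem isManifold3WithBoundary_biUnion_closedCube (t : Finset R3) {r : ℝ} (hr : 0 < r)
    (hgen : ∀ c ∈ t, ∀ d ∈ t, ∀ j, c j - d j ≠ 2 * r) :
    IsManifold3WithBoundary (⋃ c ∈ t, closedCube c r) := by
  classical
  rintro ⟨q, hq⟩
  set N : Set R3 := ⋃ c ∈ t, closedCube c r with hN
  have memN (x : R3) : x ∈ N ↔ ∃ c ∈ t, ∀ j, |x j - c j| ≤ r := by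
    simp [hN, closedCube]
  have hcoord (j : Fin 3) (c : R3) : Continuous fun x : R3 => x j - c j := by fun_prop
  by_cases hint : ∃ c ∈ t, ∀ j, |q j - c j| < r
  · obtain ⟨c, hc, hqc⟩ := hint
    let Φ : R3 ≃ₜ R3 := Homeomorph.addRight (!₂[0, 0, 1 - q 2] : R3)
    have hΦ (x : R3) : Φ x 2 = x 2 + (1 - q 2) := by simp [Φ]
    refine exists_halfSpace_chart N ⟨q, hq⟩
      ({x | ∀ j, |x j - c j| < r} ∩ {x | 0 < Φ x 2}) ?_ ⟨hqc, ?_⟩ Φ ?_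
    · refine IsOpen.inter ?_ (isOpen_lt continuous_const (by fun_prop))
      simp only [ofPred_forall]
      exact isOpen_iInter_of_finite fun j => isOpen_lt (hcoord j c).abs continuous_const
    · change 0 < Φ q 2
      rw [hΦ]
      linarith
    · rintro x ⟨hx, hx'⟩
      exact ⟨fun _ => show 0 ≤ Φ x 2 from le_of_lt hx',
        fun _ => (memN x).2 ⟨c, hc, fun j => (hx j).le⟩⟩
  · push Not at hint
    let s : R3 := WithLp.toLp 2 fun j => if ∃ c ∈ t, q j - c j = r then 1 else -1
    have hs (j : Fin 3) : s j = if ∃ c ∈ t, q j - c j = r then 1 else -1 := rfl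
    have hss (j : Fin 3) : s j * s j = 1 := by
      rw [hs]
      split_ifs <;> norm_num
    have hsr : ∀ c ∈ t, ∀ j, |q j - c j| = r → q j - c j = s j * r := by
      intro c hc j h
      rw [hs]
      split_ifs with hex
      · obtain ⟨d, hd, hdr⟩ := hex
        rcases (abs_eq hr.le).1 h with h | h
        · linarith
        · exact absurd (by linarith) (hgen c hc d hd j)
      · rcases (abs_eq hr.le).1 h with h | h
        · exact absurd ⟨c, hc, h⟩ hex
        · linarith
    let good : Finset R3 := t.filter fun c => ∀ j, |q j - c j| ≤ r
    have hgood : good.Nonempty := by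
      obtain ⟨c, hc, h⟩ := (memN q).1 hq
      exact ⟨c, Finset.mem_filter.2 ⟨hc, h⟩⟩
    have huniv : (Finset.univ : Finset (Fin 3)).Nonempty := Finset.univ_nonempty
    let y (j : Fin 3) (x : R3) : ℝ := s j * (x j - q j)
    have hy (j : Fin 3) : Continuous (y j) := by fun_prop
    let g (c : R3) (j : Fin 3) (x : R3) : ℝ :=
      if |q j - c j| = r then y j x else Finset.univ.inf' huniv fun k => y k x
    have hg (c : R3) (j : Fin 3) : Continuous (g c j) := by
      by_cases h : |q j - c j| = r
      · simpa only [g, h, if_true] using hy j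
      · simpa only [g, h, if_false] using
          Continuous.finset_inf'_apply huniv fun k _ => hy k
    let f (x : R3) : ℝ :=
      good.inf' hgood fun c => Finset.univ.sup' huniv fun j => g c j x
    have hf : Continuous f := Continuous.finset_inf'_apply hgood fun c _ =>
      Continuous.finset_sup'_apply huniv fun j _ => hg c j
    have hfs (x : R3) (τ : ℝ) : f (x + τ • s) = f x + τ := by
      have hyτ (j : Fin 3) : y j (x + τ • s) = y j x + τ := by
        simp only [y, PiLp.add_apply, PiLp.smul_apply, smul_eq_mul]
        linear_combination τ * hss j
      have hgτ (c : R3) (j : Fin 3) : g c j (x + τ • s) = g c j x + τ := by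
        simp only [g, hyτ, inf'_add_const]
        split_ifs <;> rfl
      simp only [f, hgτ, sup'_add_const, inf'_add_const]
    have hev : ∀ᶠ x in nhds q, ∀ c ∈ t, ∀ j,
        (|q j - c j| < r → |x j - c j| < r) ∧ (r < |q j - c j| → r < |x j - c j|) ∧
        (|q j - c j| = r → -r < s j * (x j - c j)) := by
      refine (Filter.eventually_all_finset t).2 fun c hc => Filter.eventually_all.2 fun j => ?_
      refine .and ?_ (.and ?_ ?_) <;> refine Filter.eventually_imp_distrib_left.2 fun h => ?_
      · exact (hcoord j c).abs.continuousAt.eventually_lt continuousAt_const h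
      · exact continuousAt_const.eventually_lt (hcoord j c).abs.continuousAt h
      · refine continuousAt_const.eventually_lt
          (continuous_const.mul (hcoord j c)).continuousAt ?_
        rw [hsr c hc j h]
        nlinarith [hss j]
    obtain ⟨U, hUsub, hUo, hqU⟩ := mem_nhds_iff.1 hev
    refine exists_halfSpace_chart N ⟨q, hq⟩ U hUo hqU (diagonalChart f hf s hss hfs) ?_
    intro x hx
    have hxU := hUsub hx
    have hface : ∀ c ∈ t, ∀ j, |q j - c j| = r → (|x j - c j| ≤ r ↔ y j x ≤ 0) := by
      intro c hc j h
      have h1 := (hxU c hc j).2.2 h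
      have h2 : y j x = s j * (x j - c j) - r := by
        simp only [y]
        linear_combination (-s j) * hsr c hc j h - r * hss j
      have h3 : |x j - c j| = |s j * (x j - c j)| := by
        have : |s j| = 1 := by
          rw [hs]
          split_ifs <;> simp
        rw [abs_mul, this, one_mul]
      rw [h2, h3, abs_le]
      exact ⟨fun h => by linarith [h.2], fun h => ⟨h1.le, by linarith⟩⟩
    have hcube : ∀ c ∈ good, (∀ j, |x j - c j| ≤ r) ↔
        Finset.univ.sup' huniv (fun j => g c j x) ≤ 0 := by
      intro c hc
      obtain ⟨hct, hcq⟩ := Finset.mem_filter.1 hc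
      obtain ⟨k, hk⟩ := hint c hct
      have hk := le_antisymm (hcq k) hk
      simp only [Finset.sup'_le_iff, Finset.mem_univ, true_implies]
      constructor
      · intro h j
        by_cases hj : |q j - c j| = r
        · simpa only [g, hj, if_true] using (hface c hct j hj).1 (h j)
        · simp only [g, hj, if_false]
          exact (Finset.inf'_le _ (Finset.mem_univ k)).trans ((hface c hct k hk).1 (h k))
      · intro h j
        by_cases hj : |q j - c j| = r
        · exact (hface c hct j hj).2 (by simpa only [g, hj, if_true] using h j)
        · exact ((hxU c hct j).1 (lt_of_le_of_ne (hcq j) hj)).le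
    have hlast : diagonalChart f hf s hss hfs x ∈ HalfSpace3 ↔ f x ≤ 0 := by
      change 0 ≤ -f x ↔ f x ≤ 0
      exact neg_nonneg
    rw [hlast, memN, Finset.inf'_le_iff]
    constructor
    · rintro ⟨c, hc, h⟩
      have hcg : c ∈ good := by
        refine Finset.mem_filter.2 ⟨hc, fun j => ?_⟩
        by_contra hj
        exact absurd (h j) (not_le.2 ((hxU c hc j).2.1 (not_le.1 hj)))
      exact ⟨c, hcg, (hcube c hcg).1 h⟩
    · rintro ⟨c, hc, h⟩
      exact ⟨c, (Finset.mem_filter.1 hc).1, (hcube c hc).2 h⟩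

theorem ball_subset_closedCube (c : R3) (r : ℝ) : Metric.ball c r ⊆ closedCube c r := by
  intro x hx j
  have := PiLp.norm_apply_le (x - c) j
  rw [PiLp.sub_apply, Real.norm_eq_abs, ← dist_eq_norm] at this
  exact this.trans (Metric.mem_ball.1 hx).le

theorem closedCube_subset_ball (c : R3) {r : ℝ} (hr : 0 < r) :
    closedCube c r ⊆ Metric.ball c (2 * r) := by
  intro x hx
  have h (j : Fin 3) : (x j - c j) ^ 2 ≤ r ^ 2 := sq_le_sq' (abs_le.1 (hx j)).1 (abs_le.1 (hx j)).2
  rw [Metric.mem_ball, EuclideanSpace.dist_eq, Real.sqrt_lt' (by positivity)]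
  simp only [Fin.sum_univ_three, Real.dist_eq, sq_abs]
  nlinarith [h 0, h 1, h 2]

/-- Every compact set `K ⊆ ℝ³` has arbitrarily small neighbourhoods that are polyhedral
3-manifolds: for every open `V ⊇ K` there is `N` with `K ⊆ interior N ⊆ N ⊆ V` such that
`N` is a polyhedron and a topological 3-manifold with boundary. -/
theorem compact_has_polyhedral_manifold_neighbourhoods (K : Set R3) (hK : IsCompact K) :
    ∀ V : Set R3, IsOpen V → K ⊆ V →
      ∃ N : Set R3, K ⊆ interior N ∧ N ⊆ V ∧ IsPolyhedron N ∧ IsManifold3WithBoundary N := by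
  classical
  intro V hV hKV
  obtain ⟨δ, hδ, hδV⟩ := hK.exists_thickening_subset_open hV hKV
  obtain ⟨t, htK, htfin, htcov⟩ := hK.finite_cover_balls (e := δ / 4) (by positivity)
  lift t to Finset R3 using htfin
  let bad : Set ℝ := ⋃ c ∈ t, ⋃ d ∈ t, ⋃ j, {(c j - d j) / 2}
  have hbad : bad.Finite := t.finite_toSet.biUnion fun c _ =>
    t.finite_toSet.biUnion fun d _ => finite_iUnion fun j => finite_singleton _
  obtain ⟨r, ⟨hr1, hr2⟩, hrbad⟩ :=
    (Ioo_infinite (show δ / 4 < δ / 2 by linarith)).exists_notMem_finite hbad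
  have hr : 0 < r := by linarith
  refine ⟨⋃ c ∈ t, closedCube c r, ?_, ?_,
    isPolyhedron_biUnion t _ fun c _ => isPolyhedron_closedCube c hr.le,
    isManifold3WithBoundary_biUnion_closedCube t hr ?_⟩
  · refine htcov.trans (interior_maximal ?_ (isOpen_biUnion fun _ _ => Metric.isOpen_ball))
    exact iUnion₂_mono fun c _ =>
      (Metric.ball_subset_ball hr1.le).trans (ball_subset_closedCube c r)
  · refine iUnion₂_subset fun c hc => (closedCube_subset_ball c hr).trans ?_
    exact (Metric.ball_subset_ball (by linarith)).trans
      ((Metric.ball_subset_thickening (htK hc) δ).trans hδV)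
  · intro c hc d hd j h
    refine hrbad ?_
    simp only [bad, mem_iUnion, mem_singleton_iff]
    exact ⟨c, hc, d, hd, j, by linarith⟩
end
end

section
/- Let S³ denote the one-point compactification OnePoint ℝ³ of ℝ³ (homeomorphic to the 3-sphere), and let S ⊆ S³ be a nonempty compact connected set that is locally Euclidean of dimension 2, i.e. every point of S has an open neighbourhood in S homeomorphic to ℝ² = EuclideanSpace ℝ (Fin 2). Then S³ ∖ S has exactly two connected components. -/
open Set

noncomputable section

/-- The 3-sphere, as the one-point compactification of `ℝ³`. -/
abbrev S3 := OnePoint R3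

/-- A subset `S` of a topological space is locally Euclidean of dimension 2 if every point
of `S` has an open neighbourhood in the subspace `S` homeomorphic to `ℝ²`. -/
def LocallyEuclidean2 {X : Type*} [TopologicalSpace X] (S : Set X) : Prop :=
  ∀ p : S, ∃ V : Set S, IsOpen V ∧ p ∈ V ∧ Nonempty (↥V ≃ₜ EuclideanSpace ℝ (Fin 2))

section Chains

variable {E : Type*}

/-- Chains with coefficients in `ZMod 2` on finite sequences of points; the empty sequence is a
simplex of dimension `-1`, so that all homology below is reduced. -/
abbrev Chain (E : Type*) := List E →₀ ZMod 2

/-- The chain consisting of a single simplex. -/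
def simplex (l : List E) : Chain E := Finsupp.single l 1

/-- Joining a chain with a vertex. -/
def join (b : E) : Chain E →ₗ[ZMod 2] Chain E :=
  Finsupp.lmapDomain (ZMod 2) (ZMod 2) (List.cons b)

@[simp] theorem join_simplex (b : E) (l : List E) : join b (simplex l) = simplex (b :: l) := by
  simp [join, simplex]

/-- The linear map on chains with prescribed values on simplices. -/
def extend (f : List E → Chain E) : Chain E →ₗ[ZMod 2] Chain E :=
  Finsupp.linearCombination (ZMod 2) f

@[simp] theorem extend_simplex (f : List E → Chain E) (l : List E) :
    extend f (simplex l) = f l := by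
  simp [extend, simplex]

theorem chain_hom_ext {M : Type*} [AddCommMonoid M] [Module (ZMod 2) M]
    {f g : Chain E →ₗ[ZMod 2] M} (h : ∀ l, f (simplex l) = g (simplex l)) : f = g :=
  Finsupp.lhom_ext' fun l => LinearMap.ext_ring (h l)

theorem chain_add_self (c : Chain E) : c + c = 0 := ZModModule.add_self c

theorem chain_add_eq_zero {c c' : Chain E} : c + c' = 0 ↔ c = c' := by
  rw [add_eq_zero_iff_eq_neg, ZModModule.neg_eq_self]

/-- The boundary of a simplex. -/
def face : List E → Chain E
  | [] => 0
  | a :: l => simplex l + join a (face l)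

/-- The boundary operator. -/
def bd : Chain E →ₗ[ZMod 2] Chain E := extend face

theorem bd_simplex_nil : bd (simplex ([] : List E)) = 0 := by simp [bd, face]

theorem bd_join (b : E) (c : Chain E) : bd (join b c) = c + join b (bd c) := by
  have : bd ∘ₗ join b = LinearMap.id + join b ∘ₗ bd :=
    chain_hom_ext fun l => by simp [bd, face]
  exact LinearMap.congr_fun this c

theorem bd_simplex_cons (b : E) (l : List E) :
    bd (simplex (b :: l)) = simplex l + join b (bd (simplex l)) := by
  rw [← join_simplex, bd_join]

theorem bd_bd (c : Chain E) : bd (bd c) = 0 := by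
  have : bd ∘ₗ bd = (0 : Chain E →ₗ[ZMod 2] Chain E) := chain_hom_ext fun l => by
    induction l with
    | nil => simp [bd_simplex_nil]
    | cons a l ih =>
      have ih : bd (bd (simplex l)) = 0 := ih
      simp [bd_simplex_cons, bd_join, ih, chain_add_self]
  exact LinearMap.congr_fun this c

/-- Chains all of whose simplices have `n` vertices. -/
def homog (E : Type*) (n : ℕ) : Submodule (ZMod 2) (Chain E) :=
  Finsupp.supported (ZMod 2) (ZMod 2) {l | l.length = n}

theorem simplex_mem_supported {s : Set (List E)} {l : List E} (h : l ∈ s) :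
    simplex l ∈ Finsupp.supported (ZMod 2) (ZMod 2) s :=
  Finsupp.single_mem_supported _ _ h

theorem map_supported_le {M : Type*} [AddCommGroup M] [Module (ZMod 2) M] {s : Set (List E)}
    {p : Submodule (ZMod 2) M} (f : Chain E →ₗ[ZMod 2] M) (h : ∀ l ∈ s, f (simplex l) ∈ p)
    {c : Chain E} (hc : c ∈ Finsupp.supported (ZMod 2) (ZMod 2) s) : f c ∈ p := by
  rw [Finsupp.supported_eq_span_single] at hc
  have : Submodule.span (ZMod 2) ((fun i => Finsupp.single i (1 : ZMod 2)) '' s) ≤ p.comap f := by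
    rw [Submodule.span_le]
    rintro _ ⟨l, hl, rfl⟩
    exact h l hl
  exact this hc

theorem join_mem_supported {s t : Set (List E)} {b : E} (h : ∀ l ∈ s, b :: l ∈ t) {c : Chain E}
    (hc : c ∈ Finsupp.supported (ZMod 2) (ZMod 2) s) :
    join b c ∈ Finsupp.supported (ZMod 2) (ZMod 2) t :=
  map_supported_le _ (fun l hl => by
    rw [join_simplex]; exact simplex_mem_supported (h l hl)) hc

theorem bd_simplex_mem_supported (l : List E) :
    bd (simplex l) ∈ Finsupp.supported (ZMod 2) (ZMod 2)
      {l' : List E | l'.length + 1 = l.length ∧ l' ⊆ l} := by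
  induction l with
  | nil => rw [bd_simplex_nil]; exact zero_mem _
  | cons a l ih =>
    rw [bd_simplex_cons]
    refine add_mem (simplex_mem_supported ⟨by simp, by simp⟩) (join_mem_supported ?_ ih)
    rintro l' ⟨h1, h2⟩
    exact ⟨by simp [h1], List.cons_subset_cons _ h2⟩

theorem bd_mem_homog {n : ℕ} {c : Chain E} (hc : c ∈ homog E (n + 1)) : bd c ∈ homog E n :=
  map_supported_le _ (fun l hl => Finsupp.supported_mono
    (fun _ hl' => Nat.succ_injective (hl'.1.trans hl)) (bd_simplex_mem_supported l)) hc

/-- The part of a chain supported on simplices with `n` vertices. -/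
def homogPart (n : ℕ) : Chain E →ₗ[ZMod 2] Chain E :=
  extend fun l => if l.length = n then simplex l else 0

theorem homogPart_mem_homog (n : ℕ) (c : Chain E) : homogPart n c ∈ homog E n := by
  refine map_supported_le (s := univ) _ (fun l _ => ?_) (by simp)
  simp only [homogPart, extend_simplex]
  split_ifs with h
  · exact simplex_mem_supported h
  · exact zero_mem _

theorem homogPart_of_mem {n : ℕ} {c : Chain E} (hc : c ∈ homog E n) : homogPart n c = c := by
  have : (homogPart n - LinearMap.id : Chain E →ₗ[ZMod 2] Chain E) c ∈
      (⊥ : Submodule (ZMod 2) (Chain E)) :=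
    map_supported_le _ (fun l (hl : l.length = n) => by simp [homogPart, hl]) hc
  simpa [sub_eq_zero] using this

theorem homogPart_of_mem_ne {m n : ℕ} (hmn : m ≠ n) {c : Chain E} (hc : c ∈ homog E m) :
    homogPart n c = 0 := by
  have : homogPart n c ∈ (⊥ : Submodule (ZMod 2) (Chain E)) :=
    map_supported_le _ (fun l (hl : l.length = m) => by simp [homogPart, hl, hmn]) hc
  simpa using this

theorem bd_homogPart (n : ℕ) (c : Chain E) : bd (homogPart (n + 1) c) = homogPart n (bd c) := by
  have : bd ∘ₗ homogPart (n + 1) = homogPart n ∘ₗ bd (E := E) := chain_hom_ext fun l => by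
    have hl : simplex l ∈ homog E l.length := simplex_mem_supported rfl
    simp only [LinearMap.comp_apply]
    rcases l with _ | ⟨a, l⟩
    · rw [homogPart_of_mem_ne (by simp) hl, bd_simplex_nil, map_zero, map_zero]
    · have hb : bd (simplex (a :: l)) ∈ homog E l.length := bd_mem_homog hl
      by_cases h : l.length = n
      · subst h
        rw [homogPart_of_mem hb]
        exact congrArg bd (homogPart_of_mem hl)
      · rw [homogPart_of_mem_ne (by simpa using h) hl, homogPart_of_mem_ne h hb, map_zero]
  exact LinearMap.congr_fun this c

theorem exists_recursive_map (x : Chain E) (g : List E → Chain E → Chain E) :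
    ∃ f : Chain E →ₗ[ZMod 2] Chain E, f (simplex []) = x ∧
      ∀ l ≠ [], f (simplex l) = g l (f (bd (simplex l))) := by
  let F : ℕ → List E → Chain E := fun n => Nat.rec (fun _ => x)
    (fun _ r l => g l (extend r (bd (simplex l)))) n
  refine ⟨extend fun l => F l.length l, by simp [F], fun l hl => ?_⟩
  obtain ⟨n, hn⟩ : ∃ n, l.length = n + 1 :=
    Nat.exists_eq_succ_of_ne_zero fun h => hl (List.length_eq_zero_iff.1 h)
  have hs : simplex l ∈ homog E (n + 1) := simplex_mem_supported hn
  have : (extend (F n) - extend fun l => F l.length l) (bd (simplex l)) ∈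
      (⊥ : Submodule (ZMod 2) (Chain E)) :=
    map_supported_le _ (fun l (hl : l.length = n) => by simp [hl]) (bd_mem_homog hs)
  have h2 : extend (F n) (bd (simplex l)) = extend (fun l => F l.length l) (bd (simplex l)) := by
    simpa [sub_eq_zero] using this
  rw [extend_simplex, ← h2, hn]

theorem simplex_mem_homog (l : List E) : simplex l ∈ homog E l.length := simplex_mem_supported rfl

theorem bd_simplex_pair (a b : E) : bd (simplex [a, b]) = simplex [a] + simplex [b] := by
  simp [bd_simplex_cons, bd_simplex_nil, add_comm]

end Chains

section Subdivision

theorem chain_hom_ext_of_bd {E : Type*} {f g : Chain E →ₗ[ZMod 2] Chain E}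
    (h : ∀ l, f (bd (simplex l)) = g (bd (simplex l)) → f (simplex l) = g (simplex l)) :
    f = g := by
  refine chain_hom_ext fun l => ?_
  induction hn : l.length using Nat.strong_induction_on generalizing l with
  | _ n ih =>
    refine h l ?_
    have : (f - g : Chain E →ₗ[ZMod 2] Chain E) (bd (simplex l)) ∈
        (⊥ : Submodule (ZMod 2) (Chain E)) :=
      map_supported_le _ (fun l' hl' => by
        simp [ih l'.length (by have := hl'.1; omega) l' rfl]) (bd_simplex_mem_supported l)
    simpa [sub_eq_zero] using this

theorem exists_dist_bound {E : Type*} [PseudoMetricSpace E] (l : List E) :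
    ∃ δ, 0 ≤ δ ∧ ∀ x ∈ l, ∀ y ∈ l, dist x y ≤ δ :=
  ⟨Metric.diam {x | x ∈ l}, Metric.diam_nonneg, fun _ hx _ hy =>
    Metric.dist_le_diam_of_mem (List.finite_toSet l).isBounded hx hy⟩

variable {E : Type*} [NormedAddCommGroup E] [NormedSpace ℝ E]

/-- The convex hull of the vertices of a simplex. -/
def hull (l : List E) : Set E := convexHull ℝ {x | x ∈ l}

theorem hull_mono {l l' : List E} (h : l ⊆ l') : hull l ⊆ hull l' := convexHull_mono h

theorem hull_nil : hull ([] : List E) = ∅ := by simp [hull]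

theorem mem_hull {l : List E} {x : E} (h : x ∈ l) : x ∈ hull l := subset_convexHull ℝ _ h

theorem hull_singleton (a : E) : hull [a] = {a} := by simp [hull]

theorem hull_pair (a b : E) : hull [a, b] = segment ℝ a b := by
  have : {x | x ∈ [a, b]} = {a, b} := by ext; simp
  rw [hull, this, convexHull_pair]

theorem hull_cons_subset {a : E} {l : List E} {U : Set E} (hU : StarConvex ℝ a U) (ha : a ∈ U)
    (hl : hull l ⊆ U) : hull (a :: l) ⊆ U := by
  have : {x | x ∈ a :: l} = insert a {x | x ∈ l} := by ext; simp
  rw [hull, this]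
  rcases l with _ | ⟨b, l⟩
  · simpa using ha
  · rw [convexHull_insert ⟨b, by simp⟩]
    intro x hx
    simp only [convexJoin_singleton_left, mem_iUnion] at hx
    obtain ⟨y, hy, hx⟩ := hx
    exact hU.segment_subset (hl hy) hx

theorem isCompact_hull (l : List E) : IsCompact (hull l) :=
  (List.finite_toSet l).isCompact_convexHull ℝ

/-- Chains whose simplices are contained in `U`. -/
def chainsIn (U : Set E) : Submodule (ZMod 2) (Chain E) :=
  Finsupp.supported (ZMod 2) (ZMod 2) {l | hull l ⊆ U}

theorem chainsIn_mono {U V : Set E} (h : U ⊆ V) : chainsIn U ≤ chainsIn V :=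
  Finsupp.supported_mono fun _ hl => Subset.trans hl h

theorem mem_chainsIn_inter {U V : Set E} {c : Chain E} (hU : c ∈ chainsIn U)
    (hV : c ∈ chainsIn V) : c ∈ chainsIn (U ∩ V) :=
  fun _ hl => subset_inter (hU hl) (hV hl)

theorem simplex_mem_chainsIn {U : Set E} {l : List E} (h : hull l ⊆ U) :
    simplex l ∈ chainsIn U := simplex_mem_supported h

theorem bd_mem_chainsIn {U : Set E} {c : Chain E} (hc : c ∈ chainsIn U) : bd c ∈ chainsIn U :=
  map_supported_le _ (fun l hl => Finsupp.supported_mono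
    (fun _ hl' => (hull_mono hl'.2).trans hl) (bd_simplex_mem_supported l)) hc

theorem homogPart_mem_chainsIn (n : ℕ) {U : Set E} {c : Chain E} (hc : c ∈ chainsIn U) :
    homogPart n c ∈ chainsIn U :=
  map_supported_le _ (fun l hl => by
    simp only [homogPart, extend_simplex]
    split_ifs
    · exact simplex_mem_supported hl
    · exact zero_mem _) hc

theorem join_mem_chainsIn {a : E} {U : Set E} (hU : StarConvex ℝ a U) (ha : a ∈ U) {c : Chain E}
    (hc : c ∈ chainsIn U) : join a c ∈ chainsIn U :=
  join_mem_supported (fun _ hl => hull_cons_subset hU ha hl) hc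

/-- The barycenter of the vertices. -/
def bary (l : List E) : E := (l.length : ℝ)⁻¹ • l.sum

theorem bary_mem_hull {l : List E} (hl : l ≠ []) : bary l ∈ hull l := by
  have h0 : (l.length : ℝ) ≠ 0 := by simpa using hl
  rw [bary, ← Fin.sum_univ_getElem, Finset.smul_sum]
  refine (convex_convexHull ℝ _).sum_mem (fun _ _ => by positivity) ?_ fun i _ =>
    mem_hull (List.getElem_mem _)
  simp [h0]

theorem dist_bary_le {l : List E} {N : ℕ} (hN : l.length ≤ N + 1) {δ : ℝ} (hδ : 0 ≤ δ)
    (h : ∀ x ∈ l, ∀ y ∈ l, dist x y ≤ δ) {v : E} (hv : v ∈ hull l) :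
    dist (bary l) v ≤ N / (N + 1) * δ := by
  suffices H : hull l ⊆ Metric.closedBall (bary l) (N / (N + 1) * δ) by
    rw [dist_comm]; exact H hv
  refine convexHull_min (fun v (hv : v ∈ l) => ?_) (convex_closedBall _ _)
  obtain ⟨j, hj, rfl⟩ := List.mem_iff_getElem.1 hv
  set m := l.length with hm
  have hm0 : (0 : ℝ) < m := by exact_mod_cast (by omega : 0 < m)
  have e : bary l - l[j] = (m : ℝ)⁻¹ • ∑ i : Fin m, (l[i] - l[j]) := by
    rw [Finset.sum_sub_distrib, smul_sub, bary, ← Fin.sum_univ_getElem]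
    simp [← Nat.cast_smul_eq_nsmul ℝ, smul_smul, hm0.ne', m]
  have b : ∑ i : Fin m, ‖l[i] - l[j]‖ ≤ (m - 1) * δ := by
    rw [← Finset.add_sum_erase _ _ (Finset.mem_univ (⟨j, hj⟩ : Fin m))]
    refine (add_le_add_right (Finset.sum_le_card_nsmul _ _ δ fun i _ => ?_) _).trans ?_
    · rw [← dist_eq_norm]; exact h _ (List.getElem_mem _) _ hv
    · rw [Finset.card_erase_of_mem (Finset.mem_univ _)]
      simp [Nat.cast_sub (by omega : 1 ≤ m)]
  rw [Metric.mem_closedBall, dist_comm, dist_eq_norm, e, norm_smul, norm_inv, Real.norm_natCast]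
  have hN' : (m : ℝ) ≤ N + 1 := by exact_mod_cast hN
  calc (m : ℝ)⁻¹ * ‖∑ i : Fin m, (l[i] - l[j])‖ ≤ (m : ℝ)⁻¹ * ((m - 1) * δ) := by
        gcongr; exact (norm_sum_le _ _).trans b
    _ = ((m - 1) / m) * δ := by ring
    _ ≤ N / (N + 1) * δ := by
        refine mul_le_mul_of_nonneg_right ?_ hδ
        rw [div_le_div_iff₀ hm0 (by positivity)]
        nlinarith

/-- Barycentric subdivision. -/
def sd (E : Type*) [NormedAddCommGroup E] [NormedSpace ℝ E] : Chain E →ₗ[ZMod 2] Chain E :=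
  (exists_recursive_map (simplex []) fun l c => join (bary l) c).choose

theorem sd_nil : sd E (simplex []) = simplex [] :=
  (exists_recursive_map (simplex []) fun l c => join (bary l) c).choose_spec.1

theorem sd_simplex {l : List E} (hl : l ≠ []) :
    sd E (simplex l) = join (bary l) (sd E (bd (simplex l))) :=
  (exists_recursive_map (simplex []) fun l c => join (bary l) c).choose_spec.2 l hl

theorem bd_sd (c : Chain E) : bd (sd E c) = sd E (bd c) := by
  have : bd ∘ₗ sd E = sd E ∘ₗ bd := chain_hom_ext_of_bd fun l h => by
    simp only [LinearMap.comp_apply, bd_bd, map_zero] at h ⊢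
    rcases eq_or_ne l [] with rfl | hl
    · rw [sd_nil, bd_simplex_nil, map_zero]
    · rw [sd_simplex hl, bd_join, h, map_zero, add_zero]
  exact LinearMap.congr_fun this c

/-- The chain homotopy between barycentric subdivision and the identity. -/
def sdHomotopy (E : Type*) [NormedAddCommGroup E] [NormedSpace ℝ E] :
    Chain E →ₗ[ZMod 2] Chain E :=
  (exists_recursive_map 0 fun l c => join (bary l) (simplex l + c)).choose

theorem sdHomotopy_nil : sdHomotopy E (simplex []) = 0 :=
  (exists_recursive_map 0 fun l c => join (bary l) (simplex l + c)).choose_spec.1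

theorem sdHomotopy_simplex {l : List E} (hl : l ≠ []) :
    sdHomotopy E (simplex l) =
      join (bary l) (simplex l + sdHomotopy E (bd (simplex l))) :=
  (exists_recursive_map 0 fun l c => join (bary l) (simplex l + c)).choose_spec.2 l hl

theorem bd_sdHomotopy (c : Chain E) :
    bd (sdHomotopy E c) + sdHomotopy E (bd c) = c + sd E c := by
  have : bd ∘ₗ sdHomotopy E + sdHomotopy E ∘ₗ bd = LinearMap.id + sd E :=
    chain_hom_ext_of_bd fun l h => by
      simp only [LinearMap.comp_apply, LinearMap.add_apply, LinearMap.id_apply, bd_bd,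
        map_zero, add_zero] at h ⊢
      rcases eq_or_ne l [] with rfl | hl
      · rw [sdHomotopy_nil, bd_simplex_nil, sd_nil, chain_add_self]; simp
      · rw [sdHomotopy_simplex hl, bd_join, map_add, h, sd_simplex hl, ← add_assoc (bd _),
          chain_add_self, zero_add, add_right_comm, add_assoc (simplex l), chain_add_self,
          add_zero]
  exact LinearMap.congr_fun this c

theorem sd_simplex_mem {N : ℕ} {δ : ℝ} (hδ : 0 ≤ δ) (l : List E) (hN : l.length ≤ N + 1)
    (h : ∀ x ∈ l, ∀ y ∈ l, dist x y ≤ δ) :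
    sd E (simplex l) ∈ Finsupp.supported (ZMod 2) (ZMod 2)
      {l' : List E | l'.length = l.length ∧ hull l' ⊆ hull l ∧
        ∀ x ∈ l', ∀ y ∈ l', dist x y ≤ N / (N + 1) * δ} := by
  induction hn : l.length using Nat.strong_induction_on generalizing l with
  | _ n ih =>
    rcases eq_or_ne l [] with rfl | hl
    · rw [sd_nil]
      exact simplex_mem_supported ⟨by simpa using hn, by simp, by simp⟩
    rw [sd_simplex hl]
    have key : sd E (bd (simplex l)) ∈ Finsupp.supported (ZMod 2) (ZMod 2)
        {l' : List E | l'.length + 1 = l.length ∧ hull l' ⊆ hull l ∧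
          ∀ x ∈ l', ∀ y ∈ l', dist x y ≤ N / (N + 1) * δ} := by
      refine map_supported_le _ (fun l' hl' => ?_) (bd_simplex_mem_supported l)
      have h1 := hl'.1
      refine Finsupp.supported_mono ?_ (ih l'.length (by omega) l' (by omega)
        (fun x hx y hy => h x (hl'.2 hx) y (hl'.2 hy)) rfl)
      rintro l'' ⟨h2, h3, h4⟩
      exact ⟨by omega, h3.trans (hull_mono hl'.2), h4⟩
    refine join_mem_supported ?_ key
    rintro l' ⟨h1, h2, h3⟩
    refine ⟨by simp; omega, hull_cons_subset ((convex_convexHull ℝ _).starConvex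
      (bary_mem_hull hl)) (bary_mem_hull hl) h2, ?_⟩
    have hb : ∀ x ∈ l', dist (bary l) x ≤ N / (N + 1) * δ := fun x hx =>
      dist_bary_le hN hδ h (h2 (mem_hull hx))
    intro x hx y hy
    rcases List.mem_cons.1 hx with rfl | hx <;> rcases List.mem_cons.1 hy with rfl | hy
    · rw [dist_self]; positivity
    · exact hb y hy
    · rw [dist_comm]; exact hb x hx
    · exact h3 x hx y hy

theorem sd_mem_homog {n : ℕ} {c : Chain E} (hc : c ∈ homog E n) : sd E c ∈ homog E n :=
  map_supported_le _ (fun l (hl : l.length = n) => by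
    obtain ⟨δ, hδ, h⟩ := exists_dist_bound l
    exact Finsupp.supported_mono (fun l' hl' => hl'.1.trans hl)
      (sd_simplex_mem hδ l (Nat.le_succ _) h)) hc

theorem sd_mem_chainsIn {U : Set E} {c : Chain E} (hc : c ∈ chainsIn U) :
    sd E c ∈ chainsIn U :=
  map_supported_le _ (fun l hl => by
    obtain ⟨δ, hδ, h⟩ := exists_dist_bound l
    exact Finsupp.supported_mono (fun l' hl' => hl'.2.1.trans hl)
      (sd_simplex_mem hδ l (Nat.le_succ _) h)) hc

theorem sdHomotopy_mem_chainsIn {U : Set E} {c : Chain E} (hc : c ∈ chainsIn U) :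
    sdHomotopy E c ∈ chainsIn U := by
  have key : ∀ l : List E, sdHomotopy E (simplex l) ∈ chainsIn (hull l) := by
    intro l
    induction hn : l.length using Nat.strong_induction_on generalizing l with
    | _ n ih =>
      rcases eq_or_ne l [] with rfl | hl
      · rw [sdHomotopy_nil]; exact zero_mem _
      rw [sdHomotopy_simplex hl]
      refine join_mem_chainsIn ((convex_convexHull ℝ _).starConvex (bary_mem_hull hl))
        (bary_mem_hull hl) (add_mem (simplex_mem_chainsIn le_rfl) ?_)
      refine map_supported_le _ (fun l' hl' => ?_) (bd_simplex_mem_supported l)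
      exact chainsIn_mono (hull_mono hl'.2) (ih l'.length (by have := hl'.1; omega) l' rfl)
  exact map_supported_le _ (fun l hl => chainsIn_mono hl (key l)) hc

theorem sd_pow_succ (k : ℕ) (c : Chain E) : (sd E ^ (k + 1)) c = sd E ((sd E ^ k) c) := by
  rw [pow_succ', Module.End.mul_apply]

theorem sd_pow_simplex_mem {N : ℕ} {δ : ℝ} (hδ : 0 ≤ δ) (l : List E) (hN : l.length ≤ N + 1)
    (h : ∀ x ∈ l, ∀ y ∈ l, dist x y ≤ δ) (k : ℕ) :
    (sd E ^ k) (simplex l) ∈ Finsupp.supported (ZMod 2) (ZMod 2)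
      {l' : List E | l'.length = l.length ∧ hull l' ⊆ hull l ∧
        ∀ x ∈ l', ∀ y ∈ l', dist x y ≤ (N / (N + 1)) ^ k * δ} := by
  induction k with
  | zero => exact simplex_mem_supported ⟨rfl, le_rfl, by simpa using h⟩
  | succ k ih =>
    rw [sd_pow_succ]
    refine map_supported_le _ ?_ ih
    rintro l' ⟨h1, h2, h3⟩
    refine Finsupp.supported_mono ?_ (sd_simplex_mem (N := N) (by positivity) l' (by omega) h3)
    rintro l'' ⟨h4, h5, h6⟩
    exact ⟨h4.trans h1, h5.trans h2, by rw [pow_succ']; simpa only [mul_assoc] using h6⟩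

theorem eventually_sd_pow_mem {U V : Set E} (hU : IsOpen U) (hV : IsOpen V) {c : Chain E}
    (hc : c ∈ chainsIn (U ∪ V)) :
    ∃ k₀, ∀ k ≥ k₀, (sd E ^ k) c ∈ chainsIn U ⊔ chainsIn V := by
  have hc' := hc
  rw [chainsIn, Finsupp.supported_eq_span_single] at hc'
  induction hc' using Submodule.span_induction with
  | zero => exact ⟨0, fun k _ => by simp⟩
  | add x y hx hy ihx ihy =>
    obtain ⟨k₁, h₁⟩ := ihx (by rwa [chainsIn, Finsupp.supported_eq_span_single])
    obtain ⟨k₂, h₂⟩ := ihy (by rwa [chainsIn, Finsupp.supported_eq_span_single])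
    refine ⟨max k₁ k₂, fun k hk => ?_⟩
    rw [map_add]
    exact add_mem (h₁ k (le_of_max_le_left hk)) (h₂ k (le_of_max_le_right hk))
  | smul a x hx ih =>
    obtain ⟨k₁, h₁⟩ := ih (by rwa [chainsIn, Finsupp.supported_eq_span_single])
    exact ⟨k₁, fun k hk => by rw [map_smul]; exact Submodule.smul_mem _ _ (h₁ k hk)⟩
  | mem x hx =>
    obtain ⟨l, hl, rfl⟩ := hx
    obtain ⟨ε, hε, hleb⟩ := lebesgue_number_lemma_of_metric (c := fun b : Bool => cond b U V)
      (isCompact_hull l) (by simp [hU, hV])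
      (hl.trans (union_subset (subset_iUnion_of_subset true le_rfl)
        (subset_iUnion_of_subset false le_rfl)))
    obtain ⟨δ, hδ, h⟩ := exists_dist_bound l
    have ht : Filter.Tendsto (fun k : ℕ => ((l.length : ℝ) / (l.length + 1)) ^ k * δ)
        Filter.atTop (nhds 0) := by
      simpa using (tendsto_pow_atTop_nhds_zero_of_lt_one (by positivity)
        ((div_lt_one (by positivity)).2 (lt_add_one _))).mul_const δ
    obtain ⟨k₀, hk₀⟩ := Filter.eventually_atTop.1 (ht.eventually_lt_const hε)
    refine ⟨k₀, fun k hk => ?_⟩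
    refine map_supported_le (s := {l' | hull l' ⊆ U ∨ hull l' ⊆ V}) LinearMap.id
      (fun l' hl' => ?_) (Finsupp.supported_mono ?_ (sd_pow_simplex_mem hδ l (Nat.le_succ _) h k))
    · rcases hl' with hl' | hl'
      · exact Submodule.mem_sup_left (simplex_mem_chainsIn hl')
      · exact Submodule.mem_sup_right (simplex_mem_chainsIn hl')
    · rintro l' ⟨-, h2, h3⟩
      rcases l' with _ | ⟨x, l'⟩
      · left; simp [hull_nil]
      · obtain ⟨i, hi⟩ := hleb x (h2 (mem_hull (by simp)))
        have : hull (x :: l') ⊆ Metric.ball x ε := convexHull_min (fun y hy => by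
          rw [Metric.mem_ball]
          exact (h3 y hy x (by simp)).trans_lt (hk₀ k hk)) (convex_ball _ _)
        cases i
        · exact Or.inr (this.trans hi)
        · exact Or.inl (this.trans hi)

theorem exists_sd_pow_homotopy (k : ℕ) : ∃ T : Chain E →ₗ[ZMod 2] Chain E,
    (∀ c, bd (T c) + T (bd c) = c + (sd E ^ k) c) ∧
      ∀ (U : Set E), ∀ c ∈ chainsIn U, T c ∈ chainsIn U := by
  induction k with
  | zero => exact ⟨0, fun c => by simp [chain_add_self], fun U c _ => zero_mem _⟩
  | succ k ih =>
    obtain ⟨T, h1, h2⟩ := ih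
    refine ⟨T + sdHomotopy E ∘ₗ (sd E ^ k), fun c => ?_, fun U c hc => ?_⟩
    · have hb : ∀ c, bd ((sd E ^ k) c) = (sd E ^ k) (bd c) := fun c =>
        LinearMap.congr_fun ((Commute.pow_right (show Commute bd (sd E) from
          LinearMap.ext bd_sd) k).eq) c
      have h3 := bd_sdHomotopy ((sd E ^ k) c)
      rw [hb] at h3
      rw [sd_pow_succ]
      simp only [LinearMap.add_apply, LinearMap.comp_apply, map_add]
      rw [add_add_add_comm, h1, h3, add_assoc, ← add_assoc _ _ (sd E _), chain_add_self, zero_add]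
    · refine add_mem (h2 U c hc) (sdHomotopy_mem_chainsIn ?_)
      clear h1 h2 T
      induction k with
      | zero => exact hc
      | succ k ih => rw [sd_pow_succ]; exact sd_mem_chainsIn ih

theorem exists_fine_subdivision {U V : Set E} (hU : IsOpen U) (hV : IsOpen V) {w : Chain E}
    (hw : w ∈ chainsIn (U ∪ V)) : ∃ Φ T : Chain E →ₗ[ZMod 2] Chain E,
    Φ w ∈ chainsIn U ⊔ chainsIn V ∧ (∀ c, bd (Φ c) = Φ (bd c)) ∧
      (∀ c, bd (T c) + T (bd c) = c + Φ c) ∧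
      (∀ (W : Set E), ∀ c ∈ chainsIn W, Φ c ∈ chainsIn W) ∧
      (∀ (W : Set E), ∀ c ∈ chainsIn W, T c ∈ chainsIn W) ∧
      ∀ n, ∀ c ∈ homog E n, Φ c ∈ homog E n := by
  obtain ⟨k, hk⟩ := eventually_sd_pow_mem hU hV hw
  obtain ⟨T, h1, h2⟩ := exists_sd_pow_homotopy (E := E) k
  refine ⟨sd E ^ k, T, hk k le_rfl, fun c => LinearMap.congr_fun ((Commute.pow_right
    (show Commute bd (sd E) from LinearMap.ext bd_sd) k).eq) c, h1, fun W c hc => ?_, h2,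
    fun n c hc => ?_⟩
  · clear hk h1 h2 T
    induction k with
    | zero => exact hc
    | succ k ih => rw [sd_pow_succ]; exact sd_mem_chainsIn ih
  · clear hk h1 h2 T
    induction k with
    | zero => exact hc
    | succ k ih => rw [sd_pow_succ]; exact sd_mem_homog ih

end Subdivision

section Homology

variable {E : Type*} [NormedAddCommGroup E] [NormedSpace ℝ E]

/-- A chain bounds in `U` if it is the boundary of a chain in `U`. -/
def Bounds (U : Set E) (z : Chain E) : Prop := ∃ w ∈ chainsIn U, bd w = z

/-- Vanishing of the reduced homology of `U`. -/
def Acyclic (U : Set E) : Prop := ∀ z ∈ chainsIn U, bd z = 0 → Bounds U z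

/-- The reduced homology of `U` has a single nonzero class, and it is represented by a cycle of
simplices with `n` vertices. -/
def RankOne (n : ℕ) (U : Set E) : Prop :=
  ∃ z₀ ∈ chainsIn U, z₀ ∈ homog E n ∧ bd z₀ = 0 ∧ ¬ Bounds U z₀ ∧
    ∀ z ∈ chainsIn U, bd z = 0 → Bounds U z ∨ Bounds U (z + z₀)

variable {U V U' V' : Set E}

theorem bounds_bd {w : Chain E} (hw : w ∈ chainsIn U) : Bounds U (bd w) := ⟨w, hw, rfl⟩

theorem Bounds.zero : Bounds U 0 := ⟨0, zero_mem _, map_zero _⟩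

theorem Bounds.add {z z' : Chain E} (h : Bounds U z) (h' : Bounds U z') : Bounds U (z + z') := by
  obtain ⟨w, hw, rfl⟩ := h
  obtain ⟨w', hw', rfl⟩ := h'
  exact ⟨w + w', add_mem hw hw', map_add _ _ _⟩

theorem Bounds.mono {z : Chain E} (h : Bounds U z) (hUV : U ⊆ V) : Bounds V z :=
  ⟨h.choose, chainsIn_mono hUV h.choose_spec.1, h.choose_spec.2⟩

theorem Bounds.bd_eq_zero {z : Chain E} (h : Bounds U z) : bd z = 0 := by
  obtain ⟨w, -, rfl⟩ := h
  exact bd_bd w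

theorem StarConvex.acyclic {a : E} (hU : StarConvex ℝ a U) (ha : a ∈ U) : Acyclic U :=
  fun z hz hz0 => ⟨join a z, join_mem_chainsIn hU ha hz, by simp [bd_join, hz0]⟩

theorem Bounds.exists_homog {n : ℕ} {z : Chain E} (h : Bounds U z) (hz : z ∈ homog E n) :
    ∃ w ∈ chainsIn U, w ∈ homog E (n + 1) ∧ bd w = z := by
  obtain ⟨w, hw, rfl⟩ := h
  exact ⟨homogPart (n + 1) w, homogPart_mem_chainsIn _ hw, homogPart_mem_homog _ _, by
    rw [bd_homogPart, homogPart_of_mem hz]⟩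

theorem Bounds.bd_of_add (hU : IsOpen U) (hV : IsOpen V) {x y : Chain E} (hx : x ∈ chainsIn U)
    (hy : y ∈ chainsIn V) (h : Bounds (U ∪ V) (x + y)) : Bounds (U ∩ V) (bd x) := by
  have hxy : bd x = bd y := by simpa [chain_add_eq_zero] using h.bd_eq_zero
  obtain ⟨w, hw, hwxy⟩ := h
  obtain ⟨Φ, T, h1, h2, h3, h4, h5, -⟩ := exists_fine_subdivision hU hV hw
  obtain ⟨a, ha, b, hb, hab⟩ := Submodule.mem_sup.1 h1
  have hm : Φ x + bd a = Φ y + bd b := by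
    have := h2 w
    rw [← hab, hwxy, map_add, map_add] at this
    rw [← chain_add_eq_zero]
    rw [← chain_add_eq_zero] at this
    rw [← this]
    abel
  have hbd : bd x ∈ chainsIn (U ∩ V) :=
    mem_chainsIn_inter (bd_mem_chainsIn hx) (hxy ▸ bd_mem_chainsIn hy)
  refine ⟨Φ x + bd a + T (bd x), add_mem (mem_chainsIn_inter
    (add_mem (h4 _ _ hx) (bd_mem_chainsIn ha)) (hm ▸ add_mem (h4 _ _ hy) (bd_mem_chainsIn hb)))
    (h5 _ _ hbd), ?_⟩
  have := h3 (bd x)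
  rw [bd_bd, map_zero, add_zero] at this
  rw [map_add, map_add, bd_bd, this, h2, add_zero, add_comm (bd x), ← add_assoc, chain_add_self,
    zero_add]

theorem exists_split (hU : IsOpen U) (hV : IsOpen V) {z : Chain E} (hz : z ∈ chainsIn (U ∪ V))
    (hz0 : bd z = 0) : ∃ zU ∈ chainsIn U, ∃ zV ∈ chainsIn V, bd zU = bd zV ∧
      Bounds (U ∪ V) (z + (zU + zV)) ∧ ∀ n, z ∈ homog E n → zU ∈ homog E n ∧ zV ∈ homog E n := by
  obtain ⟨Φ, T, h1, h2, h3, h4, h5, h6⟩ := exists_fine_subdivision hU hV hz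
  classical
  set a := (Φ z).filter (fun l => hull l ⊆ U) with ha
  set b := (Φ z).filter (fun l => ¬ hull l ⊆ U) with hb
  have hab : a + b = Φ z := Finsupp.filter_add_filter_not _ _
  have haU : a ∈ chainsIn U := by
    intro l hl
    simp only [ha, Finset.mem_coe, Finsupp.support_filter, Finset.mem_filter] at hl
    exact hl.2
  have hbV : b ∈ chainsIn V := by
    rw [chainsIn, chainsIn, ← Finsupp.supported_union] at h1
    intro l hl
    simp only [hb, Finset.mem_coe, Finsupp.support_filter, Finset.mem_filter] at hl
    exact (h1 hl.1).resolve_left hl.2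
  refine ⟨a, haU, b, hbV, ?_, ?_, fun n hn => ⟨fun l hl => ?_, fun l hl => ?_⟩⟩
  · rw [← chain_add_eq_zero, ← map_add, hab, h2, hz0, map_zero]
  · rw [hab, ← h3, hz0, map_zero, add_zero]
    exact bounds_bd (h5 _ _ hz)
  · simp only [ha, Finset.mem_coe, Finsupp.support_filter, Finset.mem_filter] at hl
    exact h6 n z hn hl.1
  · simp only [hb, Finset.mem_coe, Finsupp.support_filter, Finset.mem_filter] at hl
    exact h6 n z hn hl.1

theorem Acyclic.bounds_add (hU : Acyclic U) (hV : Acyclic V) {x y m : Chain E}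
    (hx : x ∈ chainsIn U) (hy : y ∈ chainsIn V) (hm : m ∈ chainsIn (U ∩ V))
    (hxm : bd x = bd m) (hym : bd y = bd m) : Bounds (U ∪ V) (x + y) := by
  have h1 := (hU (x + m) (add_mem hx (chainsIn_mono inter_subset_left hm))
    (by rw [map_add, hxm, chain_add_self])).mono (subset_union_left (t := V))
  have h2 := (hV (y + m) (add_mem hy (chainsIn_mono inter_subset_right hm))
    (by rw [map_add, hym, chain_add_self])).mono (subset_union_right (s := U))
  have := h1.add h2
  rwa [add_add_add_comm, chain_add_self, add_zero] at this

theorem Acyclic.inter (hUo : IsOpen U) (hVo : IsOpen V) (hU : Acyclic U) (hV : Acyclic V)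
    (hUV : Acyclic (U ∪ V)) : Acyclic (U ∩ V) := by
  intro z hz hz0
  obtain ⟨x, hx, rfl⟩ := hU z (chainsIn_mono inter_subset_left hz) hz0
  obtain ⟨y, hy, hxy⟩ := hV _ (chainsIn_mono inter_subset_right hz) hz0
  exact Bounds.bd_of_add hUo hVo hx hy (hUV _ (add_mem (chainsIn_mono subset_union_left hx)
    (chainsIn_mono subset_union_right hy)) (by rw [map_add, hxy, chain_add_self]))

theorem RankOne.union {n : ℕ} (hUo : IsOpen U) (hVo : IsOpen V) (hU : Acyclic U) (hV : Acyclic V)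
    (h : RankOne n (U ∩ V)) : RankOne (n + 1) (U ∪ V) := by
  obtain ⟨z₀, hz, hn, hz0, hb, h⟩ := h
  obtain ⟨x, hx, hxn, rfl⟩ :=
    (hU z₀ (chainsIn_mono inter_subset_left hz) hz0).exists_homog hn
  obtain ⟨y, hy, hyn, hxy⟩ :=
    (hV _ (chainsIn_mono inter_subset_right hz) hz0).exists_homog hn
  have hxU := chainsIn_mono (subset_union_left (t := V)) hx
  have hyV := chainsIn_mono (subset_union_right (s := U)) hy
  refine ⟨x + y, add_mem hxU hyV, add_mem hxn hyn, by rw [map_add, hxy, chain_add_self],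
    fun hB => hb (hB.bd_of_add hUo hVo hx hy), fun z hz hz0 => ?_⟩
  obtain ⟨zU, hzU, zV, hzV, hUV, hB, -⟩ := exists_split hUo hVo hz hz0
  refine (h (bd zU) (mem_chainsIn_inter (bd_mem_chainsIn hzU) (hUV ▸ bd_mem_chainsIn hzV))
    (bd_bd _)).imp (fun ⟨m, hm, hm'⟩ => ?_) (fun ⟨m, hm, hm'⟩ => ?_)
  · have := hB.add (hU.bounds_add hV hzU hzV hm hm'.symm (by rw [hm', hUV]))
    rwa [add_assoc, chain_add_self, add_zero] at this
  · have := hB.add (hU.bounds_add hV (add_mem hzU hx) (add_mem hzV hy) hm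
      (by rw [map_add, hm']) (by rw [map_add, hm', hUV, hxy]))
    rwa [add_add_add_comm zU, ← add_assoc, add_assoc z, chain_add_self, add_zero] at this

theorem RankOne.inter {n : ℕ} (hUo : IsOpen U) (hVo : IsOpen V) (hU : Acyclic U) (hV : Acyclic V)
    (h : RankOne (n + 1) (U ∪ V)) : RankOne n (U ∩ V) := by
  obtain ⟨z₀, hz, hn, hz0, hb, h⟩ := h
  obtain ⟨zU, hzU, zV, hzV, hUV, hB, hn'⟩ := exists_split hUo hVo hz hz0
  refine ⟨bd zU, mem_chainsIn_inter (bd_mem_chainsIn hzU) (hUV ▸ bd_mem_chainsIn hzV),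
    bd_mem_homog (hn' _ hn).1, bd_bd _, fun ⟨m, hm, hm'⟩ => hb ?_, fun z hz hz0 => ?_⟩
  · have := hB.add (hU.bounds_add hV hzU hzV hm hm'.symm (by rw [hm', hUV]))
    rwa [add_assoc, chain_add_self, add_zero] at this
  · obtain ⟨x, hx, rfl⟩ := hU z (chainsIn_mono inter_subset_left hz) hz0
    obtain ⟨y, hy, hxy⟩ := hV _ (chainsIn_mono inter_subset_right hz) hz0
    refine (h (x + y) (add_mem (chainsIn_mono subset_union_left hx)
      (chainsIn_mono subset_union_right hy)) (by rw [map_add, hxy, chain_add_self])).imp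
      (fun hB' => hB'.bd_of_add hUo hVo hx hy) fun hB' => ?_
    rw [← map_add]
    refine Bounds.bd_of_add hUo hVo (add_mem hx hzU) (add_mem hy hzV) ?_
    have := hB'.add hB
    rwa [add_assoc, ← add_assoc z₀, chain_add_self, zero_add, add_add_add_comm] at this

/-- Injectivity of the map on homology induced by an inclusion passes from unions of acyclic open
sets to their intersections. -/
theorem bounds_inter_of_bounds_union (hUo : IsOpen U) (hVo : IsOpen V) (hU : Acyclic U)
    (hV : Acyclic V) (hU' : Acyclic U') (hV' : Acyclic V')
    (h : ∀ z ∈ chainsIn (U ∪ V), bd z = 0 → Bounds (U' ∪ V') z → Bounds (U ∪ V) z)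
    (hUU' : U ⊆ U') (hVV' : V ⊆ V') {z : Chain E} (hz : z ∈ chainsIn (U ∩ V)) (hz0 : bd z = 0)
    (hB : Bounds (U' ∩ V') z) : Bounds (U ∩ V) z := by
  obtain ⟨x, hx, rfl⟩ := hU z (chainsIn_mono inter_subset_left hz) hz0
  obtain ⟨y, hy, hxy⟩ := hV _ (chainsIn_mono inter_subset_right hz) hz0
  obtain ⟨m, hm, hm'⟩ := hB
  exact Bounds.bd_of_add hUo hVo hx hy (h _ (add_mem (chainsIn_mono subset_union_left hx)
    (chainsIn_mono subset_union_right hy)) (by rw [map_add, hxy, chain_add_self])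
    (hU'.bounds_add hV' (chainsIn_mono hUU' hx) (chainsIn_mono hVV' hy) hm hm'.symm
      (by rw [hm', hxy])))

theorem rankOne_empty : RankOne 0 (∅ : Set E) := by
  refine ⟨simplex [], simplex_mem_chainsIn (by simp [hull_nil]), simplex_mem_supported rfl,
    bd_simplex_nil, ?_, fun z hz _ => ?_⟩
  · have key : ∀ w ∈ chainsIn (∅ : Set E), bd w = 0 := fun w hw => by
      refine (Submodule.mem_bot (ZMod 2)).1 (map_supported_le bd (fun l hl => ?_) hw)
      rcases l with _ | ⟨a, l⟩
      · simp [bd_simplex_nil]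
      · exact absurd (hl (mem_hull (List.mem_cons_self))) (notMem_empty a)
    rintro ⟨w, hw, hw'⟩
    rw [key w hw] at hw'
    exact one_ne_zero (Finsupp.single_eq_zero.1 hw'.symm)
  · have : z ∈ Submodule.span (ZMod 2) {simplex ([] : List E)} := by
      refine map_supported_le LinearMap.id (fun l hl => ?_) hz
      rcases l with _ | ⟨a, l⟩
      · exact Submodule.mem_span_singleton_self _
      · exact absurd (hl (mem_hull (List.mem_cons_self))) (notMem_empty a)
    obtain ⟨r, rfl⟩ := Submodule.mem_span_singleton.1 this
    have hr : ∀ r : ZMod 2, r = 0 ∨ r = 1 := by decide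
    rcases hr r with rfl | rfl
    · left; rw [zero_smul]; exact Bounds.zero
    · right; rw [one_smul, chain_add_self]; exact Bounds.zero

theorem exists_isCompact_mem_chainsIn {w : Chain E} (hw : w ∈ chainsIn U) :
    ∃ H ⊆ U, IsCompact H ∧ w ∈ chainsIn H :=
  ⟨⋃ l ∈ w.support, hull l, iUnion₂_subset fun _ hl => hw hl,
    w.support.isCompact_biUnion fun l _ => isCompact_hull l,
    fun _ hl => subset_biUnion_of_mem (u := fun l => hull l) hl⟩

theorem Bounds.exists_isCompact {z : Chain E} (h : Bounds U z) :
    ∃ H ⊆ U, IsCompact H ∧ Bounds H z := by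
  obtain ⟨w, hw, rfl⟩ := h
  obtain ⟨H, h1, h2, h3⟩ := exists_isCompact_mem_chainsIn hw
  exact ⟨H, h1, h2, bounds_bd h3⟩

end Homology

section Linked

variable {E : Type*} [NormedAddCommGroup E] [NormedSpace ℝ E] {U V : Set E}

/-- Two points are linked in `U` if their difference is a reduced boundary. -/
def Linked (U : Set E) (a b : E) : Prop := Bounds U (simplex [a] + simplex [b])

theorem Linked.refl (U : Set E) (a : E) : Linked U a a := by
  rw [Linked, chain_add_self]; exact Bounds.zero

theorem Linked.symm {a b : E} (h : Linked U a b) : Linked U b a := by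
  rwa [Linked, add_comm]

theorem Linked.trans {a b c : E} (h : Linked U a b) (h' : Linked U b c) : Linked U a c := by
  have := Bounds.add h h'
  rwa [add_assoc, ← add_assoc (simplex [b]), chain_add_self, zero_add] at this

theorem Linked.mono {a b : E} (h : Linked U a b) (hUV : U ⊆ V) : Linked V a b :=
  Bounds.mono h hUV

theorem linked_of_segment_subset {a b : E} (h : segment ℝ a b ⊆ U) : Linked U a b :=
  ⟨simplex [a, b], simplex_mem_chainsIn (by rwa [hull_pair]), bd_simplex_pair a b⟩

theorem IsPreconnected.linked {T : Set E} (hT : IsPreconnected T) (hU : IsOpen U) (hTU : T ⊆ U)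
    {a b : E} (ha : a ∈ T) (hb : b ∈ T) : Linked U a b := by
  refine hT.induction₂ (fun x y => Linked U x y) (fun x hx => ?_)
    (fun x y z _ _ _ h1 h2 => h1.trans h2) (fun x y _ _ h => h.symm) ha hb
  obtain ⟨ε, hε, h⟩ := Metric.isOpen_iff.1 hU x (hTU hx)
  filter_upwards [mem_nhdsWithin_of_mem_nhds (Metric.ball_mem_nhds x hε)] with y hy
  exact linked_of_segment_subset
    (((convex_ball x ε).segment_subset (Metric.mem_ball_self hε) hy).trans h)

theorem mem_connectedComponentIn_of_linked {a b : E} (h : Linked U a b) (ha : a ∈ U) :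
    b ∈ connectedComponentIn U a := by
  classical
  obtain ⟨w, hw, hwn, hw'⟩ := h.exists_homog (n := 1)
    (add_mem (simplex_mem_homog [a]) (simplex_mem_homog [b]))
  let φ : Chain E →ₗ[ZMod 2] ZMod 2 := Finsupp.linearCombination (ZMod 2)
    fun l => if ∃ x ∈ l, x ∈ connectedComponentIn U a then 1 else 0
  have hφ : ∀ l : List E, φ (simplex l) =
      if ∃ x ∈ l, x ∈ connectedComponentIn U a then 1 else 0 := fun l => by
    simp [φ, simplex]
  have h0 : ∀ c ∈ Finsupp.supported (ZMod 2) (ZMod 2) {l : List E | hull l ⊆ U ∧ l.length = 2},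
      (φ ∘ₗ bd) c = 0 := fun c hc => by
    refine map_supported_le (p := LinearMap.ker (LinearMap.id (R := ZMod 2) (M := ZMod 2)))
      (φ ∘ₗ bd) (fun l hl => LinearMap.mem_ker.2 ?_) hc
    obtain ⟨hl, hl2⟩ := hl
    obtain ⟨x, y, rfl⟩ := List.length_eq_two.1 hl2
    rw [hull_pair] at hl
    have hxy : x ∈ connectedComponentIn U a ↔ y ∈ connectedComponentIn U a := by
      have hs := (convex_segment (𝕜 := ℝ) x y).isPreconnected
      constructor <;> intro hx
      · rw [connectedComponentIn_eq hx]
        exact hs.subset_connectedComponentIn (left_mem_segment ℝ x y) hl (right_mem_segment ℝ x y)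
      · rw [connectedComponentIn_eq hx]
        exact hs.subset_connectedComponentIn (right_mem_segment ℝ x y) hl (left_mem_segment ℝ x y)
    rw [LinearMap.id_apply, LinearMap.comp_apply, bd_simplex_pair, map_add, hφ, hφ]
    simp [hxy, CharTwo.add_self_eq_zero]
  have := h0 w fun l hl => ⟨hw hl, hwn hl⟩
  rw [LinearMap.comp_apply, hw', map_add, hφ, hφ] at this
  by_contra hb
  simp [hb, mem_connectedComponentIn ha] at this

theorem bounds_of_linked (h : ∀ a ∈ U, ∀ b ∈ U, Linked V a b) {ζ : Chain E} (hζ : ζ ∈ chainsIn U)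
    (hn : ζ ∈ homog E 1) (h0 : bd ζ = 0) : Bounds V ζ := by
  have hs : ζ ∈ Finsupp.supported (ZMod 2) (ZMod 2) {l : List E | hull l ⊆ U ∧ l.length = 1} :=
    fun l hl => ⟨hζ hl, hn hl⟩
  rcases U.eq_empty_or_nonempty with rfl | ⟨a, ha⟩
  · have : ζ ∈ (⊥ : Submodule (ZMod 2) (Chain E)) :=
      map_supported_le LinearMap.id (fun l hl' => by
        obtain ⟨hl, hl1⟩ := hl'
        obtain ⟨x, rfl⟩ := List.length_eq_one_iff.1 hl1
        exact absurd (hl (mem_hull (List.mem_cons_self))) (notMem_empty x)) hs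
    rw [(Submodule.mem_bot _).1 this]
    exact Bounds.zero
  · have : ζ ∈ (chainsIn V).map bd ⊔ Submodule.span (ZMod 2) {simplex [a]} :=
      map_supported_le LinearMap.id (fun l hl' => by
        obtain ⟨hl, hl1⟩ := hl'
        obtain ⟨x, rfl⟩ := List.length_eq_one_iff.1 hl1
        have hx : simplex [x] + simplex [a] ∈ (chainsIn V).map bd :=
          h x (hl (mem_hull (List.mem_cons_self))) a ha
        have h' := add_mem (Submodule.mem_sup_left hx) (Submodule.mem_sup_right
          (S := (chainsIn V).map bd) (Submodule.mem_span_singleton_self (R := ZMod 2) (simplex [a])))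
        rwa [add_assoc, chain_add_self, add_zero] at h') hs
    obtain ⟨ξ, hξ, η, hη, rfl⟩ := Submodule.mem_sup.1 this
    obtain ⟨r, rfl⟩ := Submodule.mem_span_singleton.1 hη
    have hξ' : Bounds V ξ := hξ
    have hr : r = 0 := by
      rw [map_add, hξ'.bd_eq_zero, zero_add, map_smul, bd_simplex_cons, bd_simplex_nil, map_zero,
        add_zero, simplex, Finsupp.smul_single, Finsupp.single_eq_zero] at h0
      simpa using h0
    rwa [hr, zero_smul, add_zero]

end Linked

section Cones

/-- Four-dimensional Euclidean space. -/
abbrev R4 := EuclideanSpace ℝ (Fin 4)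

theorem rankOne_flag (j : ℕ) (hj : j ≤ 4) :
    RankOne j {x : R4 | ∃ i : Fin 4, (i : ℕ) < j ∧ x i ≠ 0} := by
  induction j with
  | zero => simpa using rankOne_empty (E := R4)
  | succ j ih =>
    set G : Set R4 := {x : R4 | ∃ i : Fin 4, (i : ℕ) < j ∧ x i ≠ 0} with hG
    let k : Fin 4 := ⟨j, hj⟩
    let U (r : ℝ) : Set R4 := G ∪ {x | r * x k < 0}
    have hGo : IsOpen G := by
      have : G = ⋃ i : Fin 4, {x : R4 | (i : ℕ) < j ∧ x i ≠ 0} := by ext; simp [hG]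
      rw [this]
      refine isOpen_iUnion fun i => ?_
      by_cases hi : (i : ℕ) < j
      · simp only [hi, true_and]
        exact isOpen_ne_fun (by fun_prop) continuous_const
      · simp [hi]
    have hUo : ∀ r, IsOpen (U r) := fun r =>
      hGo.union (isOpen_lt (by fun_prop) continuous_const)
    have hUa : ∀ r : ℝ, r ≠ 0 → Acyclic (U r) := fun r hr => by
      have h0 : EuclideanSpace.single k (-r) ∈ U r := Or.inr (by simp [hr])
      refine StarConvex.acyclic (a := EuclideanSpace.single k (-r)) ?_ h0
      rw [starConvex_iff_forall_pos h0]
      rintro x (⟨i, hi, hx⟩ | hx) s t hs ht hst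
      · refine Or.inl ⟨i, hi, ?_⟩
        have : i ≠ k := fun h => by simp [h, k] at hi
        simp [this, ht.ne', hx]
      · refine Or.inr ?_
        simp only [mem_ofPred_eq, PiLp.add_apply, PiLp.smul_apply, PiLp.single_apply,
          if_true, smul_eq_mul] at hx ⊢
        have : 0 < s * (r * r) := mul_pos hs (mul_self_pos.2 hr)
        nlinarith [mul_pos ht (neg_pos.2 hx)]
    have hI : U 1 ∩ U (-1) = G := by
      ext x
      simp only [U, mem_inter_iff, mem_union, mem_ofPred_eq]
      constructor
      · rintro ⟨h1 | h1, h2 | h2⟩ <;> first | assumption | linarith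
      · tauto
    have hUn : U 1 ∪ U (-1) = {x : R4 | ∃ i : Fin 4, (i : ℕ) < j + 1 ∧ x i ≠ 0} := by
      ext x
      simp only [U, mem_union, mem_ofPred_eq, hG]
      constructor
      · rintro ((⟨i, hi, h⟩ | h) | (⟨i, hi, h⟩ | h))
        · exact ⟨i, by omega, h⟩
        · exact ⟨k, Nat.lt_succ_self j, fun h' => by simp [h'] at h⟩
        · exact ⟨i, by omega, h⟩
        · exact ⟨k, Nat.lt_succ_self j, fun h' => by simp [h'] at h⟩
      · rintro ⟨i, hi, h⟩
        rcases (Nat.lt_succ_iff_lt_or_eq.1 hi) with hi | hi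
        · exact Or.inl (Or.inl ⟨i, hi, h⟩)
        · have : i = k := Fin.ext hi
          subst this
          rcases lt_or_gt_of_ne h with h | h
          · exact Or.inl (Or.inr (by linarith))
          · exact Or.inr (Or.inr (by linarith))
    rw [← hUn]
    refine RankOne.union (hUo _) (hUo _) (hUa _ (by norm_num)) (hUa _ (by norm_num)) ?_
    rw [hI]
    exact ih (by omega)

theorem rankOne_compl_zero : RankOne 4 ({0}ᶜ : Set R4) := by
  convert rankOne_flag 4 le_rfl using 1
  ext x
  simp only [mem_compl_iff, mem_singleton_iff, mem_ofPred_eq]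
  constructor
  · intro h
    by_contra! h'
    exact h (by ext i; exact h' i i.2)
  · rintro ⟨i, -, h⟩ rfl
    exact h rfl

variable {E : Type*} [NormedAddCommGroup E] [NormedSpace ℝ E]

/-- The complement of the closed cone over a subset of the unit sphere. -/
def coneCompl (K : Set E) : Set E := {x | x ≠ 0 ∧ ‖x‖⁻¹ • x ∉ K}

theorem norm_normalized {x : E} (hx : x ≠ 0) : ‖‖x‖⁻¹ • x‖ = 1 := by
  rw [norm_smul, norm_inv, norm_norm, inv_mul_cancel₀ (norm_ne_zero_iff.2 hx)]

theorem normalized_mem_coneCompl {K : Set E} {x : E} (hx : x ∈ coneCompl K) :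
    ‖x‖⁻¹ • x ∈ coneCompl K := by
  have h := norm_normalized hx.1
  exact ⟨norm_ne_zero_iff.1 (by rw [h]; exact one_ne_zero),
    by rw [h, inv_one, one_smul]; exact hx.2⟩

theorem coneCompl_union (K L : Set E) : coneCompl (K ∪ L) = coneCompl K ∩ coneCompl L := by
  ext; simp only [coneCompl, mem_ofPred_eq, mem_union, mem_inter_iff]; tauto

theorem coneCompl_inter (K L : Set E) : coneCompl (K ∩ L) = coneCompl K ∪ coneCompl L := by
  ext; simp only [coneCompl, mem_ofPred_eq, mem_union, mem_inter_iff]; tauto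

theorem coneCompl_anti {K L : Set E} (h : K ⊆ L) : coneCompl L ⊆ coneCompl K :=
  fun _ hx => ⟨hx.1, fun hx' => hx.2 (h hx')⟩

theorem coneCompl_empty : coneCompl (∅ : Set E) = {0}ᶜ := by ext; simp [coneCompl]

theorem isOpen_coneCompl {K : Set E} (hK : IsClosed K) : IsOpen (coneCompl K) := by
  have hc : ContinuousOn (fun x : E => ‖x‖⁻¹ • x) {0}ᶜ :=
    (continuousOn_id.norm.inv₀ fun x hx => norm_ne_zero_iff.2 hx).smul continuousOn_id
  exact hc.isOpen_inter_preimage isOpen_compl_singleton hK.isOpen_compl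

theorem smul_mem_coneCompl {K : Set E} {x : E} {r : ℝ} (hr : 0 < r) (hx : x ∈ coneCompl K) :
    r • x ∈ coneCompl K := by
  refine ⟨smul_ne_zero hr.ne' hx.1, ?_⟩
  rw [norm_smul, Real.norm_of_nonneg hr.le, smul_smul, mul_inv_rev, inv_mul_cancel_right₀ hr.ne']
  exact hx.2

theorem mem_coneCompl_of_norm_eq_one {K : Set E} {x : E} (hx : ‖x‖ = 1) :
    x ∈ coneCompl K ↔ x ∉ K := by
  have : x ≠ 0 := norm_ne_zero_iff.1 (by simp [hx])
  simp [coneCompl, hx, this]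

theorem neg_mem_coneCompl_singleton {s : E} (hs : ‖s‖ = 1) : -s ∈ coneCompl {s} := by
  rw [mem_coneCompl_of_norm_eq_one (by simpa using hs), mem_singleton_iff]
  intro h
  have : s = 0 := by
    have h2 : (2 : ℝ) • s = 0 := by rw [two_smul]; nth_rw 1 [← h]; simp
    simpa using h2
  simp [this] at hs

theorem starConvex_coneCompl_singleton {s : E} (hs : ‖s‖ = 1) :
    StarConvex ℝ (-s) (coneCompl {s}) := by
  rw [starConvex_iff_forall_pos (neg_mem_coneCompl_singleton hs)]
  rintro x ⟨hx0, hx⟩ a b ha hb hab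
  rw [mem_singleton_iff] at hx
  by_contra hcon
  have key : ∃ r : ℝ, 0 ≤ r ∧ a • -s + b • x = r • s := by
    by_cases h0 : a • -s + b • x = 0
    · exact ⟨0, le_rfl, by simpa using h0⟩
    · simp only [coneCompl, mem_ofPred_eq, not_and, not_not, mem_singleton_iff] at hcon
      have := hcon h0
      refine ⟨‖a • -s + b • x‖, norm_nonneg _, ?_⟩
      nth_rw 3 [← this]
      rw [smul_smul, mul_inv_cancel₀ (norm_ne_zero_iff.2 h0), one_smul]
  obtain ⟨r, hr, h⟩ := key
  have hxs : x = (b⁻¹ * (a + r)) • s := by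
    rw [mul_smul, add_smul, ← h, smul_neg, add_neg_cancel_left, smul_smul,
      inv_mul_cancel₀ hb.ne', one_smul]
  have hpos : 0 < b⁻¹ * (a + r) := by positivity
  apply hx
  rw [hxs, norm_smul, hs, mul_one, Real.norm_of_nonneg hpos.le, smul_smul,
    inv_mul_cancel₀ hpos.ne', one_smul]

theorem acyclic_coneCompl_singleton {s : E} (hs : ‖s‖ = 1) : Acyclic (coneCompl {s}) :=
  (starConvex_coneCompl_singleton hs).acyclic (neg_mem_coneCompl_singleton hs)

end Cones

section Slicing

variable {E : Type*} [NormedAddCommGroup E] [NormedSpace ℝ E] {X : Type*} [TopologicalSpace X]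
  [T2Space X] {γ : X → E} {Q : Set X}

theorem exists_nhds_bounds_of_slice {h : X → ℝ} (hQ : IsCompact Q)
    (hγ : ContinuousOn γ Q) (hh : ContinuousOn h Q) {z : Chain E}
    {t : ℝ} (hz : Bounds (coneCompl (γ '' (Q ∩ h ⁻¹' {t}))) z) :
    ∃ c : Set ℝ, IsOpen c ∧ t ∈ c ∧
      ∀ s ⊆ c, Bounds (coneCompl (γ '' (Q ∩ h ⁻¹' s))) z := by
  obtain ⟨H, hH, hHc, hHz⟩ := hz.exists_isCompact
  set N := (fun x : E => ‖x‖⁻¹ • x) '' H with hN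
  have hNc : IsCompact N := hHc.image_of_continuousOn <|
    (continuousOn_id.norm.inv₀ fun x hx => norm_ne_zero_iff.2 (hH hx).1).smul continuousOn_id
  have hB : IsCompact (h '' (Q ∩ γ ⁻¹' N)) :=
    (hQ.of_isClosed_subset (hγ.preimage_isClosed_of_isClosed hQ.isClosed hNc.isClosed)
      inter_subset_left).image_of_continuousOn (hh.mono inter_subset_left)
  refine ⟨(h '' (Q ∩ γ ⁻¹' N))ᶜ, hB.isClosed.isOpen_compl, ?_, fun s hs => hHz.mono ?_⟩
  · rintro ⟨v, ⟨hv, x, hx, hxv⟩, rfl⟩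
    exact (hH hx).2 ⟨v, ⟨hv, rfl⟩, hxv.symm⟩
  · rintro x hx
    refine ⟨(hH hx).1, ?_⟩
    rintro ⟨v, ⟨hv, hvs⟩, hxv⟩
    exact hs hvs ⟨v, ⟨hv, x, hx, hxv.symm⟩, rfl⟩

theorem acyclic_of_slices {h : X → ℝ} (hQ : IsCompact Q) (hQc : IsConnected Q)
    (hγ : ContinuousOn γ Q) (hi : InjOn γ Q) (hh : ContinuousOn h Q)
    (hs : ∀ v ∈ Q, Acyclic (coneCompl (γ '' (Q ∩ h ⁻¹' {h v})))) :
    Acyclic (coneCompl (γ '' Q)) := by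
  have himg := eq_Icc_of_connected_compact (hQc.image h hh) (hQ.image_of_continuousOn hh)
  set α := sInf (h '' Q)
  set β := sSup (h '' Q)
  have hαβ : α ≤ β := by
    by_contra hlt
    rw [Icc_eq_empty hlt] at himg
    exact (hQc.nonempty.image h).ne_empty himg
  have hs' : ∀ t ∈ Icc α β, Acyclic (coneCompl (γ '' (Q ∩ h ⁻¹' {t}))) := fun t ht => by
    rw [← himg] at ht
    obtain ⟨v, hv, rfl⟩ := ht
    exact hs v hv
  have hcl : ∀ s : Set ℝ, IsClosed s → IsClosed (γ '' (Q ∩ h ⁻¹' s)) := fun s hs =>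
    ((hQ.of_isClosed_subset (hh.preimage_isClosed_of_isClosed hQ.isClosed hs)
      inter_subset_left).image_of_continuousOn (hγ.mono inter_subset_left)).isClosed
  intro z hz hz0
  have hsub : ∀ s : Set ℝ, z ∈ chainsIn (coneCompl (γ '' (Q ∩ h ⁻¹' s))) := fun s =>
    chainsIn_mono (coneCompl_anti (image_mono inter_subset_left)) hz
  have hc : ∀ t : Icc α β, ∃ c : Set ℝ, IsOpen c ∧ (t : ℝ) ∈ c ∧
      ∀ s ⊆ c, Bounds (coneCompl (γ '' (Q ∩ h ⁻¹' s))) z := fun t =>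
    exists_nhds_bounds_of_slice hQ hγ hh (hs' t t.2 z (hsub _) hz0)
  choose c hco htc hcb using hc
  obtain ⟨t, ht0, htm, ⟨n, hn⟩, ht⟩ := exists_monotone_Icc_subset_open_cover_Icc hαβ
    (c := fun i => (Subtype.val ⁻¹' c i : Set (Icc α β)))
    (fun i => (hco i).preimage continuous_subtype_val) (fun x _ => mem_iUnion.2 ⟨x, htc x⟩)
  have key : ∀ m, Bounds (coneCompl (γ '' (Q ∩ h ⁻¹' Icc α (t m)))) z := by
    intro m
    induction m with
    | zero => rw [ht0, Icc_self]; exact hs' α (left_mem_Icc.2 hαβ) z (hsub _) hz0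
    | succ m ih =>
      obtain ⟨i, hi'⟩ := ht m
      have hsc : Icc (t m : ℝ) (t (m + 1)) ⊆ c i := fun x hx =>
        hi' (a := ⟨x, (t m).2.1.trans hx.1, hx.2.trans (t (m + 1)).2.2⟩) ⟨hx.1, hx.2⟩
      obtain ⟨x, hx, hxz⟩ := ih
      obtain ⟨y, hy, hyz⟩ := hcb i _ hsc
      have hU : coneCompl (γ '' (Q ∩ h ⁻¹' Icc α (t m))) ∪
          coneCompl (γ '' (Q ∩ h ⁻¹' Icc (t m : ℝ) (t (m + 1)))) =
            coneCompl (γ '' (Q ∩ h ⁻¹' {(t m : ℝ)})) := by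
        rw [← coneCompl_inter, ← hi.image_inter inter_subset_left inter_subset_left,
          ← inter_inter_distrib_left, ← preimage_inter, Icc_inter_Icc_eq_singleton (t m).2.1
          (htm (Nat.le_succ m))]
      have hI : coneCompl (γ '' (Q ∩ h ⁻¹' Icc α (t m))) ∩
          coneCompl (γ '' (Q ∩ h ⁻¹' Icc (t m : ℝ) (t (m + 1)))) =
            coneCompl (γ '' (Q ∩ h ⁻¹' Icc α (t (m + 1)))) := by
        rw [← coneCompl_union, ← image_union, ← inter_union_distrib_left, ← preimage_union,
          Icc_union_Icc_eq_Icc (t m).2.1 (htm (Nat.le_succ m))]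
      rw [← hI, ← hxz]
      refine Bounds.bd_of_add (isOpen_coneCompl (hcl _ isClosed_Icc))
        (isOpen_coneCompl (hcl _ isClosed_Icc)) hx hy ?_
      rw [hU]
      refine hs' (t m) (t m).2 _ ?_ (by rw [map_add, hxz, hyz, chain_add_self])
      rw [← hU]
      exact add_mem (chainsIn_mono subset_union_left hx) (chainsIn_mono subset_union_right hy)
  have hfin := key n
  rw [hn n le_rfl] at hfin
  have : Q ∩ h ⁻¹' Icc α β = Q := inter_eq_left.2 fun v hv => by
    rw [← himg]
    exact mem_image_of_mem h hv
  rwa [this] at hfin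

theorem acyclic_coneCompl_image_of_convex {γ : ℂ → E} {Q : Set ℂ} (hQ : IsCompact Q)
    (hQc : Convex ℝ Q) (hne : Q.Nonempty) (hγ : ContinuousOn γ Q) (hi : InjOn γ Q)
    (hn : ∀ v ∈ Q, ‖γ v‖ = 1) : Acyclic (coneCompl (γ '' Q)) := by
  refine acyclic_of_slices (h := Complex.re) hQ (hQc.isConnected hne) hγ hi
    Complex.continuous_re.continuousOn fun v hv => ?_
  have hc1 : Convex ℝ (Q ∩ Complex.re ⁻¹' {v.re}) :=
    hQc.inter ((convex_singleton v.re).linear_preimage Complex.reLm)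
  refine acyclic_of_slices (h := Complex.im)
    (hQ.inter_right (isClosed_singleton.preimage Complex.continuous_re))
    (hc1.isConnected ⟨v, hv, rfl⟩) (hγ.mono inter_subset_left) (hi.mono inter_subset_left)
    Complex.continuous_im.continuousOn fun w hw => ?_
  have : Q ∩ Complex.re ⁻¹' {v.re} ∩ Complex.im ⁻¹' {w.im} = {w} := by
    ext u
    simp only [mem_inter_iff, mem_preimage, mem_singleton_iff]
    constructor
    · rintro ⟨⟨-, h1⟩, h2⟩
      exact Complex.ext (h1.trans hw.2.symm) h2
    · rintro rfl
      exact ⟨hw, rfl⟩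
  rw [this, image_singleton]
  exact acyclic_coneCompl_singleton (hn w hw.1)

end Slicing

section Annuli

/-- A closed annulus. -/
def ann (v : ℂ) (a b : ℝ) : Set ℂ := {w | a ≤ ‖w - v‖ ∧ ‖w - v‖ ≤ b}

/-- The upper (`ε = 1`) or lower (`ε = -1`) half of a closed annulus. -/
def halfAnn (ε : ℝ) (v : ℂ) (a b : ℝ) : Set ℂ := {w ∈ ann v a b | 0 ≤ ε * (w - v).im}

/-- The right (`ε = 1`) or left (`ε = -1`) radius of a closed annulus. -/
def radius (ε : ℝ) (v : ℂ) (a b : ℝ) : Set ℂ := {w | (w - v).im = 0 ∧ ε * (w - v).re ∈ Icc a b}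

variable {v : ℂ} {a b : ℝ}

theorem halfAnn_union : halfAnn 1 v a b ∪ halfAnn (-1) v a b = ann v a b := by
  ext w
  simp only [halfAnn, mem_union, mem_ofPred_eq]
  have : 0 ≤ 1 * (w - v).im ∨ 0 ≤ -1 * (w - v).im := by
    rcases le_total 0 (w - v).im with h | h
    · exact Or.inl (by linarith)
    · exact Or.inr (by linarith)
  tauto

theorem halfAnn_inter (ha : 0 < a) :
    halfAnn 1 v a b ∩ halfAnn (-1) v a b = radius 1 v a b ∪ radius (-1) v a b := by
  ext w
  simp only [halfAnn, ann, radius, mem_union, mem_inter_iff, mem_ofPred_eq, mem_Icc]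
  constructor
  · rintro ⟨⟨⟨h1, h2⟩, h3⟩, -, h4⟩
    have h5 : (w - v).im = 0 := by linarith
    have h6 : ‖w - v‖ = |(w - v).re| := (Complex.abs_re_eq_norm.2 h5).symm
    rw [h6] at h1 h2
    rcases le_total 0 (w - v).re with h | h
    · rw [abs_of_nonneg h] at h1 h2
      exact Or.inl ⟨h5, by linarith, by linarith⟩
    · rw [abs_of_nonpos h] at h1 h2
      exact Or.inr ⟨h5, by linarith, by linarith⟩
  · intro h
    have h5 : (w - v).im = 0 := by tauto
    have h6 : ‖w - v‖ = |(w - v).re| := (Complex.abs_re_eq_norm.2 h5).symm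
    rw [h6, h5]
    have : a ≤ |(w - v).re| ∧ |(w - v).re| ≤ b := by
      rcases h with ⟨-, h1, h2⟩ | ⟨-, h1, h2⟩
      · rw [abs_of_pos (by linarith)]; constructor <;> linarith
      · rw [abs_of_neg (by linarith)]; constructor <;> linarith
    simpa using this

theorem radius_inter (ha : 0 < a) : radius 1 v a b ∩ radius (-1) v a b = ∅ := by
  ext w
  simp only [radius, mem_inter_iff, mem_ofPred_eq, mem_Icc, mem_empty_iff_false, iff_false]
  rintro ⟨⟨-, h1, -⟩, -, h2, -⟩
  linarith

/-- Polar coordinates centered at `v`. -/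
def polar (ε : ℝ) (v w : ℂ) : ℂ := v + ε * (w.re * Complex.exp (w.im * Complex.I))

theorem continuous_polar (ε : ℝ) (v : ℂ) : Continuous (polar ε v) := by
  unfold polar; fun_prop

theorem injOn_polar {ε : ℝ} (hε : ε ≠ 0) (ha : 0 < a) :
    InjOn (polar ε v) (Icc a b ×ℂ Icc 0 Real.pi) := by
  rintro w ⟨⟨h1, -⟩, h2, h3⟩ w' ⟨⟨h1', -⟩, h2', h3'⟩ h
  have h0 : (w.re : ℂ) * Complex.exp (w.im * Complex.I) =
      w'.re * Complex.exp (w'.im * Complex.I) := by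
    simpa [polar, hε] using h
  have hre : w.re = w'.re := by
    have := congrArg norm h0
    rwa [norm_mul, norm_mul, Complex.norm_exp_ofReal_mul_I, Complex.norm_exp_ofReal_mul_I, mul_one,
      mul_one, Complex.norm_of_nonneg (ha.le.trans h1), Complex.norm_of_nonneg (ha.le.trans h1')]
      at this
  have him : w.im = w'.im := by
    have := congrArg Complex.arg h0
    simp only [Complex.exp_mul_I] at this
    rwa [Complex.arg_mul_cos_add_sin_mul_I (ha.trans_le h1) ⟨by linarith [Real.pi_pos], h3⟩,
      Complex.arg_mul_cos_add_sin_mul_I (ha.trans_le h1') ⟨by linarith [Real.pi_pos], h3'⟩]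
      at this
  exact Complex.ext hre him

theorem polar_image_halfAnn {ε : ℝ} (hε : ε * ε = 1) (ha : 0 < a) :
    polar ε v '' (Icc a b ×ℂ Icc 0 Real.pi) = halfAnn ε v a b := by
  have hε1 : |ε| = 1 := by
    rcases mul_self_eq_one_iff.1 hε with rfl | rfl <;> simp
  ext u
  constructor
  · rintro ⟨w, ⟨h1, h2⟩, rfl⟩
    have hn : ‖polar ε v w - v‖ = w.re := by
      rw [polar, add_sub_cancel_left, norm_mul, norm_mul, Complex.norm_exp_ofReal_mul_I, mul_one,
        Complex.norm_of_nonneg (ha.le.trans h1.1), Complex.norm_real, Real.norm_eq_abs, hε1,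
        one_mul]
    refine ⟨⟨hn.symm ▸ h1.1, hn.symm ▸ h1.2⟩, ?_⟩
    rw [polar, add_sub_cancel_left, Complex.im_ofReal_mul, Complex.im_ofReal_mul, ← mul_assoc, hε,
      one_mul, Complex.exp_ofReal_mul_I_im]
    exact mul_nonneg (ha.le.trans h1.1) (Real.sin_nonneg_of_nonneg_of_le_pi h2.1 h2.2)
  · rintro ⟨⟨h1, h2⟩, h3⟩
    refine ⟨⟨‖u - v‖, Complex.arg (ε * (u - v))⟩, ⟨⟨h1, h2⟩, ?_, Complex.arg_le_pi _⟩, ?_⟩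
    · change 0 ≤ Complex.arg _
      rw [Complex.arg_nonneg_iff]
      simpa using h3
    · have : ‖u - v‖ = ‖(ε : ℂ) * (u - v)‖ := by
        rw [norm_mul, Complex.norm_real, Real.norm_eq_abs, hε1, one_mul]
      simp only [polar]
      rw [this, Complex.norm_mul_exp_arg_mul_I, ← mul_assoc, ← Complex.ofReal_mul, hε]
      simp

theorem polar_image_radius {ε : ℝ} (hε : ε * ε = 1) :
    polar ε v '' (Icc a b ×ℂ {0}) = radius ε v a b := by
  ext u
  constructor
  · rintro ⟨w, ⟨h1, h2⟩, rfl⟩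
    have h2' : w.im = 0 := h2
    have : polar ε v w - v = ((ε * w.re : ℝ) : ℂ) := by simp [polar, h2']
    refine ⟨by rw [this, Complex.ofReal_im], ?_⟩
    rw [this, Complex.ofReal_re, ← mul_assoc, hε, one_mul]
    exact h1
  · rintro ⟨h1, h2⟩
    refine ⟨⟨ε * (u - v).re, 0⟩, ⟨h2, rfl⟩, ?_⟩
    simp only [polar, Complex.ofReal_zero, zero_mul, Complex.exp_zero, mul_one]
    rw [← Complex.ofReal_mul, ← mul_assoc, hε, one_mul]
    apply Complex.ext <;> simp
    simpa [sub_eq_zero, eq_comm] using h1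

theorem isCompact_ann : IsCompact (ann v a b) := by
  have : ann v a b = Metric.closedBall v b ∩ {w | a ≤ ‖w - v‖} := by
    ext w; simp [ann, dist_eq_norm, and_comm]
  rw [this]
  exact (isCompact_closedBall v b).inter_right (isClosed_le (by fun_prop) (by fun_prop))

theorem isCompact_halfAnn (ε : ℝ) : IsCompact (halfAnn ε v a b) :=
  isCompact_ann.inter_right (isClosed_le (by fun_prop)
    (continuous_const.mul (Complex.continuous_im.comp (by fun_prop))))

theorem isCompact_radius {ε : ℝ} (hε : ε * ε = 1) : IsCompact (radius ε v a b) := by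
  rw [← polar_image_radius hε]
  exact (isCompact_Icc.reProdIm isCompact_singleton).image (continuous_polar ε v)

variable {γ : ℂ → R4}

theorem convex_reProdIm {s t : Set ℝ} (hs : Convex ℝ s) (ht : Convex ℝ t) : Convex ℝ (s ×ℂ t) :=
  (hs.linear_preimage Complex.reLm).inter (ht.linear_preimage Complex.imLm)

theorem acyclic_halfAnn {ε : ℝ} (hγ : Continuous γ) (hi : Function.Injective γ)
    (hn : ∀ v, ‖γ v‖ = 1) (hε : ε * ε = 1) (ha : 0 < a) (hab : a ≤ b) :
    Acyclic (coneCompl (γ '' halfAnn ε v a b)) := by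
  rw [← polar_image_halfAnn hε ha, ← image_comp]
  exact acyclic_coneCompl_image_of_convex (isCompact_Icc.reProdIm isCompact_Icc)
    (convex_reProdIm (convex_Icc a b) (convex_Icc 0 Real.pi))
    ⟨⟨a, 0⟩, ⟨le_rfl, hab⟩, ⟨le_rfl, Real.pi_pos.le⟩⟩
    (hγ.comp (continuous_polar ε v)).continuousOn
    (hi.comp_injOn (injOn_polar (fun h => by simp [h] at hε) ha)) fun _ _ => hn _

theorem acyclic_radius {ε : ℝ} (hγ : Continuous γ) (hi : Function.Injective γ)
    (hn : ∀ v, ‖γ v‖ = 1) (hε : ε * ε = 1) (ha : 0 < a) (hab : a ≤ b) :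
    Acyclic (coneCompl (γ '' radius ε v a b)) := by
  rw [← polar_image_radius hε, ← image_comp]
  have hsub : Icc a b ×ℂ ({0} : Set ℝ) ⊆ Icc a b ×ℂ Icc 0 Real.pi := fun w hw =>
    ⟨hw.1, by rw [mem_preimage, show w.im = 0 from hw.2]; exact ⟨le_rfl, Real.pi_pos.le⟩⟩
  exact acyclic_coneCompl_image_of_convex (isCompact_Icc.reProdIm isCompact_singleton)
    (convex_reProdIm (convex_Icc a b) (convex_singleton 0)) ⟨⟨a, 0⟩, ⟨le_rfl, hab⟩, rfl⟩
    (hγ.comp (continuous_polar ε v)).continuousOn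
    (hi.comp_injOn ((injOn_polar (fun h => by simp [h] at hε) ha).mono hsub)) fun _ _ => hn _

theorem isOpen_coneCompl_image {Q : Set ℂ} (hγ : Continuous γ) (hQ : IsCompact Q) :
    IsOpen (coneCompl (γ '' Q)) := isOpen_coneCompl (hQ.image hγ).isClosed

theorem coneCompl_radius_union (hi : Function.Injective γ) (ha : 0 < a) :
    coneCompl (γ '' radius 1 v a b) ∪ coneCompl (γ '' radius (-1) v a b) = {0}ᶜ := by
  rw [← coneCompl_inter, ← image_inter hi, radius_inter ha, image_empty, coneCompl_empty]

theorem coneCompl_halfAnn_union (hi : Function.Injective γ) (ha : 0 < a) :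
    coneCompl (γ '' halfAnn 1 v a b) ∪ coneCompl (γ '' halfAnn (-1) v a b) =
      coneCompl (γ '' radius 1 v a b) ∩ coneCompl (γ '' radius (-1) v a b) := by
  rw [← coneCompl_inter, ← image_inter hi, halfAnn_inter ha, image_union, coneCompl_union]

theorem coneCompl_ann :
    coneCompl (γ '' ann v a b) =
      coneCompl (γ '' halfAnn 1 v a b) ∩ coneCompl (γ '' halfAnn (-1) v a b) := by
  rw [← halfAnn_union, image_union, coneCompl_union]

theorem rankOne_coneCompl_circle (hγ : Continuous γ) (hi : Function.Injective γ)
    (hn : ∀ v, ‖γ v‖ = 1) (ha : 0 < a) : RankOne 2 (coneCompl (γ '' ann v a a)) := by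
  have h1 : (1 : ℝ) * 1 = 1 := by norm_num
  have h2 : (-1 : ℝ) * -1 = 1 := by norm_num
  rw [coneCompl_ann]
  refine RankOne.inter (isOpen_coneCompl_image hγ (isCompact_halfAnn _))
    (isOpen_coneCompl_image hγ (isCompact_halfAnn _)) (acyclic_halfAnn hγ hi hn h1 ha le_rfl)
    (acyclic_halfAnn hγ hi hn h2 ha le_rfl) ?_
  rw [coneCompl_halfAnn_union hi ha]
  refine RankOne.inter (isOpen_coneCompl_image hγ (isCompact_radius h1))
    (isOpen_coneCompl_image hγ (isCompact_radius h2)) (acyclic_radius hγ hi hn h1 ha le_rfl)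
    (acyclic_radius hγ hi hn h2 ha le_rfl) ?_
  rw [coneCompl_radius_union hi ha]
  exact rankOne_compl_zero

theorem bounds_coneCompl_ann (hγ : Continuous γ) (hi : Function.Injective γ)
    (hn : ∀ v, ‖γ v‖ = 1) (ha : 0 < a) (hab : a ≤ b) {z : Chain R4}
    (hz : z ∈ chainsIn (coneCompl (γ '' ann v a b))) (hz0 : bd z = 0)
    (hB : Bounds (coneCompl (γ '' ann v b b)) z) : Bounds (coneCompl (γ '' ann v a b)) z := by
  have h1 : (1 : ℝ) * 1 = 1 := by norm_num
  have h2 : (-1 : ℝ) * -1 = 1 := by norm_num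
  have hb := ha.trans_le hab
  have hsub : ann v b b ⊆ ann v a b := fun w hw => ⟨hab.trans hw.1, hw.2⟩
  have hsubh : ∀ ε, halfAnn ε v b b ⊆ halfAnn ε v a b := fun ε w hw => ⟨hsub hw.1, hw.2⟩
  have hsubr : ∀ ε, radius ε v b b ⊆ radius ε v a b := fun ε w hw =>
    ⟨hw.1, hab.trans hw.2.1, hw.2.2⟩
  rw [coneCompl_ann] at hz hB ⊢
  refine bounds_inter_of_bounds_union (isOpen_coneCompl_image hγ (isCompact_halfAnn _))
    (isOpen_coneCompl_image hγ (isCompact_halfAnn _)) (acyclic_halfAnn hγ hi hn h1 ha hab)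
    (acyclic_halfAnn hγ hi hn h2 ha hab) (acyclic_halfAnn hγ hi hn h1 hb le_rfl)
    (acyclic_halfAnn hγ hi hn h2 hb le_rfl) ?_ (coneCompl_anti (image_mono (hsubh _)))
    (coneCompl_anti (image_mono (hsubh _))) hz hz0 hB
  rw [coneCompl_halfAnn_union hi ha, coneCompl_halfAnn_union hi hb]
  intro z hz hz0 hB
  refine bounds_inter_of_bounds_union (isOpen_coneCompl_image hγ (isCompact_radius h1))
    (isOpen_coneCompl_image hγ (isCompact_radius h2)) (acyclic_radius hγ hi hn h1 ha hab)
    (acyclic_radius hγ hi hn h2 ha hab) (acyclic_radius hγ hi hn h1 hb le_rfl)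
    (acyclic_radius hγ hi hn h2 hb le_rfl) ?_ (coneCompl_anti (image_mono (hsubr _)))
    (coneCompl_anti (image_mono (hsubr _))) hz hz0 hB
  rw [coneCompl_radius_union hi ha, coneCompl_radius_union hi hb]
  exact fun _ _ _ h => h

end Annuli

section LocalSeparation

/-- A parametrisation of an open subset of `S` by the plane. -/
structure IsChart (S : Set R4) (γ : ℂ → R4) : Prop where
  continuous : Continuous γ
  injective : Function.Injective γ
  mem : ∀ v, γ v ∈ S
  isClosed_diff : ∀ G : Set ℂ, IsOpen G → IsClosed (S \ γ '' G)

theorem exists_convex_cone {y : R4} (hy : ‖y‖ = 1) {W : Set R4} (hW : W ∈ nhds y) :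
    ∃ K : Set R4, IsClosed K ∧ y ∉ K ∧ Convex ℝ (coneCompl K) ∧
      ∀ x ∈ coneCompl K, ‖x‖⁻¹ • x ∈ W := by
  obtain ⟨δ, hδ, hball⟩ := Metric.mem_nhds_iff.1 hW
  set ε := min δ 1 with hε
  have hε0 : 0 < ε := lt_min hδ one_pos
  have hε1 : ε ≤ 1 := min_le_right _ _
  set c := 1 - ε ^ 2 / 2 with hc
  have hc0 : 0 ≤ c := by nlinarith
  refine ⟨{u | inner ℝ y u ≤ c}, isClosed_le (by fun_prop) (by fun_prop), ?_, ?_, ?_⟩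
  · simp only [mem_ofPred_eq, real_inner_self_eq_norm_sq, hy, not_le]
    have : 0 < ε ^ 2 := by positivity
    linarith
  · have : coneCompl {u : R4 | inner ℝ y u ≤ c} = {x | x ∈ univ ∧ c * ‖x‖ - inner ℝ y x < 0} := by
      ext x
      simp only [coneCompl, mem_ofPred_eq, not_le, inner_smul_right, mem_univ, true_and]
      constructor
      · rintro ⟨h0, h⟩
        have := norm_pos_iff.2 h0
        rw [inv_mul_eq_div, lt_div_iff₀ this] at h
        linarith
      · intro h
        have h0 : x ≠ 0 := by rintro rfl; simp at h
        have := norm_pos_iff.2 h0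
        rw [inv_mul_eq_div, lt_div_iff₀ this]
        exact ⟨h0, by linarith⟩
    rw [this]
    refine ConvexOn.convex_lt (ConvexOn.sub ((convexOn_univ_norm).smul hc0) ?_) 0
    exact (innerSL ℝ y).toLinearMap.concaveOn convex_univ
  · rintro x ⟨h0, h⟩
    simp only [mem_ofPred_eq, not_le] at h
    refine hball (Metric.ball_subset_ball (min_le_left δ 1) ?_)
    set u := ‖x‖⁻¹ • x
    have hu : ‖u‖ = 1 := norm_normalized h0
    rw [Metric.mem_ball, dist_eq_norm, norm_sub_rev]
    refine lt_of_pow_lt_pow_left₀ 2 hε0.le ?_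
    rw [norm_sub_sq_real, hy, hu]
    linarith

variable {S : Set R4} {γ : ℂ → R4}

theorem exists_closedBall_image_subset (hγ : IsChart S γ) {K : Set R4} (hK : IsClosed K) {v : ℂ}
    (hv : γ v ∉ K) : ∃ ρ, 0 < ρ ∧ ρ ≤ 1 ∧ ∀ w, ‖w - v‖ ≤ ρ → γ w ∉ K := by
  obtain ⟨ε, hε, h⟩ := Metric.nhds_basis_closedBall.mem_iff.1
    (hγ.continuous.continuousAt.preimage_mem_nhds (hK.isOpen_compl.mem_nhds hv))
  exact ⟨min ε 1, lt_min hε one_pos, min_le_right _ _, fun w hw =>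
    h (by rw [Metric.mem_closedBall, dist_eq_norm]; exact hw.trans (min_le_left _ _))⟩

theorem coneCompl_union_coneCompl_closedBall (hγ : IsChart S γ) {K : Set R4} {v : ℂ} {ρ : ℝ}
    (hρ : ∀ w, ‖w - v‖ ≤ ρ → γ w ∉ K) :
    coneCompl (K ∪ S \ γ '' Metric.ball v ρ) ∪ coneCompl (γ '' Metric.closedBall v ρ) =
      coneCompl (γ '' ann v ρ ρ) := by
  rw [← coneCompl_inter]
  congr 1
  ext x
  constructor
  · rintro ⟨hx, w, hw, rfl⟩
    rw [Metric.mem_closedBall, dist_eq_norm] at hw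
    refine ⟨w, ⟨not_lt.1 fun hlt => ?_, hw⟩, rfl⟩
    rcases hx with hx | hx
    · exact hρ w hw hx
    · exact hx.2 ⟨w, by rwa [Metric.mem_ball, dist_eq_norm], rfl⟩
  · rintro ⟨w, ⟨h1, h2⟩, rfl⟩
    refine ⟨Or.inr ⟨hγ.mem w, ?_⟩, w, by rwa [Metric.mem_closedBall, dist_eq_norm], rfl⟩
    rintro ⟨w', hw', h⟩
    rw [hγ.injective h, Metric.mem_ball, dist_eq_norm] at hw'
    exact absurd h1 (not_le.2 hw')

theorem coneCompl_inter_coneCompl_closedBall (hγ : IsChart S γ) {K : Set R4} {v : ℂ} {ρ : ℝ} :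
    coneCompl (K ∪ S \ γ '' Metric.ball v ρ) ∩ coneCompl (γ '' Metric.closedBall v ρ) =
      coneCompl (K ∪ S) := by
  rw [← coneCompl_union]
  congr 1
  have h1 : γ '' Metric.closedBall v ρ ⊆ S := by rintro _ ⟨w, -, rfl⟩; exact hγ.mem w
  have h2 : γ '' Metric.ball v ρ ⊆ γ '' Metric.closedBall v ρ :=
    image_mono Metric.ball_subset_closedBall
  ext x
  simp only [mem_union, mem_sdiff]
  have := @h1 x
  have := @h2 x
  tauto

theorem acyclic_coneCompl_closedBall (hγ : IsChart S γ) (hS : ∀ x ∈ S, ‖x‖ = 1) (v : ℂ) {ρ : ℝ}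
    (hρ : 0 < ρ) : Acyclic (coneCompl (γ '' Metric.closedBall v ρ)) :=
  acyclic_coneCompl_image_of_convex (isCompact_closedBall v ρ) (convex_closedBall v ρ)
    ⟨v, Metric.mem_closedBall_self hρ.le⟩ hγ.continuous.continuousOn hγ.injective.injOn
    fun w _ => hS _ (hγ.mem w)

theorem exists_not_linked (hγ : IsChart S γ) (hS : ∀ x ∈ S, ‖x‖ = 1) {K : Set R4}
    (hK : IsClosed K) {v : ℂ} (hv : γ v ∉ K) (hv1 : ‖v‖ < 1) {N : Set R4} (hNc : Convex ℝ N)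
    (hN : N ⊆ coneCompl (S \ γ '' Metric.ball 0 1)) (hKN : coneCompl K ⊆ N) :
    ∃ a ∈ coneCompl (K ∪ S), ∃ b ∈ coneCompl (K ∪ S), ¬ Linked (N ∩ coneCompl S) a b := by
  by_contra! hcon
  obtain ⟨ρ, hρ, hρ1, hball⟩ := exists_closedBall_image_subset hγ hK hv
  have hU := coneCompl_union_coneCompl_closedBall hγ hball
  have hI := coneCompl_inter_coneCompl_closedBall hγ (K := K) (v := v) (ρ := ρ)
  have hn : ∀ v, ‖γ v‖ = 1 := fun v => hS _ (hγ.mem v)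
  have hAo : IsOpen (coneCompl (K ∪ S \ γ '' Metric.ball v ρ)) :=
    isOpen_coneCompl (hK.union (hγ.isClosed_diff _ Metric.isOpen_ball))
  have hBo := isOpen_coneCompl_image hγ.continuous (isCompact_closedBall v ρ)
  have hBS : coneCompl S ⊆ coneCompl (γ '' Metric.closedBall v ρ) := coneCompl_anti <| by
    rintro _ ⟨w, -, rfl⟩; exact hγ.mem w
  obtain ⟨z₀, hz, hz2, hz0, hnb, -⟩ :=
    rankOne_coneCompl_circle (v := v) hγ.continuous hγ.injective hn hρ
  rw [← hU] at hz hnb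
  obtain ⟨zA, hzA, zB, hzB, hAB, hB, hhom⟩ := exists_split hAo hBo hz hz0
  obtain ⟨w, hw, hwz⟩ : Bounds (N ∩ coneCompl S) (bd zA) := by
    refine bounds_of_linked hcon ?_ (bd_mem_homog (n := 1) (hhom _ hz2).1) (bd_bd _)
    rw [← hI]
    exact mem_chainsIn_inter (bd_mem_chainsIn hzA) (hAB ▸ bd_mem_chainsIn hzB)
  have h1 : Bounds (coneCompl (γ '' Metric.closedBall v ρ)) (zB + w) :=
    acyclic_coneCompl_closedBall hγ hS v hρ _
      (add_mem hzB (chainsIn_mono (inter_subset_right.trans hBS) hw))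
      (by rw [map_add, hwz, hAB, chain_add_self])
  have hsubA : coneCompl (K ∪ S \ γ '' Metric.ball v ρ) ⊆ N :=
    (coneCompl_anti subset_union_left).trans hKN
  have h2 : Bounds N (zA + w) := by
    obtain ⟨p, hp⟩ : N.Nonempty :=
      ⟨γ v, hKN ((mem_coneCompl_of_norm_eq_one (hn v)).2 hv)⟩
    exact (hNc.starConvex hp).acyclic hp _
      (add_mem (chainsIn_mono hsubA hzA) (chainsIn_mono inter_subset_left hw))
      (by rw [map_add, hwz, chain_add_self])
  have h3 : Bounds (coneCompl (γ '' ann v ρ 2)) (zA + w) := by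
    refine bounds_coneCompl_ann hγ.continuous hγ.injective hn hρ (by linarith) (add_mem
      (chainsIn_mono (coneCompl_anti ?_) hzA)
      (chainsIn_mono (inter_subset_right.trans (coneCompl_anti ?_)) hw))
      (by rw [map_add, hwz, chain_add_self]) (h2.mono (hN.trans (coneCompl_anti ?_)))
    · rintro _ ⟨u, hu, rfl⟩
      refine Or.inr ⟨hγ.mem u, ?_⟩
      rintro ⟨u', hu', h⟩
      rw [hγ.injective h, Metric.mem_ball, dist_eq_norm] at hu'
      exact absurd hu.1 (not_le.2 hu')
    · rintro _ ⟨u, -, rfl⟩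
      exact hγ.mem u
    · rintro _ ⟨u, hu, rfl⟩
      refine ⟨hγ.mem u, ?_⟩
      rintro ⟨u', hu', h⟩
      rw [hγ.injective h, mem_ball_zero_iff] at hu'
      linarith [hu.1, norm_sub_le u v]
  have h4 : Bounds (coneCompl (γ '' ann v ρ ρ)) (zA + w) :=
    h3.mono (coneCompl_anti (image_mono fun u hu => ⟨hu.1, hu.2.trans (by linarith)⟩))
  rw [← hU] at h4
  have h5 := hB.add (h4.add (h1.mono subset_union_right))
  rw [add_add_add_comm zA, chain_add_self w, add_zero, add_assoc, chain_add_self, add_zero] at h5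
  exact hnb h5

theorem exists_nhds_linked (hγ : IsChart S γ) (hS : ∀ x ∈ S, ‖x‖ = 1) {K : Set R4}
    (hK : IsClosed K) (hγK : γ 0 ∉ K) : ∃ W ∈ nhds (γ 0),
      ∀ a ∈ W ∩ coneCompl S, ∀ b ∈ W ∩ coneCompl S, ∀ c ∈ W ∩ coneCompl S,
        Linked (coneCompl (K ∪ S)) a b ∨ Linked (coneCompl (K ∪ S)) b c ∨
          Linked (coneCompl (K ∪ S)) a c := by
  obtain ⟨ρ, hρ, hρ1, hball⟩ := exists_closedBall_image_subset hγ hK hγK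
  have hU := coneCompl_union_coneCompl_closedBall hγ hball
  have hI := coneCompl_inter_coneCompl_closedBall hγ (K := K) (v := 0) (ρ := ρ)
  have hn : ∀ v, ‖γ v‖ = 1 := fun v => hS _ (hγ.mem v)
  have hAo : IsOpen (coneCompl (K ∪ S \ γ '' Metric.ball 0 ρ)) :=
    isOpen_coneCompl (hK.union (hγ.isClosed_diff _ Metric.isOpen_ball))
  have hBo := isOpen_coneCompl_image hγ.continuous (isCompact_closedBall 0 ρ)
  have hBS : coneCompl S ⊆ coneCompl (γ '' Metric.closedBall 0 ρ) := coneCompl_anti <| by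
    rintro _ ⟨w, -, rfl⟩; exact hγ.mem w
  obtain ⟨z₀, hz, hz2, hz0, -, hone⟩ :=
    rankOne_coneCompl_circle (v := 0) hγ.continuous hγ.injective hn hρ
  rw [← hU] at hz hone
  have hy : γ 0 ∈ coneCompl (K ∪ S \ γ '' Metric.ball 0 ρ) := by
    rw [mem_coneCompl_of_norm_eq_one (hn 0)]
    rintro (h | h)
    · exact hγK h
    · exact h.2 ⟨0, Metric.mem_ball_self hρ, rfl⟩
  obtain ⟨ε, hε, hεA⟩ := Metric.isOpen_iff.1 hAo _ hy
  have key : ∀ a ∈ Metric.ball (γ 0) ε ∩ coneCompl S, ∀ b ∈ Metric.ball (γ 0) ε ∩ coneCompl S,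
      Linked (coneCompl (K ∪ S)) a b ∨
        ∃ x ∈ chainsIn (coneCompl (K ∪ S \ γ '' Metric.ball 0 ρ)),
        ∃ y ∈ chainsIn (coneCompl (γ '' Metric.closedBall 0 ρ)),
          bd x = simplex [a] + simplex [b] ∧
          Bounds (coneCompl (K ∪ S \ γ '' Metric.ball 0 ρ) ∪
            coneCompl (γ '' Metric.closedBall 0 ρ)) (x + y + z₀) := by
    intro a ha b hb
    have hx : simplex [a, b] ∈ chainsIn (coneCompl (K ∪ S \ γ '' Metric.ball 0 ρ)) :=
      simplex_mem_chainsIn <| by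
        rw [hull_pair]
        exact ((convex_ball _ _).segment_subset ha.1 hb.1).trans hεA
    have hpt : ∀ c ∈ coneCompl S,
        simplex [c] ∈ chainsIn (coneCompl (γ '' Metric.closedBall 0 ρ)) :=
      fun c hc => simplex_mem_chainsIn (by rw [hull_singleton]; exact singleton_subset_iff.2 (hBS hc))
    obtain ⟨y, hy, hyab⟩ := acyclic_coneCompl_closedBall hγ hS 0 hρ (simplex [a] + simplex [b])
      (add_mem (hpt a ha.2) (hpt b hb.2)) (by rw [← bd_simplex_pair, bd_bd])
    refine (hone (simplex [a, b] + y) (add_mem (chainsIn_mono subset_union_left hx)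
      (chainsIn_mono subset_union_right hy)) ?_).imp (fun h => ?_)
      fun h => ⟨_, hx, _, hy, bd_simplex_pair a b, h⟩
    · rw [map_add, hyab, bd_simplex_pair, chain_add_self]
    · have := h.bd_of_add hAo hBo hx hy
      rwa [hI, bd_simplex_pair] at this
  refine ⟨_, Metric.ball_mem_nhds _ hε, fun a ha b hb c hc => ?_⟩
  rcases key a ha b hb with h | ⟨x, hx, y, hy, hab, h⟩
  · exact Or.inl h
  rcases key b hb c hc with h' | ⟨x', hx', y', hy', hbc, h'⟩
  · exact Or.inr (Or.inl h')
  have := h.add h'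
  rw [add_add_add_comm, chain_add_self, add_zero, add_add_add_comm] at this
  have := this.bd_of_add hAo hBo (add_mem hx hx') (add_mem hy hy')
  rw [hI, map_add, hab, hbc, add_assoc, ← add_assoc (simplex [b]), chain_add_self, zero_add] at this
  exact Or.inr (Or.inr this)

end LocalSeparation

section SameComponent

variable {X Y : Type*} [TopologicalSpace X] [TopologicalSpace Y] {U V : Set X} {a b c : X}

/-- Two points of `U` lie in the same connected component of `U`. -/
def SameComponent (U : Set X) (a b : X) : Prop := ∃ T ⊆ U, IsPreconnected T ∧ a ∈ T ∧ b ∈ T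

theorem SameComponent.refl (ha : a ∈ U) : SameComponent U a a :=
  ⟨{a}, singleton_subset_iff.2 ha, isPreconnected_singleton, rfl, rfl⟩

theorem SameComponent.symm : SameComponent U a b → SameComponent U b a :=
  fun ⟨T, hT, hp, ha, hb⟩ => ⟨T, hT, hp, hb, ha⟩

theorem SameComponent.trans : SameComponent U a b → SameComponent U b c → SameComponent U a c :=
  fun ⟨T, hT, hp, ha, hb⟩ ⟨T', hT', hp', hb', hc⟩ =>
    ⟨T ∪ T', union_subset hT hT', hp.union b hb hb' hp', Or.inl ha, Or.inr hc⟩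

theorem SameComponent.mono (h : U ⊆ V) : SameComponent U a b → SameComponent V a b :=
  fun ⟨T, hT, hp⟩ => ⟨T, hT.trans h, hp⟩

theorem SameComponent.right_mem : SameComponent U a b → b ∈ U := fun ⟨_, hT, _, _, hb⟩ => hT hb

theorem SameComponent.left_mem : SameComponent U a b → a ∈ U := fun h => h.symm.right_mem

theorem SameComponent.map {W : Set Y} {f : X → Y} (hf : ContinuousOn f U) (hW : MapsTo f U W) :
    SameComponent U a b → SameComponent W (f a) (f b) :=
  fun ⟨T, hT, hp, ha, hb⟩ => ⟨f '' T, (hW.mono_left hT).image_subset, hp.image f (hf.mono hT),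
    mem_image_of_mem f ha, mem_image_of_mem f hb⟩

end SameComponent

section Truncation

variable {E : Type*} [NormedAddCommGroup E] [NormedSpace ℝ E] {U K : Set E} {a b : E}

theorem sameComponent_of_segment_subset (h : segment ℝ a b ⊆ U) : SameComponent U a b :=
  ⟨_, h, (convex_segment a b).isPreconnected, left_mem_segment ℝ a b, right_mem_segment ℝ a b⟩

theorem Linked.sameComponent (h : Linked U a b) (ha : a ∈ U) : SameComponent U a b :=
  ⟨_, connectedComponentIn_subset U a, isPreconnected_connectedComponentIn,
    mem_connectedComponentIn ha, mem_connectedComponentIn_of_linked h ha⟩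

theorem SameComponent.linked (hU : IsOpen U) : SameComponent U a b → Linked U a b :=
  fun ⟨_, hT, hp, ha, hb⟩ => hp.linked hU hT ha hb

theorem segment_smul_subset_coneCompl (ha : a ∈ coneCompl K) {r : ℝ} (hr : 0 < r) :
    segment ℝ a (r • a) ⊆ coneCompl K := by
  rintro _ ⟨s, t, hs, ht, hst, rfl⟩
  rw [smul_smul, ← add_smul]
  refine smul_mem_coneCompl ?_ ha
  rcases hs.eq_or_lt with rfl | hs
  · rw [show t = 1 by linarith]; simpa using hr
  · positivity

theorem continuousOn_normalize : ContinuousOn (fun x : E => ‖x‖⁻¹ • x) {0}ᶜ :=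
  (continuousOn_id.norm.inv₀ fun _ hx => norm_ne_zero_iff.2 hx).smul continuousOn_id

theorem SameComponent.truncate (h : SameComponent (coneCompl K) a b) {s : Set ℝ}
    (hs : s.OrdConnected) (ha : ‖a‖ ∈ s) (hb : ‖b‖ ∈ s) : SameComponent (coneCompl K ∩ {x | ‖x‖ ∈ s}) a b := by
  have ha0 := norm_pos_iff.2 h.left_mem.1
  have hb0 := norm_pos_iff.2 h.right_mem.1
  set lo := min ‖a‖ ‖b‖
  set hi := max ‖a‖ ‖b‖
  have hlo : 0 < lo := lt_min ha0 hb0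
  have hlohi : lo ≤ hi := min_le_max
  have hpos : ∀ x : E, 0 < max lo (min hi ‖x‖) := fun x => lt_max_of_lt_left hlo
  let φ : E → E := fun x => max lo (min hi ‖x‖) • ‖x‖⁻¹ • x
  have hφ : ∀ x : E, x ≠ 0 → lo ≤ ‖x‖ → ‖x‖ ≤ hi → φ x = x := fun x hx h1 h2 => by
    simp only [φ]
    rw [min_eq_right h2, max_eq_right h1, smul_smul, mul_inv_cancel₀ (norm_ne_zero_iff.2 hx),
      one_smul]
  have := h.map (f := φ) (W := coneCompl K ∩ {x | ‖x‖ ∈ s}) ?_ ?_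
  · rwa [hφ a h.left_mem.1 (min_le_left _ _) (le_max_left _ _),
      hφ b h.right_mem.1 (min_le_right _ _) (le_max_right _ _)] at this
  · exact (by fun_prop : Continuous fun x : E => max lo (min hi ‖x‖)).continuousOn.smul
      (continuousOn_normalize.mono fun x hx => hx.1)
  · intro x hx
    refine ⟨smul_mem_coneCompl (hpos x) (normalized_mem_coneCompl hx), ?_⟩
    have hn : ‖φ x‖ = max lo (min hi ‖x‖) := by
      simp only [φ]
      rw [norm_smul, norm_normalized hx.1, mul_one, Real.norm_of_nonneg (hpos x).le]
    rw [mem_ofPred_eq, hn]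
    have hlos : lo ∈ s := by rcases min_choice ‖a‖ ‖b‖ with h | h <;> simpa only [lo, h]
    have hhis : hi ∈ s := by rcases max_choice ‖a‖ ‖b‖ with h | h <;> simpa only [hi, h]
    exact hs.out hlos hhis ⟨le_max_left _ _, max_le hlohi (min_le_left _ _)⟩

end Truncation

section LocalStructure

/-- Near `q`, the set `U` has exactly two sides in arbitrarily small neighbourhoods, and both
accumulate at every nearby point not in `U`. -/
def TwoSidedAt {X : Type*} [TopologicalSpace X] (U : Set X) (q : X) : Prop :=
  ∀ M ∈ nhds q, ∃ N W : Set X, IsOpen N ∧ IsOpen W ∧ q ∈ W ∧ W ⊆ N ∧ N ⊆ M ∧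
    (∀ q' ∈ W, q' ∉ U → ∀ W' ∈ nhds q', ∃ a ∈ W' ∩ U, ∃ b ∈ W' ∩ U, ¬ SameComponent (N ∩ U) a b) ∧
    ∀ a ∈ W ∩ U, ∀ b ∈ W ∩ U, ∀ c ∈ W ∩ U,
      SameComponent (N ∩ U) a b ∨ SameComponent (N ∩ U) b c ∨ SameComponent (N ∩ U) a c

theorem twoSidedAt_coneCompl {S : Set R4} (hSc : IsClosed S) (hS : ∀ x ∈ S, ‖x‖ = 1)
    (hch : ∀ y ∈ S, ∃ γ, IsChart S γ ∧ γ 0 = y) {q : R4} (hq0 : q ≠ 0) (hq : q ∉ coneCompl S) :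
    TwoSidedAt (coneCompl S) q := by
  have hmem : ∀ x : R4, x ≠ 0 → x ∉ coneCompl S → ‖x‖⁻¹ • x ∈ S := fun x h0 h => by
    by_contra hx; exact h ⟨h0, hx⟩
  have hrec : ∀ x : R4, x ≠ 0 → ‖x‖ • ‖x‖⁻¹ • x = x := fun x h0 => by
    rw [smul_smul, mul_inv_cancel₀ (norm_ne_zero_iff.2 h0), one_smul]
  intro M hM
  obtain ⟨γ, hγ, hγ0⟩ := hch _ (hmem q hq0 hq)
  set r := ‖q‖
  have hn0 : ‖γ 0‖ = 1 := hS _ (hγ.mem 0)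
  obtain ⟨W₁, hW₁, τ, hτ, hM'⟩ : ∃ W₁ ∈ nhds (γ 0), ∃ τ > 0, ∀ u ∈ W₁, ∀ s : ℝ, |s - r| < τ →
      s • u ∈ M := by
    have hcont : Filter.Tendsto (fun p : R4 × ℝ => p.2 • p.1) (nhds (γ 0, r)) (nhds q) := by
      have : Continuous fun p : R4 × ℝ => p.2 • p.1 := by fun_prop
      have h := this.tendsto (γ 0, r)
      rwa [hγ0, hrec q hq0, ← hγ0] at h
    obtain ⟨W₁, hW₁, I, hI, hsub⟩ := mem_nhds_prod_iff.1 (hcont hM)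
    obtain ⟨τ, hτ, hball⟩ := Metric.mem_nhds_iff.1 hI
    exact ⟨W₁, hW₁, τ, hτ, fun u hu s hs => hsub (mk_mem_prod hu (hball hs))⟩
  have hW₂ : (S \ γ '' Metric.ball 0 1)ᶜ ∈ nhds (γ 0) :=
    (hγ.isClosed_diff _ Metric.isOpen_ball).isOpen_compl.mem_nhds
      fun h => h.2 ⟨0, Metric.mem_ball_self one_pos, rfl⟩
  obtain ⟨K, hK, hγK, hconv, hKW⟩ := exists_convex_cone hn0 (Filter.inter_mem hW₁ hW₂)
  obtain ⟨W₃, hW₃, hlink⟩ := exists_nhds_linked hγ hS hK hγK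
  set shell : Set R4 := {x | ‖x‖ ∈ Metric.ball r τ} with hshell
  have hord : (Metric.ball r τ).OrdConnected := by
    rw [Real.ball_eq_Ioo]; exact ordConnected_Ioo
  have hshello : IsOpen shell := Metric.isOpen_ball.preimage continuous_norm
  have hKU : coneCompl K ∩ coneCompl S = coneCompl (K ∪ S) := (coneCompl_union K S).symm
  have hN : coneCompl K ∩ shell ∩ coneCompl S = coneCompl (K ∪ S) ∩ shell := by
    rw [inter_right_comm, hKU]
  refine ⟨coneCompl K ∩ shell, coneCompl (K ∪ (interior W₃)ᶜ) ∩ shell,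
    (isOpen_coneCompl hK).inter hshello,
    (isOpen_coneCompl (hK.union isOpen_interior.isClosed_compl)).inter hshello, ⟨⟨hq0, ?_⟩,
      Metric.mem_ball_self hτ⟩, inter_subset_inter_left _ (coneCompl_anti subset_union_left),
    ?_, ?_, ?_⟩
  · rw [← hγ0]
    rintro (h | h)
    · exact hγK h
    · exact h (mem_interior_iff_mem_nhds.2 hW₃)
  · rintro x ⟨hx, hxs⟩
    rw [← hrec x hx.1]
    exact hM' _ (hKW x hx).1 _ hxs
  · rintro q' ⟨hq'K, hq's⟩ hq' W' hW'
    have hq'0 : q' ≠ 0 := hq'K.1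
    replace hq'K : q' ∈ coneCompl K := coneCompl_anti subset_union_left hq'K
    have hy' := hmem q' hq'0 hq'
    obtain ⟨v, hv, hvq⟩ : ‖q'‖⁻¹ • q' ∈ γ '' Metric.ball 0 1 := by
      by_contra hcon
      exact (hKW q' hq'K).2 ⟨hy', hcon⟩
    have hcl : IsClosed (K ∪ {u : R4 | ‖q'‖ • u ∈ (interior W')ᶜ}) :=
      hK.union (isOpen_interior.isClosed_compl.preimage (continuous_const_smul _))
    obtain ⟨a, ha, b, hb, hab⟩ := exists_not_linked hγ hS hcl (v := v) (by
        rw [hvq]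
        rintro (h | h)
        · exact hq'K.2 h
        · rw [mem_ofPred_eq, hrec q' hq'0] at h
          exact h (mem_interior_iff_mem_nhds.2 hW')) (mem_ball_zero_iff.1 hv) hconv
      (fun x hx => ⟨hx.1, (hKW x hx).2⟩) (coneCompl_anti subset_union_left)
    have hscale : ∀ x ∈ coneCompl (K ∪ {u : R4 | ‖q'‖ • u ∈ (interior W')ᶜ} ∪ S),
        ‖q'‖ • ‖x‖⁻¹ • x ∈ W' ∩ coneCompl S ∧
          SameComponent (coneCompl K ∩ coneCompl S) x (‖q'‖ • ‖x‖⁻¹ • x) := fun x hx => by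
      have hr : 0 < ‖q'‖ := norm_pos_iff.2 hq'0
      have hr' : 0 < ‖x‖⁻¹ := inv_pos.2 (norm_pos_iff.2 hx.1)
      have hx' : x ∈ coneCompl (K ∪ S) :=
        coneCompl_anti (union_subset_union_left _ subset_union_left) hx
      refine ⟨⟨?_, ?_⟩, ?_⟩
      · by_contra hcon
        exact hx.2 (Or.inl (Or.inr fun h => hcon (interior_subset h)))
      · exact smul_mem_coneCompl hr (smul_mem_coneCompl hr' (coneCompl_anti subset_union_right hx'))
      · rw [hKU, smul_smul]
        exact sameComponent_of_segment_subset (segment_smul_subset_coneCompl hx' (mul_pos hr hr'))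
    refine ⟨_, (hscale a ha).1, _, (hscale b hb).1, fun hcon => hab ?_⟩
    have := ((hscale a ha).2.trans (hcon.mono
      (inter_subset_inter_left _ inter_subset_left))).trans (hscale b hb).2.symm
    exact this.linked ((isOpen_coneCompl hK).inter (isOpen_coneCompl hSc))
  · have hnorm : ∀ x ∈ coneCompl (K ∪ (interior W₃)ᶜ) ∩ shell ∩ coneCompl S,
        ‖x‖⁻¹ • x ∈ W₃ ∩ coneCompl S ∧ SameComponent (coneCompl (K ∪ S)) x (‖x‖⁻¹ • x) := by
      rintro x ⟨⟨hx, -⟩, hxS⟩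
      have hr' : 0 < ‖x‖⁻¹ := inv_pos.2 (norm_pos_iff.2 hx.1)
      have hx' : x ∈ coneCompl (K ∪ S) := hKU ▸ ⟨coneCompl_anti subset_union_left hx, hxS⟩
      refine ⟨⟨?_, smul_mem_coneCompl hr' hxS⟩,
        sameComponent_of_segment_subset (segment_smul_subset_coneCompl hx' hr')⟩
      by_contra hcon
      exact hx.2 (Or.inr fun h => hcon (interior_subset h))
    have hfin : ∀ x ∈ coneCompl (K ∪ (interior W₃)ᶜ) ∩ shell ∩ coneCompl S,
        ∀ x' ∈ coneCompl (K ∪ (interior W₃)ᶜ) ∩ shell ∩ coneCompl S,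
        Linked (coneCompl (K ∪ S)) (‖x‖⁻¹ • x) (‖x'‖⁻¹ • x') →
        SameComponent (coneCompl K ∩ shell ∩ coneCompl S) x x' := fun x hx x' hx' h => by
      rw [hN]
      exact (((hnorm x hx).2.trans (h.sameComponent (hnorm x hx).2.right_mem)).trans
        (hnorm x' hx').2.symm).truncate hord hx.1.2 hx'.1.2
    intro a ha b hb c hc
    exact (hlink _ (hnorm a ha).1 _ (hnorm b hb).1 _ (hnorm c hc).1).imp (hfin a ha b hb)
      (Or.imp (hfin b hb c hc) (hfin a ha c hc))

end LocalStructure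

section SideFunctions

open Filter Topology

variable {E : Type*} [TopologicalSpace E] {U Ω Ω' Y : Set E} {f g : E → Bool}

/-- A function on `Ω ∩ U` telling apart the two sides of the complement of `U` in `Ω`. -/
structure IsSideFunction (U Ω : Set E) (f : E → Bool) : Prop where
  eventually_eq : ∀ x ∈ Ω ∩ U, ∀ᶠ y in 𝓝 x, f y = f x
  frequently_eq : ∀ q ∈ Ω, q ∉ U → ∀ c, ∃ᶠ x in 𝓝 q, x ∈ U ∧ f x = c

theorem IsSideFunction.mono (hf : IsSideFunction U Ω f) (h : Ω' ⊆ Ω) : IsSideFunction U Ω' f :=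
  ⟨fun x hx => hf.1 x ⟨h hx.1, hx.2⟩, fun q hq => hf.2 q (h hq)⟩

theorem isSideFunction_of_forall_exists (h : ∀ x ∈ Ω, ∃ O, x ∈ O ∧ IsSideFunction U O f) :
    IsSideFunction U Ω f :=
  ⟨fun x hx => have ⟨_, hxO, hO⟩ := h x hx.1; hO.1 x ⟨hxO, hx.2⟩,
    fun x hx => have ⟨_, hxO, hO⟩ := h x hx; hO.2 x hxO⟩

theorem IsSideFunction.congr (hf : IsSideFunction U Ω f) (hU : IsOpen U) (hΩ : IsOpen Ω)
    (h : ∀ x ∈ Ω ∩ U, f x = g x) : IsSideFunction U Ω g := by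
  refine ⟨fun x hx => ?_, fun q hq hqU c => ?_⟩
  · filter_upwards [hf.1 x hx, (hΩ.inter hU).mem_nhds hx] with y hy hy'
    rw [← h x hx, ← h y hy', hy]
  · refine ((hf.2 q hq hqU c).and_eventually (hΩ.mem_nhds hq)).mono ?_
    rintro x ⟨⟨hxU, hx⟩, hxΩ⟩
    exact ⟨hxU, by rw [← h x ⟨hxΩ, hxU⟩, hx]⟩

theorem IsSideFunction.xor (hf : IsSideFunction U Ω f) (c : Bool) :
    IsSideFunction U Ω (fun x => c ^^ f x) := by
  refine ⟨fun x hx => ?_, fun q hq hqU d => ?_⟩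
  · filter_upwards [hf.1 x hx] with y hy
    rw [hy]
  · refine (hf.2 q hq hqU (c ^^ d)).mono ?_
    rintro x ⟨hxU, hx⟩
    exact ⟨hxU, by rw [hx]; simp⟩

theorem IsSideFunction.frequently_mem (hf : IsSideFunction U Ω f) {q : E} (hU : IsOpen U)
    (hq : q ∈ Ω) : ∃ᶠ x in 𝓝 q, x ∈ U := by
  by_cases h : q ∈ U
  · exact (hU.eventually_mem h).frequently
  · exact (hf.2 q hq h true).mono fun _ h => h.1

theorem IsSideFunction.eq_of_sameComponent (hf : IsSideFunction U Ω f) {a b : E}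
    (h : SameComponent (Ω ∩ U) a b) : f a = f b := by
  obtain ⟨T, hT, hp, ha, hb⟩ := h
  refine hp.induction₂ (fun x y => f x = f y) (fun x hx => ?_) (fun x y z _ _ _ => Eq.trans)
    (fun x y _ _ => Eq.symm) ha hb
  filter_upwards [mem_nhdsWithin_of_mem_nhds (hf.1 x (hT hx))] with y hy
  exact hy.symm

theorem IsSideFunction.eventually_eq_xor (hf : IsSideFunction U Ω f) (hg : IsSideFunction U Ω g)
    (hΩ : IsOpen Ω) (hY : ∀ q ∈ Ω, q ∉ U → TwoSidedAt U q) {q : E} (hq : q ∈ Ω) :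
    ∃ c : Bool, ∀ᶠ x in 𝓝 q, x ∈ U → g x = (c ^^ f x) := by
  by_cases hqU : q ∈ U
  · refine ⟨g q ^^ f q, ?_⟩
    filter_upwards [hf.1 q ⟨hq, hqU⟩, hg.1 q ⟨hq, hqU⟩] with x h1 h2 _
    rw [h1, h2]; simp
  · obtain ⟨N, W, -, hW, hqW, hWN, hN, -, h3⟩ := hY q hq hqU Ω (hΩ.mem_nhds hq)
    have key : ∀ {f}, IsSideFunction U Ω f → ∀ c, ∃ x ∈ W ∩ U, f x = c := fun hf c => by
      obtain ⟨x, ⟨hxU, hx⟩, hxW⟩ := ((hf.2 q hq hqU c).and_eventually (hW.mem_nhds hqW)).exists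
      exact ⟨x, ⟨hxW, hxU⟩, hx⟩
    have hNU : N ∩ U ⊆ Ω ∩ U := inter_subset_inter_left _ hN
    obtain ⟨a, ha, hfa⟩ := key hf true
    obtain ⟨b, hb, hfb⟩ := key hf false
    have hab : ∀ x ∈ W ∩ U, (f x = true ∧ g x = g a) ∨ (f x = false ∧ g x = g b) := fun x hx => by
      rcases h3 a ha x hx b hb with h | h | h
      · left
        rw [← hf.eq_of_sameComponent (h.mono hNU), hg.eq_of_sameComponent (h.mono hNU)]
        exact ⟨hfa, rfl⟩
      · right
        rw [hf.eq_of_sameComponent (h.mono hNU), hg.eq_of_sameComponent (h.mono hNU)]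
        exact ⟨hfb, rfl⟩
      · exact absurd (hf.eq_of_sameComponent (h.mono hNU)) (by simp [hfa, hfb])
    have hgab : g a = !g b := by
      obtain ⟨x, hx, hgx⟩ := key hg (!g b)
      rcases hab x hx with h | h
      · rw [← h.2, hgx]
      · rw [h.2] at hgx
        simp at hgx
    refine ⟨g b, ?_⟩
    filter_upwards [hW.mem_nhds hqW] with x hx hxU
    rcases hab x ⟨hx, hxU⟩ with h | h
    · rw [h.1, h.2, hgab]; simp
    · rw [h.1, h.2]; simp

theorem IsSideFunction.exists_eq_xor (hf : IsSideFunction U Ω f) (hg : IsSideFunction U Ω g)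
    (hU : IsOpen U) (hΩ : IsOpen Ω) (hΩp : IsPreconnected Ω)
    (hY : ∀ q ∈ Ω, q ∉ U → TwoSidedAt U q) : ∃ c : Bool, ∀ x ∈ Ω ∩ U, g x = (c ^^ f x) := by
  let A : Bool → Set E := fun c => {q | ∀ᶠ x in 𝓝 q, x ∈ U → g x = (c ^^ f x)}
  have hA : ∀ c, IsOpen (A c) := fun c => isOpen_setOfPred_eventually_nhds
  have hcov : Ω ⊆ A true ∪ A false := fun q hq => by
    obtain ⟨c, hc⟩ := hf.eventually_eq_xor hg hΩ hY hq
    cases c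
    · exact Or.inr hc
    · exact Or.inl hc
  have hdis : Ω ∩ (A true ∩ A false) = ∅ := by
    by_contra hne
    obtain ⟨q, hq, h1, h2⟩ := nonempty_iff_ne_empty.2 hne
    obtain ⟨x, hx, h1', h2'⟩ := ((hf.frequently_mem hU hq).and_eventually (h1.and h2)).exists
    have := (h1' hx).symm.trans (h2' hx)
    simp at this
  have hfin : ∀ c, Ω ⊆ A c → ∃ c : Bool, ∀ x ∈ Ω ∩ U, g x = (c ^^ f x) := fun c hc =>
    ⟨c, fun x hx => (hc hx.1).self_of_nhds hx.2⟩
  rcases isPreconnected_iff_subset_of_disjoint.1 hΩp _ _ (hA true) (hA false) hcov hdis with h | h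
  · exact hfin _ h
  · exact hfin _ h

theorem IsSideFunction.exists_union (hf : IsSideFunction U Ω f) (hg : IsSideFunction U Ω' g)
    (hU : IsOpen U) (hΩ : IsOpen Ω) (hΩ' : IsOpen Ω') (hp : IsPreconnected (Ω ∩ Ω'))
    (hY : ∀ q ∈ Ω, q ∉ U → TwoSidedAt U q) : ∃ h, IsSideFunction U (Ω ∪ Ω') h := by
  classical
  obtain ⟨c, hc⟩ := (hg.mono inter_subset_right).exists_eq_xor (hf.mono inter_subset_left) hU
    (hΩ.inter hΩ') hp fun q hq => hY q hq.1
  refine ⟨fun x => if x ∈ Ω then f x else c ^^ g x, isSideFunction_of_forall_exists ?_⟩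
  rintro x (hx | hx)
  · exact ⟨Ω, hx, hf.congr hU hΩ fun y hy => by simp [hy.1]⟩
  · refine ⟨Ω', hx, (hg.xor c).congr hU hΩ' fun y hy => ?_⟩
    by_cases hyΩ : y ∈ Ω
    · simp [hyΩ, hc y ⟨⟨hyΩ, hy.1⟩, hy.2⟩]
    · simp [hyΩ]

end SideFunctions

section StarConvex

open Filter Topology

variable {E : Type*} [NormedAddCommGroup E] [NormedSpace ℝ E] {U Ω Y : Set E} {f : E → Bool}

theorem eventually_sameComponent (hU : IsOpen U) {x : E} (hx : x ∈ U) :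
    ∀ᶠ y in 𝓝 x, SameComponent U x y := by
  obtain ⟨ε, hε, h⟩ := Metric.isOpen_iff.1 hU x hx
  filter_upwards [Metric.ball_mem_nhds x hε] with y hy
  exact ⟨_, h, (convex_ball x ε).isPreconnected, Metric.mem_ball_self hε, hy⟩

theorem exists_isSideFunction_nhds (hU : IsOpen U) {q : E} (hq : q ∉ U → TwoSidedAt U q) :
    ∃ Ω, IsOpen Ω ∧ q ∈ Ω ∧ ∃ f, IsSideFunction U Ω f := by
  classical
  by_cases hqU : q ∈ U
  · exact ⟨U, hU, hqU, fun _ => true, fun _ _ => Eventually.of_forall fun _ => rfl,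
      fun x hx hx' => absurd hx hx'⟩
  · obtain ⟨N, W, hN, hW, hqW, hWN, -, h2, h3⟩ := hq hqU univ univ_mem
    obtain ⟨a, ha, -, -, -⟩ := h2 q hqW hqU W (hW.mem_nhds hqW)
    refine ⟨W, hW, hqW, fun x => decide (SameComponent (N ∩ U) a x), fun x hx => ?_,
      fun q' hq' hq'U c => frequently_iff.2 fun {W'} hW' => ?_⟩
    · filter_upwards [eventually_sameComponent (hN.inter hU) (x := x) ⟨hWN hx.1, hx.2⟩] with y hy
      rw [decide_eq_decide]
      exact ⟨fun h => h.trans hy.symm, fun h => h.trans hy⟩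
    · obtain ⟨a', ha', b', hb', hab⟩ := h2 q' hq' hq'U _ (inter_mem hW' (hW.mem_nhds hq'))
      have hor : SameComponent (N ∩ U) a a' ∨ SameComponent (N ∩ U) a b' := by
        rcases h3 a ha a' ⟨ha'.1.2, ha'.2⟩ b' ⟨hb'.1.2, hb'.2⟩ with h | h | h
        · exact Or.inl h
        · exact absurd h hab
        · exact Or.inr h
      have hnand : ¬ (SameComponent (N ∩ U) a a' ∧ SameComponent (N ∩ U) a b') :=
        fun h => hab (h.1.symm.trans h.2)
      by_cases h : SameComponent (N ∩ U) a a'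
      · have h' : ¬ SameComponent (N ∩ U) a b' := fun h' => hnand ⟨h, h'⟩
        cases c
        · exact ⟨b', hb'.1.1, hb'.2, by simpa using h'⟩
        · exact ⟨a', ha'.1.1, ha'.2, by simpa using h⟩
      · have h' := hor.resolve_left h
        cases c
        · exact ⟨a', ha'.1.1, ha'.2, by simpa using h⟩
        · exact ⟨b', hb'.1.1, hb'.2, by simpa using h'⟩

theorem mem_segment_or_mem_segment {a b m z : E} (hm : m ∈ segment ℝ a b) (hz : z ∈ segment ℝ a b) :
    z ∈ segment ℝ a m ∨ z ∈ segment ℝ m b := by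
  rw [segment_eq_image_lineMap] at hm hz
  obtain ⟨r, hr, rfl⟩ := hm
  obtain ⟨s, hs, rfl⟩ := hz
  rcases le_total s r with h | h
  · left
    have := mem_image_of_mem (AffineMap.lineMap a b) ((segment_eq_Icc hr.1).ge ⟨hs.1, h⟩)
    rwa [image_segment, AffineMap.lineMap_apply_zero] at this
  · right
    have := mem_image_of_mem (AffineMap.lineMap a b) ((segment_eq_Icc hr.2).ge ⟨h, hs.2⟩)
    rwa [image_segment, AffineMap.lineMap_apply_one] at this

theorem exists_isSideFunction_segment (hU : IsOpen U) (hYo : IsOpen Y)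
    (hY : ∀ q ∈ Y, q ∉ U → TwoSidedAt U q) {o x : E} (hox : segment ℝ o x ⊆ Y) :
    ∃ Ω ⊆ Y, IsOpen Ω ∧ Convex ℝ Ω ∧ o ∈ Ω ∧ x ∈ Ω ∧ ∃ f, IsSideFunction U Ω f := by
  choose! O hO hqO f hf using fun q (hq : q ∈ Y) => exists_isSideFunction_nhds hU (hY q hq)
  have hcomp : IsCompact (segment ℝ o x) := by
    rw [← convexHull_pair]
    exact (Set.toFinite {o, x}).isCompact_convexHull ℝ
  obtain ⟨δ, hδ, hleb⟩ := lebesgue_number_lemma_of_metric hcomp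
    (c := fun q : segment ℝ o x => O q ∩ Y) (fun q => (hO q (hox q.2)).inter hYo)
    (fun q hq => mem_iUnion.2 ⟨⟨q, hq⟩, hqO q (hox hq), hox hq⟩)
  have hball : ∀ p ∈ segment ℝ o x, Metric.ball p δ ⊆ Y ∧
      ∃ f, IsSideFunction U (Metric.ball p δ) f := fun p hp => by
    obtain ⟨q, hq⟩ := hleb p hp
    exact ⟨hq.trans inter_subset_right, f q, (hf q (hox q.2)).mono (hq.trans inter_subset_left)⟩
  obtain ⟨n, hn⟩ := exists_nat_gt (‖x - o‖ / (δ / 2))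
  have hn0 : (0 : ℝ) < n := lt_of_le_of_lt (by positivity) hn
  let p : ℕ → E := fun k => o + ((k : ℝ) / n) • (x - o)
  have hp0 : p 0 = o := by simp [p]
  have hpn : p n = x := by simp [p, hn0.ne']
  have hpseg : ∀ k ≤ n, p k ∈ segment ℝ o x := fun k hk => by
    rw [segment_eq_image']
    exact ⟨(k : ℝ) / n, ⟨by positivity, (div_le_one hn0).2 (by exact_mod_cast hk)⟩, rfl⟩
  have hoseg := left_mem_segment ℝ o x
  have hsegsub : ∀ k ≤ n, segment ℝ o (p k) ⊆ segment ℝ o x := fun k hk =>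
    (convex_segment o x).segment_subset hoseg (hpseg k hk)
  let T : ℕ → Set E := fun k => Metric.thickening (δ / 2) (segment ℝ o (p k))
  have hTo : ∀ k, IsOpen (T k) := fun k => Metric.isOpen_thickening
  have hTc : ∀ k, Convex ℝ (T k) := fun k => (convex_segment _ _).thickening _
  have hTY : ∀ k ≤ n, T k ⊆ Y := fun k hk y hy => by
    obtain ⟨z, hz, hyz⟩ := Metric.mem_thickening_iff.1 hy
    exact (hball z (hsegsub k hk hz)).1 (Metric.mem_ball.2 (hyz.trans (half_lt_self hδ)))
  have hstep : ∀ k, dist (p (k + 1)) (p k) < δ / 2 := fun k => by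
    have : p (k + 1) - p k = ((1 : ℝ) / n) • (x - o) := by
      simp only [p]
      rw [add_sub_add_left_eq_sub, ← sub_smul]
      push_cast
      congr 1
      field_simp
      ring
    rw [dist_eq_norm, this, norm_smul, Real.norm_of_nonneg (by positivity), one_div_mul_eq_div,
      div_lt_iff₀ hn0]
    rwa [div_lt_iff₀ (by positivity), mul_comm] at hn
  have key : ∀ k ≤ n, ∃ f, IsSideFunction U (T k) f := by
    intro k
    induction k with
    | zero =>
      intro _
      obtain ⟨f, hf⟩ := (hball o hoseg).2
      refine ⟨f, hf.mono ?_⟩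
      simp only [T, hp0, segment_same, Metric.thickening_singleton]
      exact Metric.ball_subset_ball (by linarith)
    | succ k ih =>
      intro hk
      obtain ⟨f, hf⟩ := ih (by omega)
      obtain ⟨g, hg⟩ := (hball (p k) (hpseg k (by omega))).2
      obtain ⟨h, hh⟩ := hf.exists_union hg hU (hTo k) Metric.isOpen_ball
        ((hTc k).inter (convex_ball _ _)).isPreconnected fun q hq => hY q (hTY k (by omega) hq)
      refine ⟨h, hh.mono fun y hy => ?_⟩
      obtain ⟨z, hz, hyz⟩ := Metric.mem_thickening_iff.1 hy
      have hpk : p k ∈ segment ℝ o (p (k + 1)) := by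
        rw [segment_eq_image']
        refine ⟨(k : ℝ) / (k + 1),
          ⟨by positivity, (div_le_one (by positivity)).2 (by linarith)⟩, ?_⟩
        simp only [p, add_sub_cancel_left, smul_smul]
        congr 2
        push_cast
        field_simp
      rcases mem_segment_or_mem_segment hpk hz with hz | hz
      · exact Or.inl (Metric.mem_thickening_iff.2 ⟨z, hz, hyz⟩)
      · refine Or.inr ?_
        have : z ∈ Metric.ball (p k) (δ / 2) := (convex_ball _ _).segment_subset
          (Metric.mem_ball_self (by positivity)) (Metric.mem_ball.2 (hstep k)) hz
        rw [Metric.mem_ball] at this ⊢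
        linarith [dist_triangle y z (p k)]
  have hsub : segment ℝ o x ⊆ T n := by
    simp only [T, hpn]
    exact Metric.self_subset_thickening (by positivity) _
  exact ⟨T n, hTY n le_rfl, hTo n, hTc n, hsub hoseg, hsub (right_mem_segment ℝ o x), key n le_rfl⟩

theorem exists_isSideFunction_of_starConvex (hU : IsOpen U) (hYo : IsOpen Y)
    (hY : ∀ q ∈ Y, q ∉ U → TwoSidedAt U q) {o : E} (ho : o ∈ Y) (hstar : StarConvex ℝ o Y) :
    ∃ f, IsSideFunction U Y f := by
  choose! Ω hΩY hΩo hΩc hoΩ hxΩ f hf using fun x (hx : x ∈ Y) =>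
    exists_isSideFunction_segment hU hYo hY (starConvex_iff_segment_subset.1 hstar hx)
  have hcompare : ∀ x ∈ Y, ∀ x' ∈ Y, ∃ c : Bool, ∀ y ∈ Ω x ∩ Ω x' ∩ U, f x' y = (c ^^ f x y) :=
    fun x hx x' hx' => ((hf x hx).mono inter_subset_left).exists_eq_xor
      ((hf x' hx').mono inter_subset_right) hU ((hΩo x hx).inter (hΩo x' hx'))
      ((hΩc x hx).inter (hΩc x' hx')).isPreconnected fun q hq => hY q (hΩY x hx hq.1)
  choose! c hc using fun x hx => hcompare o ho x hx
  have hagree : ∀ x ∈ Y, ∀ x' ∈ Y, ∀ y ∈ Ω x ∩ Ω x' ∩ U, (c x' ^^ f x' y) = (c x ^^ f x y) := by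
    intro x hx x' hx'
    obtain ⟨d, hd⟩ := hcompare x hx x' hx'
    obtain ⟨y, hyU, hy, hy', hyo⟩ := (((hf o ho).frequently_mem hU (hoΩ o ho)).and_eventually
      (((hΩo x hx).eventually_mem (hoΩ x hx)).and (((hΩo x' hx').eventually_mem (hoΩ x' hx')).and
        ((hΩo o ho).eventually_mem (hoΩ o ho))))).exists
    have h1 := hc x hx y ⟨⟨hyo, hy⟩, hyU⟩
    have h2 := hc x' hx' y ⟨⟨hyo, hy'⟩, hyU⟩
    have h3 := hd y ⟨⟨hy, hy'⟩, hyU⟩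
    have hdc : d = (c x ^^ c x') := by
      rw [h1, h2] at h3
      revert h3
      generalize c x = p, c x' = q, f o y = r
      clear hd
      revert d p q r
      decide
    intro w hw
    rw [hd w hw, hdc]
    generalize c x = p, c x' = q, f x w = r
    revert p q r
    decide
  refine ⟨fun y => c y ^^ f y y, isSideFunction_of_forall_exists fun x hx =>
    ⟨Ω x, hxΩ x hx, ((hf x hx).xor (c x)).congr hU (hΩo x hx) fun y hy => ?_⟩⟩
  exact hagree y (hΩY x hx hy.1) x hx y ⟨⟨hxΩ y (hΩY x hx hy.1), hy.1⟩, hy.2⟩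

theorem exists_not_sameComponent (hU : IsOpen U) (hYo : IsOpen Y) (hUY : U ⊆ Y)
    (hY : ∀ q ∈ Y, q ∉ U → TwoSidedAt U q) {o : E} (ho : o ∈ Y) (hstar : StarConvex ℝ o Y)
    {q : E} (hq : q ∈ Y) (hqU : q ∉ U) : ∃ a ∈ U, ∃ b ∈ U, ¬ SameComponent U a b := by
  obtain ⟨f, hf⟩ := exists_isSideFunction_of_starConvex hU hYo hY ho hstar
  obtain ⟨a, ha, hfa⟩ := (hf.2 q hq hqU true).exists
  obtain ⟨b, hb, hfb⟩ := (hf.2 q hq hqU false).exists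
  refine ⟨a, ha, b, hb, fun h => ?_⟩
  rw [← inter_eq_right.2 hUY] at h
  have := hf.eq_of_sameComponent h
  simp [hfa, hfb] at this

theorem diff_subset_closure_component (hU : IsOpen U) (hYp : IsPreconnected Y) (hUY : U ⊆ Y)
    (hY : ∀ q ∈ Y, q ∉ U → TwoSidedAt U q) (hp : IsPreconnected (Y \ U)) {a : E} (ha : a ∈ U) :
    Y \ U ⊆ closure {x | SameComponent U a x} := by
  set C := {x | SameComponent U a x}
  have hCU : C ⊆ U := fun x hx => hx.right_mem
  have hCo : IsOpen C := isOpen_iff_mem_nhds.2 fun x hx => by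
    filter_upwards [eventually_sameComponent hU (hCU hx)] with y hy
    exact hx.trans hy
  have hclC : ∀ x ∈ U, x ∈ closure C → x ∈ C := fun x hx hxC => by
    obtain ⟨y, hy, hyC⟩ := ((mem_closure_iff_frequently.1 hxC).and_eventually
      (eventually_sameComponent hU hx)).exists
    exact hy.trans hyC.symm
  intro q hq
  by_contra hqC
  obtain ⟨q₁, hq₁, hq₁C⟩ : ((Y \ U) ∩ closure C).Nonempty := by
    by_contra hcon
    obtain ⟨x, -, hx, hx'⟩ := hYp C (closure C)ᶜ hCo isClosed_closure.isOpen_compl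
      (fun x hx => by
        by_cases hxC : x ∈ closure C
        · exact Or.inl (hclC x (by_contra fun h => hcon ⟨x, ⟨hx, h⟩, hxC⟩) hxC)
        · exact Or.inr hxC)
      ⟨a, hUY ha, .refl ha⟩ ⟨q, hq.1, hqC⟩
    exact hx' (subset_closure hx)
  have hev : ∀ q ∈ Y \ U, q ∈ closure C → ∀ᶠ y in 𝓝 q, y ∉ U → y ∈ closure C := fun q hq hqC => by
    obtain ⟨N, W, -, hW, hqW, -, -, h2, h3⟩ := hY q hq.1 hq.2 univ univ_mem
    obtain ⟨x, hxW, hxC⟩ := mem_closure_iff.1 hqC W hW hqW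
    filter_upwards [hW.mem_nhds hqW] with y hyW hyU
    refine mem_closure_iff.2 fun O hO hyO => ?_
    obtain ⟨b, hb, c, hc, hbc⟩ := h2 y hyW hyU _ ((hO.inter hW).mem_nhds ⟨hyO, hyW⟩)
    rcases h3 x ⟨hxW, hCU hxC⟩ b ⟨hb.1.2, hb.2⟩ c ⟨hc.1.2, hc.2⟩ with h | h | h
    · exact ⟨b, hb.1.1, hxC.trans (h.mono inter_subset_right)⟩
    · exact absurd h hbc
    · exact ⟨c, hc.1.1, hxC.trans (h.mono inter_subset_right)⟩
  obtain ⟨x, hx, hxA, hxC⟩ := hp {q | ∀ᶠ y in 𝓝 q, y ∉ U → y ∈ closure C} (closure C)ᶜ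
    isOpen_setOfPred_eventually_nhds isClosed_closure.isOpen_compl
    (fun x hx => (em (x ∈ closure C)).imp (hev x hx) id) ⟨q₁, hq₁, hev q₁ hq₁ hq₁C⟩ ⟨q, hq, hqC⟩
  exact hxC (Eventually.self_of_nhds hxA hx.2)

theorem sameComponent_or_of_twoSidedAt (hU : IsOpen U) (hYp : IsPreconnected Y) (hUY : U ⊆ Y)
    (hY : ∀ q ∈ Y, q ∉ U → TwoSidedAt U q) (hp : IsPreconnected (Y \ U)) (hne : (Y \ U).Nonempty)
    {a b c : E} (ha : a ∈ U) (hb : b ∈ U) (hc : c ∈ U) :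
    SameComponent U a b ∨ SameComponent U b c ∨ SameComponent U a c := by
  obtain ⟨q, hq⟩ := hne
  obtain ⟨N, W, -, hW, hqW, -, -, -, h3⟩ := hY q hq.1 hq.2 univ univ_mem
  have key : ∀ x ∈ U, ∃ x' ∈ W ∩ U, SameComponent U x x' := fun x hx => by
    obtain ⟨x', hxW, hx'⟩ := mem_closure_iff.1
      (diff_subset_closure_component hU hYp hUY hY hp hx hq) W hW hqW
    exact ⟨x', ⟨hxW, hx'.right_mem⟩, hx'⟩
  obtain ⟨a', ha', haa⟩ := key a ha
  obtain ⟨b', hb', hbb⟩ := key b hb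
  obtain ⟨c', hc', hcc⟩ := key c hc
  have hmono {x y : E} (h : SameComponent (N ∩ U) x y) : SameComponent U x y :=
    h.mono inter_subset_right
  exact (h3 a' ha' b' hb' c' hc').imp (fun h => (haa.trans (hmono h)).trans hbb.symm)
    (Or.imp (fun h => (hbb.trans (hmono h)).trans hcc.symm)
      fun h => (haa.trans (hmono h)).trans hcc.symm)

end StarConvex

section Transfer

variable {X Y : Type*} [TopologicalSpace X] [TopologicalSpace Y]

theorem SameComponent.of_isInducing {f : X → Y} (hf : Topology.IsInducing f) {V : Set Y}
    (hV : V ⊆ range f) {a b : X} :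
    SameComponent V (f a) (f b) → SameComponent (f ⁻¹' V) a b := fun ⟨T, hT, hp, ha, hb⟩ =>
  ⟨f ⁻¹' T, preimage_mono hT, hf.isPreconnected_image.1
    (by rwa [image_preimage_eq_of_subset (hT.trans hV)]), ha, hb⟩

theorem sameComponent_univ_iff {a b : X} :
    SameComponent univ a b ↔ (a : ConnectedComponents X) = b := by
  rw [ConnectedComponents.coe_eq_coe']
  refine ⟨fun ⟨T, _, hp, ha, hb⟩ => hp.subset_connectedComponent hb ha, fun h =>
    ⟨_, subset_univ _, isPreconnected_connectedComponent, h, mem_connectedComponent⟩⟩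

theorem sameComponent_coe_iff {V : Set X} {a b : V} :
    SameComponent V a b ↔ (a : ConnectedComponents V) = b := by
  rw [← sameComponent_univ_iff]
  refine ⟨fun h => ?_, fun h => h.map continuous_subtype_val.continuousOn fun x _ => x.2⟩
  have := h.of_isInducing Topology.IsInducing.subtypeVal (by simp)
  rwa [Subtype.coe_preimage_self] at this

theorem card_connectedComponents_eq_two {V : Set X} (h : ∃ a ∈ V, ∃ b ∈ V, ¬ SameComponent V a b)
    (h' : ∀ a ∈ V, ∀ b ∈ V, ∀ c ∈ V,
      SameComponent V a b ∨ SameComponent V b c ∨ SameComponent V a c) :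
    Nat.card (ConnectedComponents V) = 2 := by
  obtain ⟨a, ha, b, hb, hab⟩ := h
  refine Nat.card_eq_two_iff.2 ⟨(⟨a, ha⟩ : V), (⟨b, hb⟩ : V),
    fun h => hab (sameComponent_coe_iff.2 h), eq_univ_of_forall fun x => ?_⟩
  obtain ⟨c, rfl⟩ := ConnectedComponents.surjective_coe x
  rcases h' a ha c c.2 b hb with h | h | h
  · exact Or.inl (sameComponent_coe_iff (a := ⟨a, ha⟩).1 h).symm
  · exact Or.inr (sameComponent_coe_iff (b := ⟨b, hb⟩).1 h)
  · exact absurd h hab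

theorem LocallyEuclidean2.exists_isChart {S : Set X} (hS : LocallyEuclidean2 S) (hc : IsCompact S)
    {ι : X → R4} (hι : Continuous ι) (hinj : Function.Injective ι) {x : X} (hx : x ∈ S) :
    ∃ γ, IsChart (ι '' S) γ ∧ γ 0 = ι x := by
  obtain ⟨V, hV, hxV, ⟨h⟩⟩ := hS ⟨x, hx⟩
  let k : ℂ ≃ₜ V := (Complex.orthonormalBasisOneI.repr.toHomeomorph.trans
    (Homeomorph.addRight (h ⟨_, hxV⟩))).trans h.symm
  have hk : k 0 = ⟨⟨x, hx⟩, hxV⟩ := by simp [k]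
  refine ⟨fun v => ι (k v), ⟨?_, ?_, fun v => mem_image_of_mem ι (k v).1.2, fun G hG => ?_⟩, ?_⟩
  · exact hι.comp (continuous_subtype_val.comp (continuous_subtype_val.comp k.continuous))
  · exact hinj.comp (Subtype.val_injective.comp (Subtype.val_injective.comp k.injective))
  · have hO : IsOpen (Subtype.val '' (k '' G) : Set S) :=
      hV.isOpenMap_subtype_val _ (k.isOpenMap _ hG)
    have := isCompact_iff_compactSpace.1 hc
    have hcomp := (hO.isClosed_compl.isCompact.image (hι.comp continuous_subtype_val)).isClosed
    convert hcomp using 1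
    ext y
    constructor
    · rintro ⟨⟨z, hz, rfl⟩, hy⟩
      refine ⟨⟨z, hz⟩, ?_, rfl⟩
      rintro ⟨_, ⟨v, hv, rfl⟩, hvz⟩
      exact hy ⟨v, hv, congrArg (fun p : S => ι p) hvz⟩
    · rintro ⟨z, hz, rfl⟩
      refine ⟨mem_image_of_mem ι z.2, ?_⟩
      rintro ⟨v, hv, hvz⟩
      exact hz ⟨k v, ⟨v, hv, rfl⟩, Subtype.val_injective (hinj hvz)⟩
  · simp only [hk]

end Transfer

section UnitSphere

variable {K : Set R4}

theorem sameComponent_normalize {a : R4} (ha : a ∈ coneCompl K) :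
    SameComponent (coneCompl K) a (‖a‖⁻¹ • a) :=
  sameComponent_of_segment_subset
    (segment_smul_subset_coneCompl ha (inv_pos.2 (norm_pos_iff.2 ha.1)))

theorem isPreconnected_diff_coneCompl (hK : ∀ x ∈ K, ‖x‖ = 1) (hp : IsPreconnected K) :
    IsPreconnected ({0}ᶜ \ coneCompl K) := by
  have : {0}ᶜ \ coneCompl K = (fun p : ℝ × R4 => p.1 • p.2) '' (Ioi 0 ×ˢ K) := by
    ext x
    constructor
    · rintro ⟨h0, hx⟩
      have h0' := norm_pos_iff.2 h0
      exact ⟨(‖x‖, ‖x‖⁻¹ • x), ⟨h0', by_contra fun h => hx ⟨h0, h⟩⟩,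
        smul_inv_smul₀ h0'.ne' x⟩
    · rintro ⟨⟨r, y⟩, ⟨hr, hy⟩, rfl⟩
      have hr : 0 < r := hr
      have hy1 := hK y hy
      have hy0 : y ≠ 0 := norm_pos_iff.1 (hy1 ▸ one_pos)
      refine ⟨smul_ne_zero hr.ne' hy0, fun h => h.2 ?_⟩
      simpa [norm_smul, hy1, abs_of_pos hr, smul_smul, hr.ne'] using hy
  rw [this]
  exact (isPreconnected_Ioi.prod hp).image _ (by fun_prop)

theorem exists_not_sameComponent_coneCompl (hKc : IsClosed K) (hK : ∀ x ∈ K, ‖x‖ = 1)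
    (hch : ∀ y ∈ K, ∃ γ, IsChart K γ ∧ γ 0 = y) (hne : K.Nonempty) :
    ∃ a ∈ coneCompl K, ∃ b ∈ coneCompl K, ¬ SameComponent (coneCompl K) a b := by
  obtain ⟨s, hs⟩ := hne
  obtain ⟨γ, hγ, rfl⟩ := hch s hs
  have h1 := hK _ (hγ.mem 1)
  refine exists_not_sameComponent (isOpen_coneCompl hKc) (isOpen_coneCompl isClosed_singleton)
    (coneCompl_anti (singleton_subset_iff.2 hs))
    (fun q hq hqK => twoSidedAt_coneCompl hKc hK hch hq.1 hqK)
    (neg_mem_coneCompl_singleton (hK _ hs)) (starConvex_coneCompl_singleton (hK _ hs))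
    (q := γ 1) ((mem_coneCompl_of_norm_eq_one h1).2 fun h => ?_)
    fun h => (mem_coneCompl_of_norm_eq_one h1).1 h (hγ.mem 1)
  exact one_ne_zero (hγ.injective h)

theorem sameComponent_coneCompl_or (hKc : IsClosed K) (hK : ∀ x ∈ K, ‖x‖ = 1)
    (hch : ∀ y ∈ K, ∃ γ, IsChart K γ ∧ γ 0 = y) (hne : K.Nonempty) (hp : IsPreconnected K)
    {a b c : R4} (ha : a ∈ coneCompl K) (hb : b ∈ coneCompl K) (hc : c ∈ coneCompl K) :
    SameComponent (coneCompl K) a b ∨ SameComponent (coneCompl K) b c ∨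
      SameComponent (coneCompl K) a c := by
  obtain ⟨s, hs⟩ := hne
  refine sameComponent_or_of_twoSidedAt (isOpen_coneCompl hKc)
    (isConnected_compl_singleton_of_one_lt_rank ?_ 0).isPreconnected (fun x hx => hx.1)
    (fun q hq hqK => twoSidedAt_coneCompl hKc hK hch hq hqK) (isPreconnected_diff_coneCompl hK hp)
    ⟨s, norm_pos_iff.1 (hK s hs ▸ one_pos),
      fun h => (mem_coneCompl_of_norm_eq_one (hK s hs)).1 h hs⟩ ha hb hc
  rw [← Module.finrank_eq_rank, finrank_euclideanSpace_fin]
  norm_num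

theorem card_connectedComponents_compl {X : Type*} [TopologicalSpace X] {S : Set X}
    (hne : S.Nonempty) (hc : IsCompact S) (hconn : IsConnected S) (hle : LocallyEuclidean2 S)
    {ι : X → R4} (hι : Topology.IsEmbedding ι) (hrange : range ι = Metric.sphere 0 1) :
    Nat.card (ConnectedComponents ↥(Sᶜ)) = 2 := by
  have hnorm : ∀ x, ‖ι x‖ = 1 := fun x => by
    simpa using hrange.subset (mem_range_self x)
  have hK : ∀ y ∈ ι '' S, ‖y‖ = 1 := by
    rintro _ ⟨x, -, rfl⟩
    exact hnorm x
  have hKc : IsClosed (ι '' S) := (hc.image hι.continuous).isClosed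
  have hch : ∀ y ∈ ι '' S, ∃ γ, IsChart (ι '' S) γ ∧ γ 0 = y := by
    rintro _ ⟨x, hx, rfl⟩
    exact hle.exists_isChart hc hι.continuous hι.injective hx
  have hmem : ∀ x, ι x ∈ coneCompl (ι '' S) ↔ x ∈ Sᶜ := fun x => by
    rw [mem_coneCompl_of_norm_eq_one (hnorm x), hι.injective.mem_set_image, mem_compl_iff]
  have hback : ∀ x y, SameComponent (coneCompl (ι '' S)) (ι x) (ι y) → SameComponent Sᶜ x y := by
    intro x y h
    have h' := h.map (W := coneCompl (ι '' S) ∩ range ι)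
      (continuousOn_normalize.mono fun v hv => hv.1) fun v hv => by
        rw [hrange, mem_inter_iff, mem_sphere_zero_iff_norm]
        exact ⟨normalized_mem_coneCompl hv, norm_normalized hv.1⟩
    simp only [hnorm, inv_one, one_smul] at h'
    exact (h'.of_isInducing hι.isInducing inter_subset_right).mono fun z hz => (hmem z).1 hz.1
  have hex : ∀ a ∈ coneCompl (ι '' S), ∃ x ∈ Sᶜ, SameComponent (coneCompl (ι '' S)) a (ι x) := by
    intro a ha
    have h := sameComponent_normalize ha
    obtain ⟨x, hx⟩ : ‖a‖⁻¹ • a ∈ range ι := by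
      rw [hrange, mem_sphere_zero_iff_norm]
      exact norm_normalized ha.1
    rw [← hx] at h
    exact ⟨x, (hmem x).1 h.right_mem, h⟩
  refine card_connectedComponents_eq_two ?_ fun a ha b hb c hc => ?_
  · obtain ⟨a, ha, b, hb, hab⟩ := exists_not_sameComponent_coneCompl hKc hK hch (hne.image ι)
    obtain ⟨x, hx, hax⟩ := hex a ha
    obtain ⟨y, hy, hby⟩ := hex b hb
    exact ⟨x, hx, y, hy, fun h => hab ((hax.trans (h.map hι.continuous.continuousOn
      fun z hz => (hmem z).2 hz)).trans hby.symm)⟩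
  · exact (sameComponent_coneCompl_or hKc hK hch (hne.image ι)
      (hconn.image ι hι.continuous.continuousOn).isPreconnected ((hmem a).2 ha) ((hmem b).2 hb)
      ((hmem c).2 hc)).imp (hback a b) (Or.imp (hback b c) (hback a c))

end UnitSphere

theorem exists_isEmbedding_S3 : ∃ ι : S3 → R4, Topology.IsEmbedding ι ∧
    range ι = Metric.sphere 0 1 := by
  let Φ : S3 ≃ₜ Metric.sphere (0 : R4) 1 := onePointEquivSphereOfFinrankEq (by simp)
  refine ⟨fun x => Φ x, Topology.IsEmbedding.subtypeVal.comp Φ.isEmbedding, ?_⟩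
  rw [← Function.comp_def, range_comp, Φ.range_coe, image_univ, Subtype.range_coe]

/-- A closed connected surface `S` in `S³` (a nonempty compact connected set that is
locally Euclidean of dimension 2) separates `S³` into exactly two connected components. -/
theorem surface_separates_sphere_into_two_components (S : Set S3) (hne : S.Nonempty)
    (hc : IsCompact S) (hconn : IsConnected S) (hle : LocallyEuclidean2 S) :
    Nat.card (ConnectedComponents ↥(Sᶜ)) = 2 := by
  obtain ⟨ι, hι, hrange⟩ := exists_isEmbedding_S3
  exact card_connectedComponents_compl hne hc hconn hle hι hrange
end
end
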